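/- arXiv:1901.06137 — 4 statements merged into one kernel-verified Lean document; each statement's English description precedes it below -/
import Mathlib

section
/- Let G=(X,Y;E) be a connected bipartite graph with d(x) ≥ d for every vertex x ∈ X, and suppose |X| ≥ |Y|. Then for every vertex y₀ ∈ Y, G has a maximal y₀-path whose terminus lies in X and whose order is at least 2d. -/
namespace SimpleGraph

variable {V : Type*} {G : SimpleGraph V} {X Y : Finset V}

/-- In a bipartite graph, a walk ending in `X` has twice as many vertices as it has vertices
in `Y`, plus one if it also starts in `X`. -/
theorem Walk.length_support_of_bipartite [DecidableEq V] (hdisj : Disjoint X Y)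
    (hbip : ∀ u v : V, G.Adj u v → (u ∈ X ∧ v ∈ Y) ∨ (u ∈ Y ∧ v ∈ X))
    {v x : V} (p : G.Walk v x) (hx : x ∈ X) :
    p.support.length = 2 * (p.support.filter (· ∈ Y)).length + if v ∈ X then 1 else 0 := by
  induction p with
  | nil => simp [hx, Finset.disjoint_left.mp hdisj hx]
  | @cons u w x h p ih =>
    have ih := ih hx
    rcases hbip _ _ h with ⟨hu, hw⟩ | ⟨hu, hw⟩
    · have hu' := Finset.disjoint_left.mp hdisj hu
      have hw' := Finset.disjoint_right.mp hdisj hw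
      simp only [hw', if_false] at ih
      simp [hu, hu', ih]
    · have hu' := Finset.disjoint_right.mp hdisj hu
      simp only [hw, if_true] at ih
      simp [hu, hu', ih]
      omega

/-- Depth-first search inside `S` from `v`: either some path from `v` within `S` ends at a vertex
of `X` other than `v` all of whose neighbours in `S` are on the path, or the explored set `T` is
closed under adjacency in `S` and has, apart from `v`, at least as many vertices in `Y` as
in `X`, with one to spare if `v ∈ X` unless `T = {v}`. -/
theorem exists_maximal_path_or_card_le [DecidableEq V]
    (hpart : ∀ v : V, v ∈ X ∨ v ∈ Y) (hdisj : Disjoint X Y)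
    (hbip : ∀ u v : V, G.Adj u v → (u ∈ X ∧ v ∈ Y) ∨ (u ∈ Y ∧ v ∈ X))
    (S : Finset V) (v : V) (hv : v ∈ S) :
    (∃ (x : V) (p : G.Walk v x), p.IsPath ∧ x ∈ X ∧ x ≠ v ∧ (∀ z ∈ p.support, z ∈ S) ∧
      ∀ z ∈ S, G.Adj x z → z ∈ p.support) ∨
    ∃ T ⊆ S, v ∈ T ∧ (∀ a ∈ T, ∀ b ∈ S, G.Adj a b → b ∈ T) ∧
      ((v ∈ Y ∧ (X ∩ T).card + 1 ≤ (Y ∩ T).card) ∨ (v ∈ X ∧ (X ∩ T).card ≤ (Y ∩ T).card) ∨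
        (v ∈ X ∧ T = {v})) := by
  induction hn : S.card using Nat.strong_induction_on generalizing S v with
  | _ n ih =>
  subst hn
  by_cases hnb : ∃ u ∈ S, G.Adj v u
  swap
  · refine .inr ⟨{v}, by simpa using hv, by simp, ?_, ?_⟩
    · intro a ha b hb hab
      rw [Finset.mem_singleton] at ha
      exact (hnb ⟨b, hb, ha ▸ hab⟩).elim
    · rcases hpart v with h | h
      · exact .inr (.inr ⟨h, rfl⟩)
      · have h' := Finset.disjoint_right.mp hdisj h
        exact .inl ⟨h, by simp [h, h']⟩
  obtain ⟨u, huS, hvu⟩ := hnb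
  have hu : u ∈ S.erase v := Finset.mem_erase.mpr ⟨hvu.ne', huS⟩
  rcases ih _ (Finset.card_erase_lt_of_mem hv) (S.erase v) u hu rfl with
    ⟨x, p, hp, hxX, -, hpS, hmax⟩ | ⟨T₁, hT₁S, huT₁, hcl₁, hT₁⟩
  · refine .inl ⟨x, .cons hvu p, ?_, hxX, ?_, ?_, ?_⟩
    · exact (Walk.cons_isPath_iff _ _).mpr ⟨hp, fun h => by simpa using hpS _ h⟩
    · exact (Finset.mem_erase.mp (hpS _ p.end_mem_support)).1
    · intro z hz
      rw [Walk.support_cons, List.mem_cons] at hz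
      rcases hz with rfl | hz
      · exact hv
      · exact Finset.mem_of_mem_erase (hpS _ hz)
    · intro z hz hxz
      rw [Walk.support_cons, List.mem_cons]
      by_cases hzv : z = v
      · exact .inl hzv
      · exact .inr (hmax z (Finset.mem_erase.mpr ⟨hzv, hz⟩) hxz)
  have hvT₁ : v ∉ T₁ := fun h => by simpa using hT₁S h
  have hT₁S' : T₁ ⊆ S := hT₁S.trans (Finset.erase_subset _ _)
  have hlt : (S \ T₁).card < S.card :=
    Finset.card_lt_card (Finset.sdiff_ssubset hT₁S' ⟨u, huT₁⟩)
  rcases ih _ hlt (S \ T₁) v (Finset.mem_sdiff.mpr ⟨hv, hvT₁⟩) rfl with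
    ⟨x, p, hp, hxX, hxv, hpS, hmax⟩ | ⟨T₂, hT₂S, hvT₂, hcl₂, hT₂⟩
  · refine .inl ⟨x, p, hp, hxX, hxv, fun z hz => (Finset.mem_sdiff.mp (hpS z hz)).1, ?_⟩
    intro z hz hxz
    have hx := Finset.mem_sdiff.mp (hpS x p.end_mem_support)
    refine hmax z (Finset.mem_sdiff.mpr ⟨hz, fun hzT => hx.2 ?_⟩) hxz
    exact hcl₁ z hzT x (Finset.mem_erase.mpr ⟨hxv, hx.1⟩) hxz.symm
  by_cases hsing : u ∈ X ∧ T₁ = {u}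
  · obtain ⟨huX, rfl⟩ := hsing
    refine .inl ⟨u, .cons hvu .nil, ?_, huX, hvu.ne', ?_, ?_⟩
    · simp [hvu.ne]
    · simp [hv, huS]
    · intro z hz huz
      by_cases hzv : z = v
      · simp [hzv]
      · have := hcl₁ u (by simp) z (Finset.mem_erase.mpr ⟨hzv, hz⟩) huz
        simp_all
  have hd : Disjoint T₁ T₂ :=
    Finset.disjoint_left.mpr fun a h₁ h₂ => (Finset.mem_sdiff.mp (hT₂S h₂)).2 h₁
  have hcard (Z : Finset V) : (Z ∩ (T₁ ∪ T₂)).card = (Z ∩ T₁).card + (Z ∩ T₂).card := by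
    rw [Finset.inter_union_distrib_left, Finset.card_union_of_disjoint]
    exact hd.mono Finset.inter_subset_right Finset.inter_subset_right
  refine .inr ⟨T₁ ∪ T₂, Finset.union_subset hT₁S' (hT₂S.trans Finset.sdiff_subset),
    Finset.mem_union_right _ hvT₂, ?_, ?_⟩
  · intro a ha b hb hab
    rw [Finset.mem_union] at ha ⊢
    by_cases hb₁ : b ∈ T₁
    · exact .inl hb₁
    rcases ha with ha | ha
    · by_cases hbv : b = v
      · exact .inr (hbv ▸ hvT₂)
      · exact .inl (hcl₁ a ha b (Finset.mem_erase.mpr ⟨hbv, hb⟩) hab)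
    · exact .inr (hcl₂ a ha b (Finset.mem_sdiff.mpr ⟨hb, hb₁⟩) hab)
  · rw [hcard, hcard]
    have hdj : ∀ a ∈ X, a ∉ Y := fun a ha => Finset.disjoint_left.mp hdisj ha
    rcases hbip _ _ hvu with ⟨hvX, huY⟩ | ⟨hvY, huX⟩
    · have huX : u ∉ X := fun h => hdj u h huY
      have h₁ : (X ∩ T₁).card + 1 ≤ (Y ∩ T₁).card := by tauto
      refine .inr (.inl ⟨hvX, ?_⟩)
      rcases hT₂ with ⟨hvY, -⟩ | ⟨-, h⟩ | ⟨-, rfl⟩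
      · exact (hdj v hvX hvY).elim
      · omega
      · have : (X ∩ {v}).card ≤ 1 := (Finset.card_le_card Finset.inter_subset_right).trans (by simp)
        omega
    · have hvX : v ∉ X := fun h => hdj v h hvY
      have huY : u ∉ Y := hdj u huX
      have h₁ : (X ∩ T₁).card ≤ (Y ∩ T₁).card := by tauto
      have h₂ : (X ∩ T₂).card + 1 ≤ (Y ∩ T₂).card := by tauto
      exact .inl ⟨hvY, by omega⟩

/-- In a connected graph, a set of vertices that is closed under adjacency and contains some
vertex contains every vertex. -/
theorem Connected.mem_of_adj_closed (hconn : G.Connected) {T : Finset V} {v : V} (hv : v ∈ T)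
    (hT : ∀ a ∈ T, ∀ b, G.Adj a b → b ∈ T) (w : V) : w ∈ T := by
  obtain ⟨p⟩ := hconn.preconnected v w
  induction p with
  | nil => exact hv
  | cons h p ih => exact ih (hT _ hv _ h)

end SimpleGraph


/-- **Lemma (Li–Ning).** Let `G = (X,Y;E)` be a connected bipartite graph with `d(x) ≥ d`
for every `x ∈ X`, and `|X| ≥ |Y|`. Then for every `y₀ ∈ Y`, `G` has a maximal `y₀`-path
(a path whose terminus `x` satisfies `N_G(x) ⊆ V(P)`) with terminus in `X` and of order at
least `2d`. -/
theorem stmt_8 {V : Type} [Fintype V] [DecidableEq V]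
    (G : SimpleGraph V) [DecidableRel G.Adj] (X Y : Finset V) (d : ℕ)
    (hpart : ∀ v : V, v ∈ X ∨ v ∈ Y) (hdisj : Disjoint X Y)
    (hbip : ∀ u v : V, G.Adj u v → (u ∈ X ∧ v ∈ Y) ∨ (u ∈ Y ∧ v ∈ X))
    (hconn : G.Connected)
    (hdeg : ∀ x ∈ X, d ≤ G.degree x)
    (hXY : Y.card ≤ X.card)
    (y₀ : V) (hy₀ : y₀ ∈ Y) :
    ∃ (x : V) (p : G.Walk y₀ x), p.IsPath ∧ x ∈ X ∧
      (∀ z : V, G.Adj x z → z ∈ p.support) ∧ 2 * d ≤ p.support.length := by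
  rcases SimpleGraph.exists_maximal_path_or_card_le hpart hdisj hbip Finset.univ y₀
    (Finset.mem_univ _) with ⟨x, p, hp, hx, -, -, hmax⟩ | ⟨T, -, hyT, hcl, hT⟩
  · have hmax' : ∀ z : V, G.Adj x z → z ∈ p.support := fun z => hmax z (Finset.mem_univ z)
    refine ⟨x, p, hp, hx, hmax', ?_⟩
    have hlen := p.length_support_of_bipartite hdisj hbip hx
    have hsub : G.neighborFinset x ⊆ (p.support.filter (· ∈ Y)).toFinset := by
      intro z hz
      rw [SimpleGraph.mem_neighborFinset] at hz
      have hzY : z ∈ Y := by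
        rcases hbip _ _ hz with h | h
        · exact h.2
        · exact (Finset.disjoint_left.mp hdisj hx h.1).elim
      simp [hmax' z hz, hzY]
    have h₁ := (Finset.card_le_card hsub).trans (List.toFinset_card_le _)
    rw [SimpleGraph.card_neighborFinset_eq_degree] at h₁
    have h₂ := hdeg x hx
    omega
  · have hTu : T = Finset.univ := Finset.eq_univ_iff_forall.mpr
      (hconn.mem_of_adj_closed hyT fun a ha b => hcl a ha b (Finset.mem_univ b))
    have hyX := Finset.disjoint_right.mp hdisj hy₀
    subst hTu
    simp only [Finset.inter_univ] at hT
    rcases hT with ⟨-, h⟩ | ⟨h, -⟩ | ⟨h, -⟩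
    · omega
    · exact (hyX h).elim
    · exact (hyX h).elim
end

section
/- Let G=(X,Y;E) be a connected bipartite graph with d(x) ≥ d for every vertex x ∈ X, and suppose |X| > |Y|. Then for every vertex x₀ ∈ X, G has a maximal x₀-path whose terminus lies in X and whose order is at least 2d+1. -/
namespace SimpleGraph

variable {V : Type*} [DecidableEq V] {G : SimpleGraph V}

/-- Every nonempty part of `D` has an edge leaving it inside `insert v D`; for `v ∉ D` this says
that `insert v D` induces a connected subgraph. -/
def IsAttached (G : SimpleGraph V) (v : V) (D : Finset V) : Prop :=
  ∀ A ⊆ D, A.Nonempty → ∃ a ∈ A, ∃ b ∈ insert v D, b ∉ A ∧ G.Adj a b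

theorem Connected.isAttached_erase_univ [Fintype V] (h : G.Connected) (v : V) :
    G.IsAttached v (Finset.univ.erase v) := by
  intro A hA ⟨a, ha⟩
  obtain ⟨p⟩ := h.preconnected a v
  have hv : v ∉ (A : Set V) := fun hv => by simpa using hA (Finset.mem_coe.1 hv)
  obtain ⟨e, -, h₁, h₂⟩ := p.exists_boundary_dart (A : Set V) (Finset.mem_coe.2 ha) hv
  exact ⟨e.fst, by simpa using h₁, e.snd, by simp, by simpa using h₂, e.adj⟩

theorem IsAttached.exists_adj {v : V} {D : Finset V} (h : G.IsAttached v D)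
    (hD : D.Nonempty) : ∃ w ∈ D, G.Adj v w := by
  obtain ⟨a, ha, b, hb, hbD, hab⟩ := h D subset_rfl hD
  rw [Finset.mem_insert] at hb
  obtain rfl : b = v := hb.resolve_right hbD
  exact ⟨a, ha, hab.symm⟩

/-- The component of `w` in the subgraph induced by `D`. -/
theorem exists_isAttached_erase_no_adj {w : V} {D : Finset V} (hw : w ∈ D) :
    ∃ C ⊆ D, w ∈ C ∧ G.IsAttached w (C.erase w) ∧ ∀ a ∈ C, ∀ b ∈ D \ C, ¬ G.Adj a b := by
  classical
  let S := D.powerset.filter fun C => w ∈ C ∧ G.IsAttached w (C.erase w)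
  have hS : S.Nonempty := by
    refine ⟨{w}, ?_⟩
    simp only [S, Finset.mem_filter, Finset.mem_powerset, Finset.singleton_subset_iff,
      Finset.mem_singleton, true_and, hw]
    intro A hA hne
    simp only [Finset.erase_singleton, Finset.subset_empty] at hA
    simp [hA] at hne
  obtain ⟨C, hC, hmax⟩ := S.exists_max_image Finset.card hS
  simp only [S, Finset.mem_filter, Finset.mem_powerset] at hC hmax
  obtain ⟨hCD, hwC, hatt⟩ := hC
  refine ⟨C, hCD, hwC, hatt, fun a ha b hb hab => ?_⟩
  rw [Finset.mem_sdiff] at hb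
  have key : G.IsAttached w ((insert b C).erase w) := by
    intro A hA hne
    by_cases hAb : (A.erase b).Nonempty
    · obtain ⟨a', ha', b', hb', hb'A, hadj⟩ := hatt (A.erase b) (by
        intro z hz
        have := hA (Finset.mem_of_mem_erase hz)
        grind) hAb
      exact ⟨a', Finset.mem_of_mem_erase ha', b', by grind, by grind, hadj⟩
    · have hA' : A = {b} := by
        rw [Finset.not_nonempty_iff_eq_empty, Finset.erase_eq_empty_iff] at hAb
        exact hAb.resolve_left hne.ne_empty
      subst hA'
      exact ⟨b, by simp, a, by grind, by grind, hab.symm⟩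
  have := hmax (insert b C) ⟨by grind, by grind, key⟩
  rw [Finset.card_insert_of_notMem hb.2] at this
  omega

theorem IsAttached.sdiff {v : V} {C D : Finset V} (h : G.IsAttached v D)
    (hC : ∀ a ∈ C, ∀ b ∈ D \ C, ¬ G.Adj a b) : G.IsAttached v (D \ C) := by
  intro A hA hne
  obtain ⟨a, ha, b, hb, hbA, hab⟩ := h A (hA.trans Finset.sdiff_subset) hne
  have hbC : b ∉ C := fun hbC => hC b hbC a (hA ha) hab.symm
  exact ⟨a, ha, b, by grind, hbA, hab⟩

/-- `G` has a path inside `D` from a neighbour of `v` to a vertex of `X` which has no neighbour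
in `D` outside the path. -/
def HasMaximalPathFrom (G : SimpleGraph V) (X : Finset V) (v : V) (D : Finset V) : Prop :=
  ∃ (w x : V) (p : G.Walk w x), G.Adj v w ∧ p.IsPath ∧ (∀ z ∈ p.support, z ∈ D) ∧ x ∈ X ∧
    ∀ z ∈ D, G.Adj x z → z ∈ p.support

theorem HasMaximalPathFrom.mono {X : Finset V} {v : V} {C D : Finset V} (hCD : C ⊆ D)
    (hC : ∀ a ∈ C, ∀ b ∈ D \ C, ¬ G.Adj a b) (h : G.HasMaximalPathFrom X v C) :
    G.HasMaximalPathFrom X v D := by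
  obtain ⟨w, x, p, hvw, hp, hs, hx, hmax⟩ := h
  refine ⟨w, x, p, hvw, hp, fun z hz => hCD (hs z hz), hx, fun z hz hxz => ?_⟩
  have := hC x (hs x p.end_mem_support) z
  exact hmax z (by grind) hxz

theorem HasMaximalPathFrom.of_erase {X : Finset V} {v w : V} {C : Finset V} (hvw : G.Adj v w)
    (hw : w ∈ C) (h : G.HasMaximalPathFrom X w (C.erase w)) : G.HasMaximalPathFrom X v C := by
  obtain ⟨u, x, p, hwu, hp, hs, hx, hmax⟩ := h
  refine ⟨w, x, p.cons hwu, hvw, ?_, ?_, hx, ?_⟩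
  · rw [Walk.cons_isPath_iff]
    exact ⟨hp, fun h => by simpa using hs w h⟩
  · intro z hz
    rw [Walk.support_cons, List.mem_cons] at hz
    rcases hz with rfl | hz
    · exact hw
    · exact Finset.mem_of_mem_erase (hs z hz)
  · intro z hz hxz
    rw [Walk.support_cons, List.mem_cons]
    by_cases hzw : z = w
    · exact Or.inl hzw
    · exact Or.inr (hmax z (Finset.mem_erase.2 ⟨hzw, hz⟩) hxz)

theorem hasMaximalPathFrom_singleton {X : Finset V} {v w : V} (hvw : G.Adj v w) (hw : w ∈ X) :
    G.HasMaximalPathFrom X v {w} :=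
  ⟨w, w, .nil, hvw, .nil, by simp, hw, by simp⟩

/-- If no depth-first search from `v` into `D` gets stuck in `X`, then `X` is no larger than `Y`
in `D`, and is strictly smaller if `v ∈ X` and `D` is nonempty. -/
theorem IsAttached.hasMaximalPathFrom_or_card_le {X Y : Finset V} (hdisj : Disjoint X Y)
    (hbip : ∀ u v : V, G.Adj u v → (u ∈ X ∧ v ∈ Y) ∨ (u ∈ Y ∧ v ∈ X)) {v : V} {D : Finset V}
    (h : G.IsAttached v D) :
    G.HasMaximalPathFrom X v D ∨
      ((D ∩ X).card ≤ (D ∩ Y).card ∧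
        (v ∈ X → D.Nonempty → (D ∩ X).card < (D ∩ Y).card)) := by
  induction hn : D.card using Nat.strong_induction_on generalizing v D with
  | _ n ih =>
  subst hn
  rcases D.eq_empty_or_nonempty with rfl | hD
  · simp
  obtain ⟨w, hwD, hvw⟩ := h.exists_adj hD
  obtain ⟨C, hCD, hwC, hC, hno⟩ := exists_isAttached_erase_no_adj (G := G) hwD
  have hCcard := Finset.card_le_card hCD
  have hcard : (D \ C).card + C.card = D.card := Finset.card_sdiff_add_card_eq_card hCD
  have hCpos : 0 < C.card := Finset.card_pos.2 ⟨w, hwC⟩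
  have hno' : ∀ a ∈ D \ C, ∀ b ∈ D \ (D \ C), ¬ G.Adj a b := by
    intro a ha b hb hab
    exact hno b (by grind) a ha hab.symm
  rcases ih _ (by omega) (h.sdiff hno) rfl with hp | ⟨hle, -⟩
  · exact Or.inl (hp.mono Finset.sdiff_subset hno')
  rcases ih _ (by rw [Finset.card_erase_of_mem hwC]; omega) hC rfl with hp | ⟨hle', hlt'⟩
  · exact Or.inl ((hp.of_erase hvw hwC).mono hCD hno)
  have hsum (Z : Finset V) : (D ∩ Z).card = ((D \ C) ∩ Z).card + (C ∩ Z).card := by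
    rw [← Finset.card_union_of_disjoint]
    · congr 1
      grind
    · rw [Finset.disjoint_left]
      grind
  have herase {Z : Finset V} (hZ : w ∈ Z) : (C ∩ Z).card = (C.erase w ∩ Z).card + 1 := by
    rw [Finset.erase_inter, Finset.card_erase_add_one (Finset.mem_inter.2 ⟨hwC, hZ⟩)]
  have herase' {Z : Finset V} (hZ : w ∉ Z) : (C ∩ Z).card = (C.erase w ∩ Z).card := by
    rw [Finset.erase_inter, Finset.erase_eq_of_notMem (by simp [hZ])]
  rw [hsum X, hsum Y]
  rcases hbip _ _ hvw with ⟨hv, hw⟩ | ⟨hv, hw⟩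
  · have hwX : w ∉ X := Finset.disjoint_right.1 hdisj hw
    rw [herase hw, herase' hwX]
    exact Or.inr ⟨by omega, fun _ _ => by omega⟩
  · have hwY : w ∉ Y := Finset.disjoint_left.1 hdisj hw
    have hvX : v ∉ X := Finset.disjoint_right.1 hdisj hv
    rcases (C.erase w).eq_empty_or_nonempty with he | hne
    · have hCw : C = {w} := by
        rw [← Finset.insert_erase hwC, he]
        rfl
      rw [hCw] at hCD hno
      exact Or.inl ((hasMaximalPathFrom_singleton hvw hw).mono hCD hno)
    · have := hlt' hw hne
      rw [herase hw, herase' hwY]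
      exact Or.inr ⟨by omega, fun h => absurd h hvX⟩

theorem Walk.length_support_eq_of_bipartition {X Y : Finset V} (hdisj : Disjoint X Y)
    (hbip : ∀ u v : V, G.Adj u v → (u ∈ X ∧ v ∈ Y) ∨ (u ∈ Y ∧ v ∈ X)) {u x : V}
    (p : G.Walk u x) (hx : x ∈ X) :
    (u ∈ X → p.support.length = 2 * (p.support.filter (· ∈ Y)).length + 1) ∧
      (u ∈ Y → p.support.length = 2 * (p.support.filter (· ∈ Y)).length) := by
  induction p with
  | nil =>
    have := Finset.disjoint_left.1 hdisj hx
    simp [this]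
  | @cons a b c hab p ih =>
    obtain ⟨ih₁, ih₂⟩ := ih hx
    rw [Walk.support_cons, List.length_cons]
    rcases hbip _ _ hab with ⟨ha, hb⟩ | ⟨ha, hb⟩
    · have haY := Finset.disjoint_left.1 hdisj ha
      rw [List.filter_cons_of_neg (by simpa using haY)]
      exact ⟨fun _ => by rw [ih₂ hb], fun h => absurd h haY⟩
    · have haX := Finset.disjoint_right.1 hdisj ha
      rw [List.filter_cons_of_pos (by simpa using ha), List.length_cons]
      exact ⟨fun h => absurd h haX, fun _ => by rw [ih₁ hb]; ring⟩

theorem Walk.two_mul_degree_add_one_le_length_support {X Y : Finset V} (hdisj : Disjoint X Y)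
    (hbip : ∀ u v : V, G.Adj u v → (u ∈ X ∧ v ∈ Y) ∨ (u ∈ Y ∧ v ∈ X)) {u x : V}
    [Fintype (G.neighborSet x)] (p : G.Walk u x) (hu : u ∈ X) (hx : x ∈ X)
    (hmax : ∀ z, G.Adj x z → z ∈ p.support) :
    2 * G.degree x + 1 ≤ p.support.length := by
  rw [(p.length_support_eq_of_bipartition hdisj hbip hx).1 hu]
  have hsub : G.neighborFinset x ⊆ (p.support.filter (· ∈ Y)).toFinset := by
    intro z hz
    rw [mem_neighborFinset] at hz
    have hzY : z ∈ Y := by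
      rcases hbip _ _ hz with h | h
      · exact h.2
      · exact absurd h.1 (Finset.disjoint_left.1 hdisj hx)
    simp [hmax z hz, hzY]
  have := (Finset.card_le_card hsub).trans (List.toFinset_card_le _)
  rw [card_neighborFinset_eq_degree] at this
  omega

end SimpleGraph


/-- **Lemma (Li–Ning).** Let `G = (X,Y;E)` be a connected bipartite graph with `d(x) ≥ d`
for every `x ∈ X`, and `|X| > |Y|`. Then for every `x₀ ∈ X`, `G` has a maximal `x₀`-path
(a path whose terminus `x` satisfies `N_G(x) ⊆ V(P)`) with terminus in `X` and of order at
least `2d + 1`. -/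
theorem stmt_9 {V : Type} [Fintype V] [DecidableEq V]
    (G : SimpleGraph V) [DecidableRel G.Adj] (X Y : Finset V) (d : ℕ)
    (hpart : ∀ v : V, v ∈ X ∨ v ∈ Y) (hdisj : Disjoint X Y)
    (hbip : ∀ u v : V, G.Adj u v → (u ∈ X ∧ v ∈ Y) ∨ (u ∈ Y ∧ v ∈ X))
    (hconn : G.Connected)
    (hdeg : ∀ x ∈ X, d ≤ G.degree x)
    (hXY : Y.card < X.card)
    (x₀ : V) (hx₀ : x₀ ∈ X) :
    ∃ (x : V) (p : G.Walk x₀ x), p.IsPath ∧ x ∈ X ∧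
      (∀ z : V, G.Adj x z → z ∈ p.support) ∧ 2 * d + 1 ≤ p.support.length := by
  have key : ∃ (x : V) (p : G.Walk x₀ x), p.IsPath ∧ x ∈ X ∧
      ∀ z : V, G.Adj x z → z ∈ p.support := by
    rcases (hconn.isAttached_erase_univ x₀).hasMaximalPathFrom_or_card_le hdisj hbip with
      ⟨w, x, p, hw, hp, hs, hx, hmax⟩ | ⟨-, hlt⟩
    · refine ⟨x, p.cons hw, ?_, hx, fun z hxz => ?_⟩
      · rw [SimpleGraph.Walk.cons_isPath_iff]
        exact ⟨hp, fun h => by simpa using hs x₀ h⟩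
      · rw [SimpleGraph.Walk.support_cons, List.mem_cons]
        by_cases hz : z = x₀
        · exact Or.inl hz
        · exact Or.inr (hmax z (by simp [hz]) hxz)
    · rcases (Finset.univ.erase x₀).eq_empty_or_nonempty with he | hne
      · refine ⟨x₀, .nil, .nil, hx₀, fun z hz => ?_⟩
        have : z ∈ Finset.univ.erase x₀ := by simp [hz.ne']
        simp [he] at this
      · have := hlt hx₀ hne
        have hY : x₀ ∉ Y := Finset.disjoint_left.1 hdisj hx₀
        rw [Finset.erase_inter, Finset.erase_inter, Finset.univ_inter, Finset.univ_inter,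
          Finset.card_erase_of_mem hx₀, Finset.erase_eq_of_notMem hY] at this
        omega
  obtain ⟨x, p, hp, hx, hmax⟩ := key
  have := p.two_mul_degree_add_one_le_length_support hdisj hbip hx₀ hx hmax
  have := hdeg x hx
  exact ⟨x, p, hp, hx, hmax, by omega⟩
end

section
/- Let G=(X,Y;E) be a balanced bipartite graph with connectivity 1, and let {x₀, x₀'} ⊆ X be a good pair of G. Suppose ρ_G({x,y}) ≥ ρ for every pair of vertices x ∈ X and y ∈ Y. Then G has a detached maximal {x₀,x₀'}-disjoint path pair of order at least ρ+1. -/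
/-- `rhoEdges G S` = number of edges of `G` incident to at least one vertex of `S`. -/
noncomputable def rhoEdges {V : Type} (G : SimpleGraph V) (S : Set V) : ℕ :=
  {e ∈ G.edgeSet | ∃ v ∈ S, v ∈ e}.ncard

/-- `v` is a cut-vertex of `G`: `G` is connected but `G - v` is not. -/
def IsCutVertex {V : Type} (G : SimpleGraph V) (v : V) : Prop :=
  G.Connected ∧ ¬ (G.induce {u : V | u ≠ v}).Connected

/-- The induced subgraph on `B` is connected and has no cut-vertex of its own. -/
def NoOwnCutVertex {V : Type} (G : SimpleGraph V) (B : Set V) : Prop :=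
  (G.induce B).Connected ∧ ∀ v ∈ B, B = {v} ∨ (G.induce (B \ {v})).Connected

/-- `B` is a block of `G`: a maximal set inducing a connected subgraph with no
cut-vertex of its own. -/
def IsBlock {V : Type} (G : SimpleGraph V) (B : Set V) : Prop :=
  NoOwnCutVertex G B ∧ ∀ B' : Set V, B ⊆ B' → NoOwnCutVertex G B' → B' = B

/-- `B` is an end-block of `G`: a block containing exactly one cut-vertex of `G`. -/
def IsEndBlock {V : Type} (G : SimpleGraph V) (B : Set V) : Prop :=
  IsBlock G B ∧ ∃! v : V, v ∈ B ∧ IsCutVertex G v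

/-- `{u, v}` is a good pair of `G`: there is an end-block `B` of `G` such that exactly one
of `u, v` is an inner-vertex of `B` (a vertex of `B` that is not a cut-vertex of `G`). -/
def GoodPair {V : Type} (G : SimpleGraph V) (u v : V) : Prop :=
  ∃ B : Set V, IsEndBlock G B ∧
    Xor' (u ∈ B ∧ ¬ IsCutVertex G u) (v ∈ B ∧ ¬ IsCutVertex G v)

/-- The signed size of `S`: vertices of `X` count `1`, all other vertices count `-1`. -/
def balance {V : Type} [DecidableEq V] (X S : Finset V) : ℤ :=
  ∑ v ∈ S, if v ∈ X then 1 else -1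

/-- The set `H` is nonempty and no nonempty proper subset of it is closed under adjacency
within `H`. -/
def CutConnected {V : Type} (G : SimpleGraph V) (H : Finset V) : Prop :=
  H.Nonempty ∧ ∀ K ⊆ H, K.Nonempty → (∀ a ∈ K, ∀ b ∈ H, G.Adj a b → b ∈ K) → K = H

/-- `K` is the vertex set of a connected component of the subgraph induced on `S`. -/
def IsComponent {V : Type} (G : SimpleGraph V) (S K : Finset V) : Prop :=
  K ⊆ S ∧ CutConnected G K ∧ ∀ a ∈ K, ∀ b ∈ S, G.Adj a b → b ∈ K

/-- Some path from `r` inside `H` ends in `X` and cannot be extended inside `H`. -/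
def HasMaximalPath {V : Type} (G : SimpleGraph V) (X H : Finset V) (r : V) : Prop :=
  ∃ t ∈ X, ∃ p : G.Walk r t, p.IsPath ∧ (∀ z ∈ p.support, z ∈ H) ∧
    ∀ z ∈ H, G.Adj t z → z ∈ p.support

/-- The edges of `G` join `X` to its complement. -/
def IsBipartition {V : Type} (G : SimpleGraph V) (X : Finset V) : Prop :=
  ∀ a b : V, G.Adj a b → (a ∈ X ↔ b ∉ X)

/-- `G` has a detached maximal `{a, b}`-disjoint path pair, with respect to the bipartition
`(X, Xᶜ)`. -/
def HasDetachedPair {V : Type} (G : SimpleGraph V) (X : Finset V) (a b : V) : Prop :=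
  ∃ (s t : V) (p : G.Walk a s) (q : G.Walk b t), p.IsPath ∧ q.IsPath ∧
    (∀ z, z ∈ p.support → z ∉ q.support) ∧
    (∀ z, G.Adj s z → z ∈ p.support ∨ z ∈ q.support) ∧
    (∀ z, G.Adj t z → z ∈ p.support ∨ z ∈ q.support) ∧ (s ∈ X ↔ t ∉ X)

section PathPairs

variable {V : Type} {G : SimpleGraph V} {X H S K : Finset V}

theorem HasDetachedPair.symm {a b : V} (h : HasDetachedPair G X a b) :
    HasDetachedPair G X b a := by
  obtain ⟨s, t, p, q, hp, hq, hd, hs, ht, hst⟩ := h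
  exact ⟨t, s, q, p, hq, hp, fun z hz hz' => hd z hz' hz, fun z hz => (ht z hz).symm,
    fun z hz => (hs z hz).symm, by tauto⟩

theorem IsComponent.support_subset {a b : V} (hK : IsComponent G S K) (p : G.Walk a b)
    (ha : a ∈ K) (hp : ∀ z ∈ p.support, z ∈ S) : ∀ z ∈ p.support, z ∈ K := by
  induction p with
  | nil => simpa using ha
  | cons h p ih =>
    simp only [SimpleGraph.Walk.support_cons, List.mem_cons, forall_eq_or_imp] at hp ⊢
    exact ⟨ha, ih (hK.2.2 _ ha _ (hp.2 _ p.start_mem_support) h) hp.2⟩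

theorem exists_isPath_join {a b c d : V} (p : G.Walk a b) (q : G.Walk c d) (hp : p.IsPath)
    (hq : q.IsPath) (h : G.Adj b c) (hd : ∀ z ∈ p.support, z ∉ q.support) :
    ∃ m : G.Walk a d, m.IsPath ∧ ∀ z, z ∈ m.support ↔ z ∈ p.support ∨ z ∈ q.support := by
  have hs : (p.append (.cons h q)).support = p.support ++ q.support := by
    rw [SimpleGraph.Walk.support_append]; rfl
  refine ⟨p.append (.cons h q), ?_, fun z => by rw [hs, List.mem_append]⟩
  rw [SimpleGraph.Walk.isPath_def, hs, List.nodup_append']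
  exact ⟨hp.support_nodup, hq.support_nodup, fun z hz hz' => hd z hz hz'⟩

variable [DecidableEq V]

theorem balance_sdiff_add (X : Finset V) (h : K ⊆ S) :
    balance X (S \ K) + balance X K = balance X S :=
  Finset.sum_sdiff h

theorem balance_erase_add (X : Finset V) {v : V} (h : v ∈ S) :
    balance X (S.erase v) + (if v ∈ X then 1 else -1) = balance X S :=
  Finset.sum_erase_add _ _ h

theorem balance_compl [Fintype V] (X S : Finset V) : balance Xᶜ S = -balance X S := by
  unfold balance
  rw [← Finset.sum_neg_distrib]
  refine Finset.sum_congr rfl fun v _ => ?_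
  by_cases h : v ∈ X <;> simp [h]

theorem IsBipartition.compl [Fintype V] (h : IsBipartition G X) : IsBipartition G Xᶜ := by
  intro a b hab
  have := h a b hab
  simp only [Finset.mem_compl]
  tauto

theorem exists_isComponent {v : V} (hv : v ∈ S) : ∃ K, IsComponent G S K ∧ v ∈ K := by
  classical
  let F := S.powerset.filter fun K => v ∈ K ∧ ∀ a ∈ K, ∀ b ∈ S, G.Adj a b → b ∈ K
  have hF : F.Nonempty := ⟨S, by simp only [F, Finset.mem_filter, Finset.mem_powerset]; tauto⟩
  obtain ⟨K, hK, hmin⟩ := Finset.exists_min_image F Finset.card hF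
  simp only [F, Finset.mem_filter, Finset.mem_powerset] at hK hmin
  obtain ⟨hKS, hvK, hcl⟩ := hK
  refine ⟨K, ⟨hKS, ⟨⟨v, hvK⟩, fun L hL hne hLcl => ?_⟩, hcl⟩, hvK⟩
  by_cases hvL : v ∈ L
  · refine Finset.eq_of_subset_of_card_le hL (hmin L ⟨hL.trans hKS, hvL, fun a ha b hb hab => ?_⟩)
    exact hLcl a ha b (hcl a (hL ha) b hb hab) hab
  · have h := hmin (K \ L) ⟨Finset.sdiff_subset.trans hKS, by simp [hvK, hvL],
      fun a ha b hb hab => ?_⟩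
    · have h2 := Finset.card_sdiff_add_card_eq_card hL
      have h3 := hne.card_pos
      omega
    · rw [Finset.mem_sdiff] at ha ⊢
      exact ⟨hcl a ha.1 b hb hab, fun hbL => ha.2 (hLcl b hbL a ha.1 hab.symm)⟩

theorem IsComponent.of_sdiff {L : Finset V} (hK : IsComponent G S K)
    (hL : IsComponent G (S \ K) L) : IsComponent G S L := by
  refine ⟨hL.1.trans Finset.sdiff_subset, hL.2.1, fun a ha b hb hab => ?_⟩
  have haS := Finset.mem_sdiff.1 (hL.1 ha)
  exact hL.2.2 a ha b (Finset.mem_sdiff.2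
    ⟨hb, fun hbK => haS.2 (hK.2.2 b hbK a haS.1 hab.symm)⟩) hab

theorem balance_nonpos_of_components (X : Finset V)
    (h : ∀ K, IsComponent G S K → balance X K ≤ 0) : balance X S ≤ 0 := by
  induction S using Finset.strongInduction with
  | H S ih =>
    rcases S.eq_empty_or_nonempty with rfl | ⟨v, hv⟩
    · simp [balance]
    · obtain ⟨K, hK, hvK⟩ := exists_isComponent (G := G) hv
      have h1 := ih (S \ K) (Finset.sdiff_ssubset hK.1 ⟨v, hvK⟩)
        fun L hL => h L (hK.of_sdiff hL)
      have h2 := h K hK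
      have h3 := balance_sdiff_add X hK.1
      omega

theorem balance_nonneg_of_components (X : Finset V)
    (h : ∀ K, IsComponent G S K → 0 ≤ balance X K) : 0 ≤ balance X S := by
  induction S using Finset.strongInduction with
  | H S ih =>
    rcases S.eq_empty_or_nonempty with rfl | ⟨v, hv⟩
    · simp [balance]
    · obtain ⟨K, hK, hvK⟩ := exists_isComponent (G := G) hv
      have h1 := ih (S \ K) (Finset.sdiff_ssubset hK.1 ⟨v, hvK⟩)
        fun L hL => h L (hK.of_sdiff hL)
      have h2 := h K hK
      have h3 := balance_sdiff_add X hK.1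
      omega

theorem IsComponent.balance_eq_zero (hK : IsComponent G S K)
    (h : ∀ K, IsComponent G S K → balance X K ≤ 0) (hS : balance X S = 0) :
    balance X K = 0 := by
  have h1 : balance X (S \ K) ≤ 0 :=
    balance_nonpos_of_components (G := G) X fun L hL => h L (hK.of_sdiff hL)
  have h2 := h K hK
  have h3 := balance_sdiff_add X hK.1
  omega

theorem CutConnected.exists_adj {r : V} (hH : CutConnected G H) (hr : r ∈ H)
    (hK : IsComponent G (H.erase r) K) : ∃ z ∈ K, G.Adj r z := by
  by_contra! hno
  have h := hH.2 K (hK.1.trans (Finset.erase_subset _ _)) hK.2.1.1 fun a ha b hb hab => by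
    refine hK.2.2 a ha b (Finset.mem_erase.2 ⟨?_, hb⟩) hab
    rintro rfl
    exact hno a ha hab.symm
  have := hK.1 (h ▸ hr)
  simp at this

theorem CutConnected.exists_isPath {a b : V} (hH : CutConnected G H) (ha : a ∈ H)
    (hb : b ∈ H) : ∃ p : G.Walk a b, p.IsPath ∧ ∀ z ∈ p.support, z ∈ H := by
  classical
  suffices h : ∃ p : G.Walk a b, ∀ z ∈ p.support, z ∈ H by
    obtain ⟨p, hp⟩ := h
    exact ⟨p.bypass, p.bypass_isPath, fun z hz => hp z (p.support_bypass_subset_support hz)⟩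
  have h := hH.2 (H.filter fun x => ∃ p : G.Walk a x, ∀ z ∈ p.support, z ∈ H)
    (Finset.filter_subset _ _) ⟨a, by simpa using ⟨ha, .nil, by simpa using ha⟩⟩
    fun x hx y hy hxy => by
      rw [Finset.mem_filter] at hx ⊢
      obtain ⟨-, p, hp⟩ := hx
      refine ⟨hy, p.concat hxy, fun z hz => ?_⟩
      rw [SimpleGraph.Walk.support_concat] at hz
      simp only [List.mem_append, List.mem_singleton] at hz
      rcases hz with hz | rfl
      · exact hp z hz
      · exact hy
  rw [← h, Finset.mem_filter] at hb
  exact hb.2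

theorem two_mul_balance_support (hX : IsBipartition G X) {a b : V} (p : G.Walk a b)
    (hp : p.IsPath) : 2 * balance X p.support.toFinset =
      (if a ∈ X then 1 else -1) + (if b ∈ X then 1 else -1) := by
  induction p with
  | @nil u => by_cases h : u ∈ X <;> simp [balance, h]
  | @cons u v w h p ih =>
    rw [SimpleGraph.Walk.cons_isPath_iff] at hp
    have h1 := ih hp.1
    have h2 := hX u v h
    have h3 : balance X (SimpleGraph.Walk.cons h p).support.toFinset =
        (if u ∈ X then 1 else -1) + balance X p.support.toFinset := by
      rw [SimpleGraph.Walk.support_cons, List.toFinset_cons]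
      exact Finset.sum_insert (by simpa using hp.2)
    rw [h3, mul_add, h1]
    by_cases hu : u ∈ X <;> by_cases hv : v ∈ X <;> simp_all <;> ring

theorem HasMaximalPath.of_component {r z : V} (hr : r ∈ H)
    (hK : IsComponent G (H.erase r) K) (hz : G.Adj r z) (h : HasMaximalPath G X K z) :
    HasMaximalPath G X H r := by
  obtain ⟨t, ht, p, hp, hpK, hmax⟩ := h
  refine ⟨t, ht, .cons hz p, ?_, ?_, ?_⟩
  · rw [SimpleGraph.Walk.cons_isPath_iff]
    refine ⟨hp, fun hrp => ?_⟩
    have := hK.1 (hpK r hrp)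
    simp at this
  · simp only [SimpleGraph.Walk.support_cons, List.mem_cons, forall_eq_or_imp]
    exact ⟨hr, fun x hx => Finset.mem_of_mem_erase (hK.1 (hpK x hx))⟩
  · intro x hx hadj
    rw [SimpleGraph.Walk.support_cons, List.mem_cons]
    by_cases hxr : x = r
    · exact .inl hxr
    · exact .inr (hmax x (hK.2.2 t (hpK t p.end_mem_support) x
        (Finset.mem_erase.2 ⟨hxr, hx⟩) hadj) hadj)

theorem balance_le_of_not_hasMaximalPath (hX : IsBipartition G X) {r : V}
    (hH : CutConnected G H) (hr : r ∈ H) (hno : ¬ HasMaximalPath G X H r) :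
    balance X H ≤ if r ∈ X then 0 else -1 := by
  induction hn : H.card using Nat.strong_induction_on generalizing H r with
  | _ n ih =>
    have hle : ∀ K, IsComponent G (H.erase r) K →
        balance X K ≤ if r ∈ X then -1 else 0 := by
      intro K hK
      obtain ⟨z, hz, hrz⟩ := hH.exists_adj hr hK
      have hcard : K.card < n := hn ▸ Finset.card_lt_card
        (hK.1.trans_ssubset (Finset.erase_ssubset hr))
      have h1 := ih _ hcard hK.2.1 hz (fun h => hno (h.of_component hr hK hrz)) rfl
      have h2 := hX r z hrz
      by_cases hrX : r ∈ X <;> simp_all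
    have h3 := balance_erase_add X hr
    by_cases hrX : r ∈ X
    · simp only [hrX, if_true] at hle h3 ⊢
      rcases (H.erase r).eq_empty_or_nonempty with he | ⟨v, hv⟩
      · refine absurd ⟨r, hrX, .nil, by simp, by simpa using hr, fun z hz hadj => ?_⟩ hno
        have : z ∈ H.erase r := Finset.mem_erase.2 ⟨hadj.ne', hz⟩
        simp [he] at this
      · obtain ⟨K, hK, -⟩ := exists_isComponent (G := G) hv
        have h4 : balance X (H.erase r \ K) ≤ 0 :=
          balance_nonpos_of_components (G := G) X fun L hL =>
            (hle L (hK.of_sdiff hL)).trans (by norm_num)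
        have h5 := hle K hK
        have h6 := balance_sdiff_add X hK.1
        omega
    · simp only [hrX, if_false] at hle h3 ⊢
      have h4 := balance_nonpos_of_components (G := G) X hle
      omega

theorem hasMaximalPath_of_pos (hX : IsBipartition G X) {r : V} (hH : CutConnected G H)
    (hr : r ∈ H) (h : 0 < balance X H) : HasMaximalPath G X H r := by
  by_contra hno
  have := balance_le_of_not_hasMaximalPath hX hH hr hno
  split_ifs at this <;> omega

theorem hasMaximalPath_of_nonneg (hX : IsBipartition G X) {r : V} (hH : CutConnected G H)
    (hr : r ∈ H) (hrX : r ∉ X) (h : 0 ≤ balance X H) : HasMaximalPath G X H r := by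
  by_contra hno
  have := balance_le_of_not_hasMaximalPath hX hH hr hno
  rw [if_neg hrX] at this
  omega

theorem hasMaximalPath_compl_of_neg [Fintype V] (hX : IsBipartition G X) {r : V}
    (hH : CutConnected G H) (hr : r ∈ H) (h : balance X H < 0) :
    HasMaximalPath G Xᶜ H r :=
  hasMaximalPath_of_pos hX.compl hH hr (by rw [balance_compl]; omega)

theorem hasMaximalPath_compl_of_nonpos [Fintype V] (hX : IsBipartition G X) {r : V}
    (hH : CutConnected G H) (hr : r ∈ H) (hrX : r ∈ X) (h : balance X H ≤ 0) :
    HasMaximalPath G Xᶜ H r :=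
  hasMaximalPath_of_nonneg hX.compl hH hr (by simpa using hrX) (by rw [balance_compl]; omega)

theorem balance_component_sdiff_path_nonpos (hX : IsBipartition G X) {r t : V}
    (hH : CutConnected G H) (hno : ¬ HasMaximalPath G X H r) (p : G.Walk r t)
    (hp : p.IsPath) (hpH : ∀ z ∈ p.support, z ∈ H)
    (hK : IsComponent G (H \ p.support.toFinset) K) : balance X K ≤ 0 := by
  have key : ∀ {r : V} {H K : Finset V}, r ∈ H → CutConnected G H →
      ¬ HasMaximalPath G X H r → IsComponent G (H.erase r) K → balance X K ≤ 0 := by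
    intro r H K hr hH hno hK
    obtain ⟨z, hz, hrz⟩ := hH.exists_adj hr hK
    have := balance_le_of_not_hasMaximalPath hX hK.2.1 hz
      fun h => hno (h.of_component hr hK hrz)
    split_ifs at this <;> omega
  induction p generalizing H with
  | @nil u =>
    refine key (by simpa using hpH) hH hno (?_ : IsComponent G (H.erase u) K)
    simpa [Finset.sdiff_singleton_eq_erase] using hK
  | @cons u v w h p ih =>
    rw [SimpleGraph.Walk.cons_isPath_iff] at hp
    simp only [SimpleGraph.Walk.support_cons, List.mem_cons, forall_eq_or_imp] at hpH
    have hpE : ∀ z ∈ p.support, z ∈ H.erase u := fun z hz =>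
      Finset.mem_erase.2 ⟨fun e => hp.2 (e ▸ hz), hpH.2 z hz⟩
    obtain ⟨L, hL, hvL⟩ := exists_isComponent (G := G) (hpE v p.start_mem_support)
    have hpL := hL.support_subset p hvL hpE
    have hmem : ∀ z, z ∈ H \ (SimpleGraph.Walk.cons h p).support.toFinset ↔
        z ∈ H.erase u ∧ z ∉ p.support := by
      intro z
      simp only [SimpleGraph.Walk.support_cons, Finset.mem_sdiff, List.mem_toFinset,
        List.mem_cons, Finset.mem_erase]
      tauto
    by_cases hKL : (K ∩ L).Nonempty
    · have hsub : K ⊆ L := by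
        rw [← hK.2.1.2 (K ∩ L) Finset.inter_subset_left hKL fun a ha b hb hab => ?_]
        · exact Finset.inter_subset_right
        · rw [Finset.mem_inter] at ha ⊢
          exact ⟨hb, hL.2.2 a ha.2 b ((hmem b).1 (hK.1 hb)).1 hab⟩
      refine ih hL.2.1 (fun h' => hno (h'.of_component hpH.1 hL h)) hp.1 hpL
        ⟨fun x hx => ?_, hK.2.1, fun a ha b hb hab => ?_⟩
      · simpa using ⟨hsub hx, ((hmem x).1 (hK.1 hx)).2⟩
      · simp only [Finset.mem_sdiff, List.mem_toFinset] at hb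
        exact hK.2.2 a ha b ((hmem b).2 ⟨hL.1 hb.1, hb.2⟩) hab
    · refine key hpH.1 hH hno ⟨fun x hx => ((hmem x).1 (hK.1 hx)).1, hK.2.1,
        fun a ha b hb hab => hK.2.2 a ha b ((hmem b).2 ⟨hb, fun hbp => hKL ⟨a, ?_⟩⟩) hab⟩
      exact Finset.mem_inter.2
        ⟨ha, hL.2.2 b (hpL b hbp) a ((hmem a).1 (hK.1 ha)).1 hab.symm⟩

/-- If all maximal paths from `r` in `H` end outside `X` and the balance of `H` is that of such a
path, then `H` has a detached maximal `{r, w}`-disjoint path pair, for each `w ∉ X ∪ {r}`. -/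
theorem exists_pair_of_not_hasMaximalPath [Fintype V] (hX : IsBipartition G X) {r w : V}
    (hH : CutConnected G H) (hr : r ∈ H) (hw : w ∈ H) (hwX : w ∉ X) (hwr : w ≠ r)
    (hno : ¬ HasMaximalPath G X H r) (hbal : 2 * balance X H = (if r ∈ X then 1 else -1) - 1) :
    ∃ s ∈ X, ∃ t ∉ X, ∃ (p : G.Walk r s) (q : G.Walk w t), p.IsPath ∧ q.IsPath ∧
      (∀ z ∈ p.support, z ∈ H) ∧ (∀ z ∈ q.support, z ∈ H) ∧
      (∀ z ∈ p.support, z ∉ q.support) ∧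
      (∀ z ∈ H, G.Adj s z → z ∈ p.support ∨ z ∈ q.support) ∧
      (∀ z ∈ H, G.Adj t z → z ∈ p.support ∨ z ∈ q.support) := by
  obtain ⟨u, p, hp, hpH, hwp, huw⟩ : ∃ (u : V) (p : G.Walk r u), p.IsPath ∧
      (∀ z ∈ p.support, z ∈ H) ∧ w ∉ p.support ∧ G.Adj u w := by
    obtain ⟨m, hm, hmH⟩ := hH.exists_isPath hw hr
    cases m with
    | nil => exact absurd rfl hwr
    | @cons _ u _ h m =>
      rw [SimpleGraph.Walk.cons_isPath_iff] at hm
      simp only [SimpleGraph.Walk.support_cons, List.mem_cons, forall_eq_or_imp] at hmH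
      exact ⟨u, m.reverse, hm.1.reverse, by simpa using hmH.2, by simpa using hm.2, h.symm⟩
  have huX : u ∈ X := (hX u w huw).2 hwX
  obtain ⟨L, hL, hwL⟩ := exists_isComponent (G := G) (S := H \ p.support.toFinset) (v := w)
    (by simpa using ⟨hw, hwp⟩)
  have hLH : ∀ z ∈ L, z ∈ H ∧ z ∉ p.support := fun z hz => by simpa using hL.1 hz
  have hnoL : ¬ HasMaximalPath G X L w := by
    rintro ⟨t, ht, q, hq, hqL, hmax⟩
    obtain ⟨m, hm, hms⟩ := exists_isPath_join p q hp hq huw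
      fun z hz hz' => (hLH z (hqL z hz')).2 hz
    refine hno ⟨t, ht, m, hm, fun z hz => ?_, fun z hz hadj => (hms z).2 ?_⟩
    · rcases (hms z).1 hz with h | h
      · exact hpH z h
      · exact (hLH z (hqL z h)).1
    · by_cases hzp : z ∈ p.support
      · exact .inl hzp
      · exact .inr (hmax z (hL.2.2 t (hqL t q.end_mem_support) z (by simpa using ⟨hz, hzp⟩) hadj)
          hadj)
  obtain ⟨t, ht, q, hq, hqL, hmax⟩ : HasMaximalPath G Xᶜ L w := by
    refine hasMaximalPath_compl_of_neg hX hL.2.1 hwL ?_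
    by_contra! h
    exact hnoL (hasMaximalPath_of_nonneg hX hL.2.1 hwL hwX h)
  rw [Finset.mem_compl] at ht
  have hqH : ∀ z ∈ q.support, z ∈ H := fun z hz => (hLH z (hqL z hz)).1
  have hpq : ∀ z ∈ p.support, z ∉ q.support := fun z hz hz' => (hLH z (hqL z hz')).2 hz
  have htmax : ∀ z ∈ H, G.Adj t z → z ∈ p.support ∨ z ∈ q.support := fun z hz hadj => by
    by_cases hzp : z ∈ p.support
    · exact .inl hzp
    · exact .inr (hmax z (hL.2.2 t (hqL t q.end_mem_support) z (by simpa using ⟨hz, hzp⟩) hadj)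
        hadj)
  by_cases hall : ∀ z ∈ H, G.Adj u z → z ∈ p.support ∨ z ∈ q.support
  · exact ⟨u, huX, t, ht, p, q, hp, hq, hpH, hqH, hpq, hall, htmax⟩
  push Not at hall
  obtain ⟨z, hz, huz, hzp, hzq⟩ := hall
  obtain ⟨m, hm, hms⟩ := exists_isPath_join p q hp hq huw hpq
  have hmH : ∀ z ∈ m.support, z ∈ H := fun z hz => ((hms z).1 hz).elim (hpH z) (hqH z)
  obtain ⟨K, hK, hzK⟩ := exists_isComponent (G := G) (S := H \ m.support.toFinset) (v := z)
    (by simpa [hms] using ⟨hz, hzp, hzq⟩)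
  have hKH : ∀ z ∈ K, z ∈ H ∧ z ∉ p.support ∧ z ∉ q.support := fun z hz => by
    simpa [hms] using hK.1 hz
  have hbalK : balance X K = 0 := by
    refine hK.balance_eq_zero
      (fun K hK => balance_component_sdiff_path_nonpos hX hH hno m hm hmH hK) ?_
    have h1 := two_mul_balance_support hX m hm
    have h2 := balance_sdiff_add X (show m.support.toFinset ⊆ H from fun z hz =>
      hmH z (by simpa using hz))
    rw [if_neg ht] at h1
    omega
  obtain ⟨s, hs, p', hp', hp'K, hsmax⟩ := hasMaximalPath_of_nonneg hX hK.2.1 hzK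
    ((hX u z huz).1 huX) hbalK.ge
  obtain ⟨m', hm', hms'⟩ := exists_isPath_join p p' hp hp' huz
    fun z hz hz' => (hKH z (hp'K z hz')).2.1 hz
  refine ⟨s, hs, t, ht, m', q, hm', hq, fun x hx => ?_, hqH, fun x hx hxq => ?_,
    fun x hx hadj => ?_, fun x hx hadj => ?_⟩
  · exact ((hms' x).1 hx).elim (hpH x) fun h => (hKH x (hp'K x h)).1
  · exact ((hms' x).1 hx).elim (fun h => hpq x h hxq) fun h => (hKH x (hp'K x h)).2.2 hxq
  · rw [hms']
    by_cases h1 : x ∈ p.support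
    · exact .inl (.inl h1)
    by_cases h2 : x ∈ q.support
    · exact .inr h2
    exact .inl (.inr (hsmax x (hK.2.2 s (hp'K s p'.end_mem_support) x
      (by simpa [hms] using ⟨hx, h1, h2⟩) hadj) hadj))
  · rw [hms']
    exact (htmax x hx hadj).imp_left .inl

/-- For `c ∉ X`, either some maximal path of `H` from `r` that ends outside `X` contains `c`, or
`H` has a maximal `{c, r}`-disjoint path pair whose first path ends in `X` and whose second path
ends outside `X`. -/
theorem exists_path_through_or_pair [Fintype V] (hX : IsBipartition G X) {r c : V}
    (hH : CutConnected G H) (hr : r ∈ H) (hc : c ∈ H) (hcX : c ∉ X)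
    (hbal : balance X H ≤ if r ∈ X then 0 else -1) :
    (∃ t ∉ X, ∃ q : G.Walk r t, q.IsPath ∧ (∀ z ∈ q.support, z ∈ H) ∧ c ∈ q.support ∧
      ∀ z ∈ H, G.Adj t z → z ∈ q.support) ∨
    ∃ s ∈ X, ∃ t ∉ X, ∃ (p : G.Walk c s) (q : G.Walk r t), p.IsPath ∧ q.IsPath ∧
      (∀ z ∈ p.support, z ∈ H) ∧ (∀ z ∈ q.support, z ∈ H) ∧
      (∀ z ∈ p.support, z ∉ q.support) ∧
      (∀ z ∈ H, G.Adj s z → z ∈ p.support ∨ z ∈ q.support) ∧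
      (∀ z ∈ H, G.Adj t z → z ∈ p.support ∨ z ∈ q.support) := by
  induction hn : H.card using Nat.strong_induction_on generalizing H r with
  | _ n ih =>
    by_cases hrc : r = c
    · subst hrc
      rw [if_neg hcX] at hbal
      obtain ⟨t, ht, q, hq, hqH, hmax⟩ :=
        hasMaximalPath_compl_of_neg hX hH hr (show balance X H < 0 by omega)
      exact .inl ⟨t, Finset.mem_compl.1 ht, q, hq, hqH, q.start_mem_support, hmax⟩
    obtain ⟨K, hK, hcK⟩ := exists_isComponent (G := G)
      (Finset.mem_erase.2 ⟨Ne.symm hrc, hc⟩)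
    obtain ⟨z, hzK, hrz⟩ := hH.exists_adj hr hK
    have hrzX := hX r z hrz
    have hcons : ∀ {L : Finset V}, IsComponent G (H.erase r) L → ∀ {y t : V} (q : G.Walk y t),
        q.IsPath → (∀ x ∈ q.support, x ∈ L) → G.Adj r y → ∃ m : G.Walk r t, m.IsPath ∧
          ∀ x, x ∈ m.support ↔ x = r ∨ x ∈ q.support := by
      intro L hL y t q hq hqL hry
      obtain ⟨m, hm, hms⟩ := exists_isPath_join (.nil : G.Walk r r) q .nil hq hry
        fun x hx hxq => by
          have := hL.1 (hqL x hxq)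
          simp only [SimpleGraph.Walk.support_nil, List.mem_singleton] at hx
          simp [hx] at this
      exact ⟨m, hm, fun x => by simpa using hms x⟩
    by_cases hKbal : balance X K ≤ if z ∈ X then 0 else -1
    · have hcard : K.card < n := hn ▸ Finset.card_lt_card
        (hK.1.trans_ssubset (Finset.erase_ssubset hr))
      have hKH : ∀ x ∈ K, x ∈ H := fun x hx => Finset.mem_of_mem_erase (hK.1 hx)
      have hclosed : ∀ x ∈ H, ∀ y ∈ K, G.Adj y x → x = r ∨ x ∈ K := fun x hx y hy hyx => by
        by_cases hxr : x = r
        · exact .inl hxr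
        · exact .inr (hK.2.2 y hy x (Finset.mem_erase.2 ⟨hxr, hx⟩) hyx)
      rcases ih _ hcard hK.2.1 hzK hcK hKbal rfl with
        ⟨t, ht, q, hq, hqK, hcq, hmax⟩ | ⟨s, hs, t, ht, p, q, hp, hq, hpK, hqK, hpq, hsmax, htmax⟩
      · obtain ⟨m, hm, hms⟩ := hcons hK q hq hqK hrz
        refine .inl ⟨t, ht, m, hm, fun x hx => ?_, (hms c).2 (.inr hcq), fun x hx hadj => ?_⟩
        · rcases (hms x).1 hx with rfl | h
          · exact hr
          · exact hKH x (hqK x h)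
        · exact (hms x).2 ((hclosed x hx t (hqK t q.end_mem_support) hadj).imp_right
            fun h => hmax x h hadj)
      · obtain ⟨m, hm, hms⟩ := hcons hK q hq hqK hrz
        refine .inr ⟨s, hs, t, ht, p, m, hp, hm, fun x hx => hKH x (hpK x hx), fun x hx => ?_,
          fun x hx hxm => ?_, fun x hx hadj => ?_, fun x hx hadj => ?_⟩
        · rcases (hms x).1 hx with rfl | h
          · exact hr
          · exact hKH x (hqK x h)
        · rcases (hms x).1 hxm with rfl | h
          · have := hK.1 (hpK x hx)
            simp at this
          · exact hpq x hx h
        · rw [hms]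
          rcases hclosed x hx s (hpK s p.end_mem_support) hadj with h | h
          · exact .inr (.inl h)
          · exact (hsmax x h hadj).imp_right .inr
        · rw [hms]
          rcases hclosed x hx t (hqK t q.end_mem_support) hadj with h | h
          · exact .inr (.inl h)
          · exact (htmax x h hadj).imp_right .inr
    · obtain ⟨L, hL, hLbal⟩ : ∃ L, IsComponent G (H.erase r \ K) L ∧ balance X L < 0 := by
        by_contra! hno
        have h1 := balance_nonneg_of_components X hno
        have h2 := balance_sdiff_add X hK.1
        have h3 := balance_erase_add X hr
        by_cases hrX : r ∈ X <;> simp_all <;> omega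
      have hL' := hK.of_sdiff hL
      obtain ⟨y, hyL, hry⟩ := hH.exists_adj hr hL'
      obtain ⟨t, ht, q, hq, hqL, htmax⟩ := hasMaximalPath_compl_of_neg hX hL'.2.1 hyL hLbal
      obtain ⟨s, hs, p, hp, hpK, hsmax⟩ := hasMaximalPath_of_nonneg hX hK.2.1 hcK hcX
        (by by_cases hzX : z ∈ X <;> simp_all <;> omega)
      obtain ⟨m, hm, hms⟩ := hcons hL' q hq hqL hry
      refine .inr ⟨s, hs, t, Finset.mem_compl.1 ht, p, m, hp, hm,
        fun x hx => Finset.mem_of_mem_erase (hK.1 (hpK x hx)), fun x hx => ?_,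
        fun x hx hxm => ?_, fun x hx hadj => ?_, fun x hx hadj => ?_⟩
      · rcases (hms x).1 hx with rfl | h
        · exact hr
        · exact Finset.mem_of_mem_erase (hL'.1 (hqL x h))
      · rcases (hms x).1 hxm with rfl | h
        · have := hK.1 (hpK x hx)
          simp at this
        · exact (Finset.mem_sdiff.1 (hL.1 (hqL x h))).2 (hpK x hx)
      · rw [hms]
        by_cases hxr : x = r
        · exact .inr (.inl hxr)
        · exact .inl (hsmax x (hK.2.2 s (hpK s p.end_mem_support) x
            (Finset.mem_erase.2 ⟨hxr, hx⟩) hadj) hadj)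
      · rw [hms]
        by_cases hxr : x = r
        · exact .inr (.inl hxr)
        · exact .inr (.inr (htmax x (hL'.2.2 t (hqL t q.end_mem_support) x
            (Finset.mem_erase.2 ⟨hxr, hx⟩) hadj) hadj))

section CutVertex

variable [Fintype V] {c : V}

theorem HasDetachedPair.compl {a b : V} (h : HasDetachedPair G Xᶜ a b) :
    HasDetachedPair G X a b := by
  obtain ⟨s, t, p, q, hp, hq, hd, hs, ht, hst⟩ := h
  refine ⟨s, t, p, q, hp, hq, hd, hs, ht, ?_⟩
  simp only [Finset.mem_compl] at hst
  tauto

theorem balance_compl_right (h : balance X Finset.univ = 0) (H : Finset V) :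
    balance X Hᶜ = -balance X H := by
  have := balance_sdiff_add X (Finset.subset_univ H)
  rw [Finset.compl_eq_univ_sdiff]
  omega

theorem IsComponent.notMem_cut (hH : IsComponent G (Finset.univ.erase c) H) : c ∉ H :=
  fun h => by simpa using hH.1 h

theorem IsComponent.eq_cut_or_mem (hH : IsComponent G (Finset.univ.erase c) H) {y z : V}
    (hy : y ∈ H) (hyz : G.Adj y z) : z = c ∨ z ∈ H := by
  by_cases h : z = c
  · exact .inl h
  · exact .inr (hH.2.2 y hy z (by simpa using h) hyz)

theorem IsComponent.cutConnected_compl (hG : CutConnected G (Finset.univ : Finset V))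
    (hH : IsComponent G (Finset.univ.erase c) H) : CutConnected G Hᶜ := by
  have hc := hH.notMem_cut
  have key : ∀ K ⊆ Hᶜ, c ∉ K → (∀ a ∈ K, ∀ b ∈ Hᶜ, G.Adj a b → b ∈ K) → K = ∅ := by
    intro K hK hcK hcl
    by_contra hne
    have h := hG.2 K (Finset.subset_univ _) (Finset.nonempty_iff_ne_empty.2 hne)
      fun a ha b _ hab => by
        by_cases hb : b ∈ H
        · rcases hH.eq_cut_or_mem hb hab.symm with rfl | h
          · exact absurd ha hcK
          · exact absurd h (Finset.mem_compl.1 (hK ha))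
        · exact hcl a ha b (Finset.mem_compl.2 hb) hab
    exact hcK (h ▸ Finset.mem_univ c)
  refine ⟨⟨c, Finset.mem_compl.2 hc⟩, fun K hK hne hcl => ?_⟩
  by_cases hcK : c ∈ K
  · refine hK.antisymm (Finset.sdiff_eq_empty_iff_subset.1 (key (Hᶜ \ K)
      Finset.sdiff_subset (by simp [hcK]) fun a ha b hb hab => ?_))
    rw [Finset.mem_sdiff] at ha ⊢
    exact ⟨hb, fun hbK => ha.2 (hcl b hbK a ha.1 hab.symm)⟩
  · exact absurd (key K hK hcK hcl) hne.ne_empty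

/-- A path from `a` through the component `H` to the cut-vertex `c`. -/
theorem IsComponent.exists_isPath_cut (hG : CutConnected G (Finset.univ : Finset V))
    (hH : IsComponent G (Finset.univ.erase c) H) {a : V} (ha : a ∈ H) :
    ∃ p : G.Walk a c, p.IsPath ∧ ∀ z ∈ p.support, z = c ∨ z ∈ H := by
  obtain ⟨z, hz, hcz⟩ := hG.exists_adj (Finset.mem_univ c) hH
  obtain ⟨p, hp, hpH⟩ := hH.2.1.exists_isPath ha hz
  obtain ⟨m, hm, hms⟩ := exists_isPath_join p (.nil : G.Walk c c) hp .nil hcz.symm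
    fun x hx hxc => hH.notMem_cut (by
      simp only [SimpleGraph.Walk.support_nil, List.mem_singleton] at hxc
      exact hxc ▸ hpH x hx)
  refine ⟨m, hm, fun x hx => ?_⟩
  rcases (hms x).1 hx with h | h
  · exact .inr (hpH x h)
  · exact .inl (by simpa using h)

theorem hasDetachedPair_of_maximalPaths (hX : IsBipartition G X) (hc : c ∈ X)
    (hH : IsComponent G (Finset.univ.erase c) H) {a b : V} (ha : HasMaximalPath G X H a)
    (hb : HasMaximalPath G Xᶜ Hᶜ b) : HasDetachedPair G X a b := by
  obtain ⟨s, hs, p, hp, hpH, hsmax⟩ := ha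
  obtain ⟨t, ht, q, hq, hqH, htmax⟩ := hb
  rw [Finset.mem_compl] at ht
  refine ⟨s, t, p, q, hp, hq, fun z hz hzq => Finset.mem_compl.1 (hqH z hzq) (hpH z hz),
    fun z hz => .inl ?_, fun z hz => .inr ?_, by tauto⟩
  · rcases hH.eq_cut_or_mem (hpH s p.end_mem_support) hz with rfl | h
    · exact absurd hc ((hX s z hz).1 hs)
    · exact hsmax z h hz
  · refine htmax z (Finset.mem_compl.2 fun h => ?_) hz
    rcases hH.eq_cut_or_mem h hz.symm with rfl | h'
    · exact ht hc
    · exact Finset.mem_compl.1 (hqH t q.end_mem_support) h'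

theorem hasDetachedPair_of_path_through_cut (hG : CutConnected G (Finset.univ : Finset V))
    (hH : IsComponent G (Finset.univ.erase c) H) (hK : IsComponent G (Finset.univ.erase c) K)
    (hHK : Disjoint K H) {a b : V} (p : G.Walk a c) (hp : p.IsPath)
    (hpH : ∀ z ∈ p.support, z ∉ H) (hpK : ∀ z ∈ p.support, z ∉ K)
    (ha : ∀ z ∈ K, G.Adj c z → HasMaximalPath G X K z) (hb : HasMaximalPath G Xᶜ H b) :
    HasDetachedPair G X a b := by
  obtain ⟨z, hz, hcz⟩ := hG.exists_adj (Finset.mem_univ c) hK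
  obtain ⟨s, hs, p', hp', hp'K, hsmax⟩ := ha z hz hcz
  obtain ⟨t, ht, q, hq, hqH, htmax⟩ := hb
  rw [Finset.mem_compl] at ht
  obtain ⟨m, hm, hms⟩ := exists_isPath_join p p' hp hp' hcz fun x hx hx' => hpK x hx (hp'K x hx')
  refine ⟨s, t, m, q, hm, hq, fun x hx hxq => ?_, fun x hx => ?_, fun x hx => ?_, by tauto⟩
  · rcases (hms x).1 hx with h | h
    · exact hpH x h (hqH x hxq)
    · exact Finset.disjoint_left.1 hHK (hp'K x h) (hqH x hxq)
  · rw [hms]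
    rcases hK.eq_cut_or_mem (hp'K s p'.end_mem_support) hx with rfl | h
    · exact .inl (.inl p.end_mem_support)
    · exact .inl (.inr (hsmax x h hx))
  · rw [hms]
    rcases hH.eq_cut_or_mem (hqH t q.end_mem_support) hx with rfl | h
    · exact .inl (.inl p.end_mem_support)
    · exact .inr (htmax x h hx)

theorem hasDetachedPair_of_not_hasMaximalPath (hX : IsBipartition G X)
    (hG : CutConnected G (Finset.univ : Finset V))
    (hH : IsComponent G (Finset.univ.erase c) H) {a b w : V} (ha : a ∈ H) (hb : b ∉ H)
    (hw : w ∈ H) (hcw : G.Adj c w) (hwX : w ∉ X) (hwa : w ≠ a)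
    (hno : ¬ HasMaximalPath G X H a)
    (hbal : 2 * balance X H = (if a ∈ X then 1 else -1) - 1) : HasDetachedPair G X a b := by
  obtain ⟨s, hs, t, ht, p, q, hp, hq, hpH, hqH, hpq, hsmax, htmax⟩ :=
    exists_pair_of_not_hasMaximalPath hX hH.2.1 ha hw hwX hwa hno hbal
  obtain ⟨p', hp', hp'H⟩ := (hH.cutConnected_compl hG).exists_isPath (Finset.mem_compl.2 hb)
    (Finset.mem_compl.2 hH.notMem_cut)
  obtain ⟨m, hm, hms⟩ := exists_isPath_join p' q hp' hq hcw
    fun x hx hxq => Finset.mem_compl.1 (hp'H x hx) (hqH x hxq)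
  have hmax : ∀ {y z : V}, y ∈ H → G.Adj y z →
      (z ∈ H → G.Adj y z → z ∈ p.support ∨ z ∈ q.support) → z ∈ p.support ∨ z ∈ m.support := by
    intro y z hy hyz h
    rw [hms]
    rcases hH.eq_cut_or_mem hy hyz with rfl | hz
    · exact .inr (.inl p'.end_mem_support)
    · exact (h hz hyz).imp_right .inr
  refine ⟨s, t, p, m, hp, hm, fun x hx hxm => ?_,
    fun x hx => hmax (hpH s p.end_mem_support) hx (hsmax x),
    fun x hx => hmax (hqH t q.end_mem_support) hx (htmax x), by tauto⟩
  rcases (hms x).1 hxm with h | h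
  · exact Finset.mem_compl.1 (hp'H x h) (hpH x hx)
  · exact hpq x hx h

theorem hasDetachedPair_of_balance_nonneg (hX : IsBipartition G X)
    (hG : CutConnected G (Finset.univ : Finset V)) (hbal : balance X Finset.univ = 0)
    (hH : IsComponent G (Finset.univ.erase c) H) (hc : c ∈ X) {a b : V} (haX : a ∈ X)
    (hbX : b ∈ X) (ha : a ∈ H) (hb : b ∉ H) (h : 0 ≤ balance X H) : HasDetachedPair G X a b := by
  by_cases hmax : HasMaximalPath G X H a
  · refine hasDetachedPair_of_maximalPaths hX hc hH hmax (hasMaximalPath_compl_of_nonpos hX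
      (hH.cutConnected_compl hG) (Finset.mem_compl.2 hb) hbX ?_)
    rw [balance_compl_right hbal]
    omega
  · obtain ⟨w, hw, hcw⟩ := hG.exists_adj (Finset.mem_univ c) hH
    have hwX := (hX c w hcw).1 hc
    have h1 := balance_le_of_not_hasMaximalPath hX hH.2.1 ha hmax
    refine hasDetachedPair_of_not_hasMaximalPath hX hG hH ha hb hw hcw (by simpa using hwX)
      (by rintro rfl; exact hwX haX) hmax ?_
    rw [if_pos haX] at h1 ⊢
    omega

theorem hasDetachedPair_of_cut_mem (hX : IsBipartition G X)
    (hG : CutConnected G (Finset.univ : Finset V)) (hbal : balance X Finset.univ = 0)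
    (hcut : ¬ CutConnected G (Finset.univ.erase c))
    (hH : IsComponent G (Finset.univ.erase c) H) (hc : c ∈ X) {a b : V} (haX : a ∈ X)
    (hbX : b ∈ X) (ha : a ∈ H) (hb : b ∉ H) : HasDetachedPair G X a b := by
  by_contra hno
  have hHbal : balance X H < 0 := by
    by_contra! h
    exact hno (hasDetachedPair_of_balance_nonneg hX hG hbal hH hc haX hbX ha hb h)
  have h1 := balance_erase_add X (Finset.mem_univ c)
  have h2 := balance_sdiff_add X hH.1
  rw [if_pos hc] at h1
  have hroot : ∀ {K : Finset V}, IsComponent G (Finset.univ.erase c) K → 0 ≤ balance X K →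
      ∀ z ∈ K, G.Adj c z → HasMaximalPath G X K z := fun hK h z hz hcz =>
    hasMaximalPath_of_nonneg hX hK.2.1 hz ((hX c z hcz).1 hc) h
  by_cases hbc : b = c
  · subst hbc
    have hneg : ∀ K, IsComponent G (Finset.univ.erase b \ H) K → balance X K < 0 := by
      intro K hK
      by_contra! h
      have hK' := hH.of_sdiff hK
      refine hno (HasDetachedPair.symm (hasDetachedPair_of_path_through_cut hG hH hK'
        (Finset.disjoint_left.2 fun x hx => (Finset.mem_sdiff.1 (hK.1 hx)).2) .nil .nil
        (by simpa using hb) (by simpa using hK'.notMem_cut) (hroot hK' h)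
        (hasMaximalPath_compl_of_neg hX hH.2.1 ha hHbal)))
    have h3 := balance_nonpos_of_components X fun K hK => (hneg K hK).le
    have hne : (Finset.univ.erase b \ H).Nonempty := by
      rw [Finset.nonempty_iff_ne_empty, Ne, Finset.sdiff_eq_empty_iff_subset]
      intro h
      exact hcut (hH.1.antisymm h ▸ hH.2.1)
    obtain ⟨v, hv⟩ := hne
    obtain ⟨K, hK, -⟩ := exists_isComponent (G := G) hv
    have h4 := hK.balance_eq_zero (fun K hK => (hneg K hK).le) (by omega)
    have h5 := hneg K hK
    omega
  · obtain ⟨L, hL, hbL⟩ := exists_isComponent (G := G) (S := Finset.univ.erase c \ H) (v := b)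
      (by simpa using ⟨hbc, hb⟩)
    have hL' := hH.of_sdiff hL
    have hLH : ∀ x ∈ L, x ∉ H := fun x hx => (Finset.mem_sdiff.1 (hL.1 hx)).2
    have hLbal : balance X L < 0 := by
      by_contra! h
      exact hno (hasDetachedPair_of_balance_nonneg hX hG hbal hL' hc hbX haX hbL
        (fun h => hLH a h ha) h).symm
    have h3 := balance_sdiff_add X hL.1
    have h4 : balance X ((Finset.univ.erase c \ H) \ L) ≤ 0 := by
      refine balance_nonpos_of_components (G := G) X fun K hK => ?_
      by_contra! h
      have hK' := hH.of_sdiff (hL.of_sdiff hK)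
      have hKd : ∀ x ∈ K, x ∉ H ∧ x ∉ L := fun x hx => by
        have := hK.1 hx
        simp only [Finset.mem_sdiff] at this
        exact ⟨this.1.2, this.2⟩
      obtain ⟨p, hp, hpH⟩ := hH.exists_isPath_cut hG ha
      refine hno (hasDetachedPair_of_path_through_cut hG hL' hK'
        (Finset.disjoint_left.2 fun x hx => (hKd x hx).2) p hp (fun x hx => ?_) (fun x hx => ?_)
        (hroot hK' h.le) (hasMaximalPath_compl_of_neg hX hL'.2.1 hbL hLbal))
      · rcases hpH x hx with rfl | h
        · exact hL'.notMem_cut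
        · exact fun hxL => hLH x hxL h
      · rcases hpH x hx with rfl | h
        · exact hK'.notMem_cut
        · exact fun hxK => (hKd x hxK).1 h
    omega

theorem hasDetachedPair_of_two_components (hX : IsBipartition G X)
    (hG : CutConnected G (Finset.univ : Finset V)) (hbal : balance X Finset.univ = 0)
    (hH : IsComponent G (Finset.univ.erase c) H) (hK : IsComponent G (Finset.univ.erase c) K)
    (hcover : ∀ v, v = c ∨ v ∈ H ∨ v ∈ K) (hHK : ∀ v ∈ K, v ∉ H) (hc : c ∉ X) {a b : V}
    (haX : a ∈ X) (hbX : b ∈ X) (ha : a ∈ H) (hb : b ∈ K) (h1 : balance X H = 1)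
    (h0 : balance X K = 0) : HasDetachedPair G X a b := by
  have hbH := hHK b hb
  have haK : a ∉ K := fun h => hHK a h ha
  have hHbal := balance_compl_right hbal H
  have hKbal := balance_compl_right hbal K
  have hHc := hH.cutConnected_compl hG
  have hKc := hK.cutConnected_compl hG
  by_cases hd : HasMaximalPath G X Kᶜ a
  · exact (hasDetachedPair_of_maximalPaths hX.compl (by simpa using hc) hK
      (hasMaximalPath_compl_of_nonpos hX hK.2.1 hb hbX h0.le)
      (by rwa [compl_compl])).symm.compl
  by_cases he : HasMaximalPath G Xᶜ H a
  · obtain ⟨t, ht, p, hp, hpH, htmax⟩ := he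
    have htX := Finset.mem_compl.1 ht
    have hpK : ∀ z ∈ p.support, z ∈ Kᶜ := fun z hz =>
      Finset.mem_compl.2 fun h => hHK z h (hpH z hz)
    obtain ⟨L, hL, hcL⟩ := exists_isComponent (G := G) (S := Kᶜ \ p.support.toFinset) (v := c)
      (by simpa using ⟨hK.notMem_cut, fun h => hH.notMem_cut (hpH c h)⟩)
    have hLmem : ∀ z ∈ L, z ∉ K ∧ z ∉ p.support := fun z hz => by simpa using hL.1 hz
    have hLbal : balance X L = 0 := by
      refine hL.balance_eq_zero
        (fun K hK => balance_component_sdiff_path_nonpos hX hKc hd p hp hpK hK) ?_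
      have h2 := two_mul_balance_support hX p hp
      have h3 := balance_sdiff_add X (show p.support.toFinset ⊆ Kᶜ from fun z hz =>
        hpK z (by simpa using hz))
      rw [if_pos haX, if_neg htX] at h2
      omega
    obtain ⟨s, hs, q, hq, hqL, hsmax⟩ := hasMaximalPath_of_nonneg hX hL.2.1 hcL hc hLbal.ge
    obtain ⟨z, hzK, hcz⟩ := hG.exists_adj (Finset.mem_univ c) hK
    obtain ⟨p', hp', hp'K⟩ := hK.2.1.exists_isPath hb hzK
    obtain ⟨m, hm, hms⟩ := exists_isPath_join p' q hp' hq hcz.symm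
      fun x hx hxq => (hLmem x (hqL x hxq)).1 (hp'K x hx)
    refine ⟨t, s, p, m, hp, hm, fun x hx hxm => ?_, fun x hx => ?_, fun x hx => ?_, by tauto⟩
    · rcases (hms x).1 hxm with h | h
      · exact hHK x (hp'K x h) (hpH x hx)
      · exact (hLmem x (hqL x h)).2 hx
    · rcases hH.eq_cut_or_mem (hpH t p.end_mem_support) hx with rfl | h
      · exact .inr ((hms x).2 (.inr q.start_mem_support))
      · exact .inl (htmax x h hx)
    · by_cases hxp : x ∈ p.support
      · exact .inl hxp
      have hsL := hqL s q.end_mem_support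
      have hxK : x ∉ K := fun h => by
        rcases hK.eq_cut_or_mem h hx.symm with rfl | h'
        · exact hc hs
        · exact (hLmem s hsL).1 h'
      exact .inr ((hms x).2 (.inr (hsmax x (hL.2.2 s hsL x (by simpa using ⟨hxK, hxp⟩) hx) hx)))
  by_cases hw : ∃ w ∈ H, G.Adj c w ∧ w ≠ a
  · obtain ⟨w, hw, hcw, hwa⟩ := hw
    have hwX : w ∈ X := by
      have := hX c w hcw
      tauto
    refine (hasDetachedPair_of_not_hasMaximalPath hX.compl hG hH ha hbH hw hcw
      (by simpa using hwX) hwa he ?_).compl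
    rw [balance_compl, h1, if_neg (by simpa using haX)]
    norm_num
  push Not at hw
  have hHcb := Finset.mem_compl.2 hbH
  obtain ⟨s, hs, p, hp, hpH, hsmax⟩ := hasMaximalPath_of_pos hX hH.2.1 ha (by omega)
  have hadj : ∀ {y z : V}, y ∉ H → z ∈ H → G.Adj y z → y = c ∧ z = a := by
    intro y z hy hz hyz
    rcases hH.eq_cut_or_mem hz hyz.symm with rfl | h
    · exact ⟨rfl, hw z hz hyz⟩
    · exact absurd h hy
  by_cases hsc : G.Adj s c
  · obtain rfl : s = a := hw s (hpH s p.end_mem_support) hsc.symm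
    rcases exists_path_through_or_pair hX hHc hHcb (Finset.mem_compl.2 hH.notMem_cut) hc
      (by rw [if_pos hbX]; omega) with
      ⟨t, ht, q, hq, hqH, hcq, htmax⟩ | ⟨u, hu, t, ht, p', q, hp', hq, hpH', hqH, hpq, humax, htmax⟩
    · refine ⟨s, t, p, q, hp, hq, fun x hx hxq => Finset.mem_compl.1 (hqH x hxq) (hpH x hx),
        fun x hx => ?_, fun x hx => ?_, by tauto⟩
      · rcases hH.eq_cut_or_mem ha hx with rfl | h
        · exact .inr hcq
        · exact .inl (hsmax x h hx)
      · by_cases hxH : x ∈ H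
        · rw [(hadj (Finset.mem_compl.1 (hqH t q.end_mem_support)) hxH hx).2]
          exact .inl p.start_mem_support
        · exact .inr (htmax x (Finset.mem_compl.2 hxH) hx)
    · obtain ⟨m, hm, hms⟩ := exists_isPath_join (.nil : G.Walk s s) p' .nil hp' hsc
        fun x hx hxp => by
          simp only [SimpleGraph.Walk.support_nil, List.mem_singleton] at hx
          exact Finset.mem_compl.1 (hpH' x hxp) (hx ▸ ha)
      simp only [SimpleGraph.Walk.support_nil, List.mem_singleton] at hms
      refine ⟨u, t, m, q, hm, hq, fun x hx hxq => ?_, fun x hx => ?_, fun x hx => ?_, by tauto⟩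
      · rcases (hms x).1 hx with rfl | h
        · exact Finset.mem_compl.1 (hqH x hxq) ha
        · exact hpq x h hxq
      · rw [hms]
        by_cases hxH : x ∈ H
        · exact .inl (.inl (hadj (Finset.mem_compl.1 (hpH' u p'.end_mem_support)) hxH hx).2)
        · exact (humax x (Finset.mem_compl.2 hxH) hx).imp_left .inr
      · rw [hms]
        by_cases hxH : x ∈ H
        · exact .inl (.inl (hadj (Finset.mem_compl.1 (hqH t q.end_mem_support)) hxH hx).2)
        · exact (htmax x (Finset.mem_compl.2 hxH) hx).imp_left .inr
  · obtain ⟨t, ht, q, hq, hqH, htmax⟩ := hasMaximalPath_compl_of_neg hX hHc hHcb (by omega)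
    rw [Finset.mem_compl] at ht
    refine ⟨s, t, p, q, hp, hq, fun x hx hxq => Finset.mem_compl.1 (hqH x hxq) (hpH x hx),
      fun x hx => ?_, fun x hx => ?_, by tauto⟩
    · rcases hH.eq_cut_or_mem (hpH s p.end_mem_support) hx with rfl | h
      · exact absurd hx hsc
      · exact .inl (hsmax x h hx)
    · by_cases hxH : x ∈ H
      · rw [(hadj (Finset.mem_compl.1 (hqH t q.end_mem_support)) hxH hx).2]
        exact .inl p.start_mem_support
      · exact .inr (htmax x (Finset.mem_compl.2 hxH) hx)

theorem balance_nonneg_of_not_hasDetachedPair (hX : IsBipartition G X)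
    (hG : CutConnected G (Finset.univ : Finset V)) (hbal : balance X Finset.univ = 0)
    (hH : IsComponent G (Finset.univ.erase c) H) (hc : c ∉ X) {a b : V} (ha : a ∈ H)
    (hb : b ∉ H) (hno : ¬ HasDetachedPair G X a b) : 0 ≤ balance X H := by
  by_contra! h
  have hb' := balance_compl_right hbal H
  refine hno (hasDetachedPair_of_maximalPaths hX.compl (by simpa using hc) hH
    (hasMaximalPath_compl_of_neg hX hH.2.1 ha h) ?_).compl
  rw [compl_compl]
  exact hasMaximalPath_of_pos hX (hH.cutConnected_compl hG) (Finset.mem_compl.2 hb) (by omega)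

/-- A third component has positive balance if and only if the component of `b` has. -/
theorem balance_pos_iff_of_not_hasDetachedPair {L : Finset V} (hX : IsBipartition G X)
    (hG : CutConnected G (Finset.univ : Finset V))
    (hH : IsComponent G (Finset.univ.erase c) H) (hK : IsComponent G (Finset.univ.erase c) K)
    (hL : IsComponent G (Finset.univ.erase c) L) (hHK : Disjoint H K) (hHL : Disjoint H L)
    (hKL : Disjoint K L) (hc : c ∉ X) {a b : V} (hbX : b ∈ X) (ha : a ∈ H)
    (hb : b ∈ K) (hno : ¬ HasDetachedPair G X a b) : 0 < balance X L ↔ 0 < balance X K := by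
  obtain ⟨p, hp, hpH⟩ := hH.exists_isPath_cut hG ha
  have hpK : ∀ z ∈ p.support, z ∉ K := fun z hz => by
    rcases hpH z hz with rfl | h
    · exact hK.notMem_cut
    · exact Finset.disjoint_left.1 hHK h
  have hpL : ∀ z ∈ p.support, z ∉ L := fun z hz => by
    rcases hpH z hz with rfl | h
    · exact hL.notMem_cut
    · exact Finset.disjoint_left.1 hHL h
  constructor
  · intro h
    by_contra! h'
    exact hno (hasDetachedPair_of_path_through_cut hG hK hL hKL.symm p hp hpK hpL
      (fun z hz _ => hasMaximalPath_of_pos hX hL.2.1 hz h)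
      (hasMaximalPath_compl_of_nonpos hX hK.2.1 hb hbX h'))
  · intro h
    by_contra! h'
    refine hno (hasDetachedPair_of_path_through_cut hG hK hL hKL.symm p hp hpK hpL
      (fun z hz hcz => hasMaximalPath_compl_of_nonpos hX hL.2.1 hz ?_ h') ?_).compl
    · have := hX c z hcz
      tauto
    · rw [compl_compl]
      exact hasMaximalPath_of_pos hX hK.2.1 hb h

theorem hasDetachedPair_of_cut_notMem (hX : IsBipartition G X)
    (hG : CutConnected G (Finset.univ : Finset V)) (hbal : balance X Finset.univ = 0)
    (hH : IsComponent G (Finset.univ.erase c) H) (hc : c ∉ X) {a b : V} (haX : a ∈ X)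
    (hbX : b ∈ X) (ha : a ∈ H) (hb : b ∉ H) : HasDetachedPair G X a b := by
  by_contra hno
  have hno' : ¬ HasDetachedPair G X b a := fun h => hno h.symm
  obtain ⟨K, hK, hbK⟩ := exists_isComponent (G := G) (S := Finset.univ.erase c \ H) (v := b)
    (by simpa using ⟨by rintro rfl; exact hc hbX, hb⟩)
  have hK' := hH.of_sdiff hK
  have hHK : Disjoint H K := Finset.disjoint_right.2 fun x hx => (Finset.mem_sdiff.1 (hK.1 hx)).2
  have haK : a ∉ K := Finset.disjoint_left.1 hHK ha
  have h1 := balance_nonneg_of_not_hasDetachedPair hX hG hbal hH hc ha hb hno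
  have h2 := balance_nonneg_of_not_hasDetachedPair hX hG hbal hK' hc hbK haK hno'
  set W := (Finset.univ.erase c \ H) \ K with hW
  have hsum : balance X H + balance X K + balance X W = 1 := by
    have h3 := balance_erase_add X (Finset.mem_univ c)
    have h4 := balance_sdiff_add X hH.1
    have h5 := balance_sdiff_add X hK.1
    rw [← hW] at h5
    rw [if_neg hc] at h3
    omega
  have hiff : ∀ L, IsComponent G W L →
      (0 < balance X L ↔ 0 < balance X K) ∧ (0 < balance X L ↔ 0 < balance X H) := by
    intro L hL
    have hL' := hH.of_sdiff (hK.of_sdiff hL)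
    have hd : ∀ x ∈ L, x ∉ H ∧ x ∉ K := fun x hx => by
      have := hL.1 hx
      simp only [hW, Finset.mem_sdiff] at this
      exact ⟨this.1.2, this.2⟩
    have hHL := Finset.disjoint_right.2 fun x hx => (hd x hx).1
    have hKL := Finset.disjoint_right.2 fun x hx => (hd x hx).2
    exact ⟨balance_pos_iff_of_not_hasDetachedPair hX hG hH hK' hL' hHK hHL hKL hc hbX ha hbK hno,
      balance_pos_iff_of_not_hasDetachedPair hX hG hK' hH hL' hHK.symm hKL hHL hc haX hbK ha hno'⟩
  have hWe : W = ∅ := by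
    by_contra hne
    obtain ⟨v, hv⟩ := Finset.nonempty_iff_ne_empty.2 hne
    obtain ⟨L, hL, -⟩ := exists_isComponent (G := G) hv
    have hiffL := hiff L hL
    by_cases hK0 : 0 < balance X K
    · have h3 : 0 ≤ balance X W :=
        balance_nonneg_of_components (G := G) X fun L hL => ((hiff L hL).1.2 hK0).le
      have h4 := hiffL.2.1 (hiffL.1.2 hK0)
      omega
    · have h3 : balance X W ≤ 0 :=
        balance_nonpos_of_components (G := G) X fun L hL => by
          have := (hiff L hL).1
          omega
      omega
  have hcover : ∀ v, v = c ∨ v ∈ H ∨ v ∈ K := by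
    intro v
    by_contra! h
    have : v ∈ W := by simpa [hW, and_assoc] using h
    simp [hWe] at this
  rw [hWe] at hsum
  have h0 : balance X ∅ = 0 := Finset.sum_empty
  rcases (by omega : balance X H = 1 ∧ balance X K = 0 ∨ balance X K = 1 ∧ balance X H = 0) with
    ⟨e1, e2⟩ | ⟨e1, e2⟩
  · exact hno (hasDetachedPair_of_two_components hX hG hbal hH hK' hcover
      (fun v hv => Finset.disjoint_right.1 hHK hv) hc haX hbX ha hbK e1 e2)
  · exact hno' (hasDetachedPair_of_two_components hX hG hbal hK' hH
      (fun v => (hcover v).imp_right Or.symm) (fun v hv => Finset.disjoint_left.1 hHK hv) hc hbX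
      haX hbK ha e1 e2)

end CutVertex

end PathPairs

section Blocks

variable {V : Type} {G : SimpleGraph V}

theorem induce_connected_of_walks {S : Set V} {r : V} (hr : r ∈ S)
    (h : ∀ x ∈ S, ∃ p : G.Walk r x, ∀ z ∈ p.support, z ∈ S) : (G.induce S).Connected := by
  have hreach : ∀ x : S, (G.induce S).Reachable ⟨r, hr⟩ x := fun x => by
    obtain ⟨p, hp⟩ := h x x.2
    exact ⟨p.induce S hp⟩
  have : Nonempty S := ⟨⟨r, hr⟩⟩
  exact ⟨fun x y => (hreach x).symm.trans (hreach y)⟩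

theorem exists_walk_of_induce_connected {S : Set V} (h : (G.induce S).Connected) {x y : V}
    (hx : x ∈ S) (hy : y ∈ S) : ∃ p : G.Walk x y, ∀ z ∈ p.support, z ∈ S := by
  obtain ⟨p⟩ := h.preconnected ⟨x, hx⟩ ⟨y, hy⟩
  let f : G.induce S →g G := ⟨Subtype.val, fun h => h⟩
  refine ⟨p.map f, fun z hz => ?_⟩
  rw [SimpleGraph.Walk.support_map, List.mem_map] at hz
  obtain ⟨w, -, rfl⟩ := hz
  exact w.2

theorem exists_walk_to_first_mem {B : Set V} {b c : V} (p : G.Walk b c) (hc : c ∈ B) :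
    ∃ d ∈ B, ∃ q : G.Walk b d, (∀ z ∈ q.support, z ∈ B → z = d) ∧
      ∀ z ∈ q.support, z ∈ p.support := by
  induction p with
  | @nil u => exact ⟨u, hc, .nil, by simp, by simp⟩
  | @cons u v w h p ih =>
    by_cases hu : u ∈ B
    · exact ⟨u, hu, .nil, by simp, by simp⟩
    · obtain ⟨d, hd, q, hq, hqp⟩ := ih hc
      refine ⟨d, hd, .cons h q, fun z hz hzB => ?_, fun z hz => ?_⟩
      · rcases List.mem_cons.1 hz with rfl | hz
        · exact absurd hzB hu
        · exact hq z hz hzB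
      · exact List.mem_cons.2 ((List.mem_cons.1 hz).imp_right (hqp z))

/-- A path whose ends have distinct neighbours in, respectively lie in, a set without cut-vertex
can be added to that set. -/
theorem NoOwnCutVertex.union_support {B : Set V} (hB : NoOwnCutVertex G B) {a b d : V}
    (ha : a ∈ B) (hd : d ∈ B) (had : a ≠ d) (hab : G.Adj a b) (q : G.Walk b d)
    (hq : q.IsPath) (hqB : ∀ z ∈ q.support, z ∈ B → z = d) :
    NoOwnCutVertex G (B ∪ {z | z ∈ q.support}) := by
  classical
  have hsplit : ∀ x (hx : x ∈ q.support) v, v ∈ (q.takeUntil x hx).support →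
      v ∈ (q.dropUntil x hx).support → v = x := by
    intro x hx v hv hv'
    have h := hq.support_nodup
    rw [← q.take_spec hx, SimpleGraph.Walk.support_append, List.nodup_append'] at h
    rw [SimpleGraph.Walk.mem_support_iff] at hv'
    exact hv'.resolve_right fun h' => h.2.2 hv h'
  have hfwd : ∀ {S : Set V}, S ⊆ B ∪ {z | z ∈ q.support} → a ∈ S →
      (∀ x ∈ B ∩ S, ∃ p : G.Walk a x, ∀ z ∈ p.support, z ∈ S) →
      (∀ x (hx : x ∈ q.support), x ∈ S → x ∉ B →
        (∀ z ∈ (q.takeUntil x hx).support, z ∈ S) ∨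
        ∀ z ∈ (q.dropUntil x hx).support, z ∈ S) → (G.induce S).Connected := by
    intro S hS haS hSB hSq
    refine induce_connected_of_walks haS fun x hx => ?_
    by_cases hxB : x ∈ B
    · exact hSB x ⟨hxB, hx⟩
    have hxq := (hS hx).resolve_left hxB
    rcases hSq x hxq hx hxB with h | h
    · exact ⟨.cons hab (q.takeUntil x hxq), by simpa using ⟨haS, h⟩⟩
    · obtain ⟨p, hp⟩ := hSB d ⟨hd, h d (SimpleGraph.Walk.end_mem_support _)⟩
      refine ⟨p.append (q.dropUntil x hxq).reverse, fun z hz => ?_⟩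
      rw [SimpleGraph.Walk.mem_support_append_iff, SimpleGraph.Walk.support_reverse,
        List.mem_reverse] at hz
      exact hz.elim (hp z) (h z)
  have hconn : ∀ {S T : Set V}, (G.induce T).Connected → a ∈ T → T ⊆ S → B ∩ S ⊆ T →
      ∀ x ∈ B ∩ S, ∃ p : G.Walk a x, ∀ z ∈ p.support, z ∈ S := by
    intro S T hT haT hTS hBS x hx
    obtain ⟨p, hp⟩ := exists_walk_of_induce_connected hT haT (hBS hx)
    exact ⟨p, fun z hz => hTS (hp z hz)⟩
  refine ⟨hfwd subset_rfl (.inl ha) (hconn hB.1 ha Set.subset_union_left Set.inter_subset_left)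
    fun x hx _ _ => .inl fun z hz => .inr (q.support_takeUntil_subset_support hx hz),
    fun v hv => .inr ?_⟩
  by_cases hva : v = a
  · subst hva
    have hBv := (hB.2 v ha).resolve_left fun h => had (by rw [h] at hd; exact hd.symm)
    refine induce_connected_of_walks (r := d) ⟨.inl hd, had.symm⟩ fun x hx => ?_
    by_cases hxB : x ∈ B
    · obtain ⟨p, hp⟩ := exists_walk_of_induce_connected hBv ⟨hd, had.symm⟩ ⟨hxB, hx.2⟩
      exact ⟨p, fun z hz => ⟨.inl (hp z hz).1, (hp z hz).2⟩⟩
    · have hxq := hx.1.resolve_left hxB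
      refine ⟨(q.dropUntil x hxq).reverse, fun z hz => ?_⟩
      rw [SimpleGraph.Walk.support_reverse, List.mem_reverse] at hz
      have hzq := q.support_dropUntil_subset_support hxq hz
      exact ⟨.inr hzq, fun e => had (hqB v (e ▸ hzq) ha)⟩
  refine hfwd Set.sdiff_subset ⟨.inl ha, Ne.symm hva⟩ ?_ fun x hx hxS hxB => ?_
  · by_cases hvB : v ∈ B
    · have hBv := (hB.2 v hvB).resolve_left fun h => hva (by rw [h] at ha; exact ha.symm)
      exact hconn hBv ⟨ha, Ne.symm hva⟩ (Set.sdiff_subset_sdiff_left Set.subset_union_left)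
        fun x hx => ⟨hx.1, hx.2.2⟩
    · exact hconn hB.1 ha (fun x hx => ⟨.inl hx, fun e => hvB (e ▸ hx)⟩) Set.inter_subset_left
  · by_cases hvt : v ∈ (q.takeUntil x hx).support
    · exact .inr fun z hz => ⟨.inr (q.support_dropUntil_subset_support hx hz),
        fun e => hxS.2 (hsplit x hx v hvt (e ▸ hz)).symm⟩
    · exact .inl fun z hz => ⟨.inr (q.support_takeUntil_subset_support hx hz),
        fun e => hvt (e ▸ hz)⟩

theorem IsBlock.mem_of_adj {B : Set V} (hB : IsBlock G B) (hG : G.Connected) {a b c : V}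
    (ha : a ∈ B) (hac : ¬ IsCutVertex G a) (hc : c ∈ B) (hca : c ≠ a) (hab : G.Adj a b) :
    b ∈ B := by
  classical
  have hconn : (G.induce {u : V | u ≠ a}).Connected := by
    by_contra h
    exact hac ⟨hG, h⟩
  obtain ⟨p, hp⟩ := exists_walk_of_induce_connected hconn (x := b) (y := c) hab.ne' hca
  obtain ⟨d, hd, q, hqB, hqp⟩ := exists_walk_to_first_mem p hc
  have hsub := q.support_bypass_subset_support
  have hB' := hB.1.union_support ha hd (hp d (hqp d q.end_mem_support)).symm hab q.bypass
    q.bypass_isPath fun z hz => hqB z (hsub hz)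
  rw [← hB.2 _ Set.subset_union_left hB']
  exact .inr q.bypass.start_mem_support

end Blocks

section Main

variable {V : Type} [Fintype V] {G : SimpleGraph V} {X : Finset V}

theorem cutConnected_univ (hG : G.Connected) : CutConnected G (Finset.univ : Finset V) := by
  have hne := hG.nonempty
  refine ⟨Finset.univ_nonempty, fun K _ ⟨r, hr⟩ hcl => Finset.eq_univ_of_forall fun x => ?_⟩
  obtain ⟨p⟩ := hG.preconnected r x
  induction p with
  | nil => exact hr
  | cons h p ih => exact ih (hcl _ hr _ (Finset.mem_univ _) h)

variable [DecidableEq V]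

theorem IsCutVertex.not_cutConnected {c : V} (hc : IsCutVertex G c) :
    ¬ CutConnected G (Finset.univ.erase c) := by
  intro h
  obtain ⟨r, hr⟩ := h.1
  refine hc.2 (induce_connected_of_walks (r := r) (by simpa using hr) fun x hx => ?_)
  obtain ⟨p, -, hp⟩ := h.exists_isPath hr (b := x) (by simpa using hx)
  exact ⟨p, fun z hz => by simpa using hp z hz⟩

theorem hasDetachedPair_of_isEndBlock (hX : IsBipartition G X)
    (hbal : balance X Finset.univ = 0) (hG : G.Connected) {a b : V} (haX : a ∈ X) (hbX : b ∈ X)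
    {B : Set V} (hB : IsEndBlock G B) (ha : a ∈ B ∧ ¬ IsCutVertex G a)
    (hb : ¬ (b ∈ B ∧ ¬ IsCutVertex G b)) : HasDetachedPair G X a b := by
  classical
  obtain ⟨hblock, c, ⟨hcB, hc⟩, hcuniq⟩ := hB
  have hac : a ≠ c := by
    rintro rfl
    exact ha.2 hc
  obtain ⟨H, hH, haH⟩ := exists_isComponent (G := G) (S := Finset.univ.erase c) (v := a)
    (by simpa using hac)
  have hinner : ∀ x ∈ H, x ∈ B → ¬ IsCutVertex G x := fun x hx hxB hxc =>
    hH.notMem_cut (hcuniq x ⟨hxB, hxc⟩ ▸ hx)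
  have hHB : H.filter (· ∈ B) = H := by
    refine hH.2.1.2 _ (Finset.filter_subset _ _) ⟨a, by simpa using ⟨haH, ha.1⟩⟩
      fun x hx y hy hxy => ?_
    rw [Finset.mem_filter] at hx ⊢
    exact ⟨hy, hblock.mem_of_adj hG hx.2 (hinner x hx.1 hx.2) hcB
      (fun e => hH.notMem_cut (e ▸ hx.1)) hxy⟩
  have hbH : b ∉ H := fun h => by
    have hbB : b ∈ B := by
      rw [← hHB, Finset.mem_filter] at h
      exact h.2
    exact hb ⟨hbB, hinner b h hbB⟩
  have hG' := cutConnected_univ hG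
  by_cases hcX : c ∈ X
  · exact hasDetachedPair_of_cut_mem hX hG' hbal hc.not_cutConnected hH hcX haX hbX haH hbH
  · exact hasDetachedPair_of_cut_notMem hX hG' hbal hH hcX haX hbX haH hbH

theorem rhoEdges_pair_lt_card {s t : V} {D : Finset V} (hX : IsBipartition G X) (hs : s ∈ X)
    (ht : t ∉ X) (hsD : s ∈ D) (hsN : ∀ z, G.Adj s z → z ∈ D)
    (htN : ∀ z, G.Adj t z → z ∈ D) : rhoEdges G {s, t} < D.card := by
  classical
  have hset : {e ∈ G.edgeSet | ∃ v ∈ ({s, t} : Set V), v ∈ e} =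
      ((G.incidenceFinset s ∪ G.incidenceFinset t : Finset (Sym2 V)) : Set (Sym2 V)) := by
    ext e
    simp only [Set.mem_insert_iff, Set.mem_singleton_iff, exists_eq_or_imp, exists_eq_left,
      Finset.coe_union, SimpleGraph.coe_incidenceFinset, SimpleGraph.incidenceSet,
      Set.mem_union, Set.mem_ofPred_eq]
    tauto
  rw [rhoEdges, hset, Set.ncard_coe_finset]
  have hunion := Finset.card_union_add_card_inter (G.incidenceFinset s) (G.incidenceFinset t)
  rw [G.card_incidenceFinset_eq_degree, G.card_incidenceFinset_eq_degree] at hunion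
  have hD := Finset.card_filter_add_card_filter_not (s := D) (· ∈ X)
  have hs' : G.degree s ≤ (D.filter (· ∉ X)).card := by
    rw [← G.card_neighborFinset_eq_degree]
    refine Finset.card_le_card fun z hz => ?_
    rw [SimpleGraph.mem_neighborFinset] at hz
    exact Finset.mem_filter.2 ⟨hsN z hz, (hX s z hz).1 hs⟩
  have htX : ∀ z, G.Adj t z → z ∈ D.filter (· ∈ X) := fun z hz => by
    have := hX t z hz
    exact Finset.mem_filter.2 ⟨htN z hz, by tauto⟩
  have ht' : G.neighborFinset t ⊆ D.filter (· ∈ X) := fun z hz =>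
    htX z ((G.mem_neighborFinset t z).1 hz)
  by_cases hst : G.Adj s t
  · have hle := Finset.card_le_card ht'
    rw [G.card_neighborFinset_eq_degree] at hle
    have hpos : 0 < (G.incidenceFinset s ∩ G.incidenceFinset t).card :=
      Finset.card_pos.2 ⟨s(s, t), by simp [SimpleGraph.incidenceSet, hst]⟩
    omega
  · have hlt := Finset.card_lt_card (Finset.ssubset_iff_subset_ne.2 ⟨ht', fun h => hst
      ((G.mem_neighborFinset t s).1 (h ▸ Finset.mem_filter.2 ⟨hsD, hs⟩)).symm⟩)
    rw [G.card_neighborFinset_eq_degree] at hlt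
    omega

end Main

/-- **Lemma (Li–Ning).** Let `G = (X,Y;E)` be a balanced bipartite graph with connectivity 1
and let `{x₀, x₀'} ⊆ X` be a good pair of `G`. Suppose `ρ({x,y}) ≥ ρ` for every
`(x,y) ∈ (X,Y)`. Then `G` has a detached maximal `{x₀,x₀'}`-disjoint path pair of order at
least `ρ + 1`. -/
theorem stmt_11 {V : Type} [Fintype V] [DecidableEq V]
    (G : SimpleGraph V) (X Y : Finset V) (ρ : ℕ)
    (hpart : ∀ v : V, v ∈ X ∨ v ∈ Y) (hdisj : Disjoint X Y)
    (hbip : ∀ u v : V, G.Adj u v → (u ∈ X ∧ v ∈ Y) ∨ (u ∈ Y ∧ v ∈ X))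
    (hbal : X.card = Y.card)
    (hconn1 : G.Connected ∧ ∃ v : V, IsCutVertex G v)
    (x₀ x₀' : V) (hx₀ : x₀ ∈ X) (hx₀' : x₀' ∈ X) (hgood : GoodPair G x₀ x₀')
    (hrho : ∀ x ∈ X, ∀ y ∈ Y, ρ ≤ rhoEdges G {x, y}) :
    ∃ (s t : V) (p : G.Walk x₀ s) (q : G.Walk x₀' t),
      p.IsPath ∧ q.IsPath ∧
      (∀ z : V, z ∈ p.support → z ∉ q.support) ∧
      (∀ z : V, G.Adj s z → z ∈ p.support ∨ z ∈ q.support) ∧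
      (∀ z : V, G.Adj t z → z ∈ p.support ∨ z ∈ q.support) ∧
      ((s ∈ X ∧ t ∈ Y) ∨ (s ∈ Y ∧ t ∈ X)) ∧
      ρ + 1 ≤ p.support.length + q.support.length := by
  have hY : ∀ v, v ∈ Y ↔ v ∉ X := fun v =>
    ⟨fun hv hvX => Finset.disjoint_left.1 hdisj hvX hv, (hpart v).resolve_left⟩
  have hX : IsBipartition G X := fun u v huv => by
    have := hbip u v huv
    simp only [hY] at this
    tauto
  have hbalance : balance X Finset.univ = 0 := by
    have hXY : Finset.univ \ X = Y := by
      ext v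
      simp [hY]
    rw [← balance_sdiff_add X (Finset.subset_univ X), hXY, balance, balance,
      Finset.sum_congr rfl fun v hv => if_neg ((hY v).1 hv),
      Finset.sum_congr rfl fun v hv => if_pos hv]
    simp [hbal]
  have hpair : HasDetachedPair G X x₀ x₀' := by
    obtain ⟨B, hB, h | h⟩ := hgood
    · exact hasDetachedPair_of_isEndBlock hX hbalance hconn1.1 hx₀ hx₀' hB h.1 h.2
    · exact (hasDetachedPair_of_isEndBlock hX hbalance hconn1.1 hx₀' hx₀ hB h.1 h.2).symm
  obtain ⟨s, t, p, q, hp, hq, hpq, hs, ht, hst⟩ := hpair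
  refine ⟨s, t, p, q, hp, hq, hpq, hs, ht, by simp only [hY]; tauto, ?_⟩
  have hcard : (p.support.toFinset ∪ q.support.toFinset).card =
      p.support.length + q.support.length := by
    rw [Finset.card_union_of_disjoint, List.toFinset_card_of_nodup hp.support_nodup,
      List.toFinset_card_of_nodup hq.support_nodup]
    exact Finset.disjoint_left.2 fun z hz hz' => hpq z (by simpa using hz) (by simpa using hz')
  rw [← hcard]
  by_cases hsX : s ∈ X
  · have htX := hst.1 hsX
    exact (Nat.succ_le_succ (hrho s hsX t ((hY t).2 htX))).trans
      (rhoEdges_pair_lt_card hX hsX htX (by simp) (by simpa using hs) (by simpa using ht))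
  · have htX : t ∈ X := by tauto
    exact (Nat.succ_le_succ (hrho t htX s ((hY s).2 hsX))).trans
      (rhoEdges_pair_lt_card hX htX hsX (by simp) (by simpa using ht) (by simpa using hs))
end

section
/- Let G=(X,Y;E) be a 2-connected balanced bipartite graph such that ρ_G({x,y}) ≥ ρ for every pair of vertices x ∈ X and y ∈ Y. Then for any two vertices x₁, x₂ ∈ X, G has a path with end-vertices x₁ and x₂ of order at least ρ. -/
namespace BipPath

variable {V : Type*} [DecidableEq V] {G : SimpleGraph V}

open Classical in
/-- The neighbours of `x` in `W`. -/
noncomputable def nb (G : SimpleGraph V) (W : Finset V) (x : V) : Finset V :=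
  W.filter (fun y => G.Adj x y)

omit [DecidableEq V] in
@[simp] theorem mem_nb {W : Finset V} {x y : V} : y ∈ nb G W x ↔ y ∈ W ∧ G.Adj x y := by
  simp [nb]

/-- The number of vertices of the list `p` outside `S`. -/
def tc (S : Finset V) (p : List V) : ℕ := (p.toFinset \ S).card

/-- `p` is (the vertex list of) a path from `u` to `v` inside `U`. -/
structure IsP (G : SimpleGraph V) (U : Finset V) (u v : V) (p : List V) : Prop where
  chain : p.IsChain G.Adj
  nodup : p.Nodup
  head : p.head? = some u
  last : p.getLast? = some v
  sub : ∀ z ∈ p, z ∈ U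

namespace IsP
omit [DecidableEq V]
variable {U U' : Finset V} {u v a b : V} {p q p₁ p₂ : List V}

theorem mono (h : IsP G U u v p) (hU : ∀ z ∈ p, z ∈ U') : IsP G U' u v p :=
  ⟨h.chain, h.nodup, h.head, h.last, hU⟩

theorem single (h : u ∈ U) : IsP G U u u [u] := by
  constructor <;> simp [h]

theorem reverse (h : IsP G U u v p) : IsP G U v u p.reverse := by
  obtain ⟨h1, h2, h3, h4, h5⟩ := h
  refine ⟨?_, by simpa using h2, by simpa using h4, by simpa using h3, by simpa using h5⟩
  rw [List.isChain_reverse]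
  exact h1.imp (fun _ _ h => h.symm)

theorem append (h : IsP G U u a p) (h' : IsP G U b v q) (hab : G.Adj a b)
    (hd : ∀ z ∈ p, z ∉ q) : IsP G U u v (p ++ q) := by
  obtain ⟨h1, h2, h3, h4, h5⟩ := h
  obtain ⟨k1, k2, k3, k4, k5⟩ := h'
  refine ⟨?_, ?_, by simp [h3], by simp [k4], ?_⟩
  · rw [List.isChain_append]
    refine ⟨h1, k1, ?_⟩
    simp [h4, k3, hab]
  · rw [List.nodup_append']
    exact ⟨h2, k2, fun z hz => hd z hz⟩
  · grind

theorem head_mem (h : IsP G U u v p) : u ∈ p := List.mem_of_head? h.head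

theorem last_mem (h : IsP G U u v p) : v ∈ p := List.mem_of_getLast? h.last

theorem front (h : IsP G U u v (p₁ ++ a :: p₂)) : IsP G U u a (p₁ ++ [a]) := by
  obtain ⟨h1, h2, h3, h4, h5⟩ := h
  refine ⟨(List.isChain_split.1 h1).1, ?_, ?_, by simp, ?_⟩
  · grind
  · cases p₁ <;> simp_all
  · grind

theorem back (h : IsP G U u v (p₁ ++ a :: p₂)) : IsP G U a v (a :: p₂) := by
  obtain ⟨h1, h2, h3, h4, h5⟩ := h
  refine ⟨(List.isChain_split.1 h1).2, ?_, by simp, ?_, ?_⟩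
  · grind
  · simpa using h4
  · grind

/-- Glue a path ending at `a` and a path starting at `a`. -/
theorem glue (h : IsP G U u a (p₁ ++ [a])) (h' : IsP G U a v (a :: p₂))
    (hd : ∀ z ∈ p₁, z ∉ p₂) : IsP G U u v (p₁ ++ a :: p₂) := by
  obtain ⟨h1, h2, h3, h4, h5⟩ := h
  obtain ⟨k1, k2, k3, k4, k5⟩ := h'
  refine ⟨List.isChain_split.2 ⟨h1, k1⟩, ?_, ?_, by simpa using k4, ?_⟩
  · grind
  · cases p₁ <;> simp_all
  · grind

end IsP

omit [DecidableEq V] in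
theorem exists_first {p : List V} {Y : V → Prop} (h : ∃ y ∈ p, Y y) :
    ∃ q₁ y q₂, p = q₁ ++ y :: q₂ ∧ Y y ∧ ∀ z ∈ q₁, ¬ Y z := by
  induction p with
  | nil => simp at h
  | cons x p ih =>
    by_cases hx : Y x
    · exact ⟨[], x, p, by simp, hx, by simp⟩
    · obtain ⟨q₁, y, q₂, h1, h2, h3⟩ := ih (by
        obtain ⟨y, hy, hy'⟩ := h
        rcases List.mem_cons.1 hy with rfl | hy
        · exact absurd hy' hx
        · exact ⟨y, hy, hy'⟩)
      exact ⟨x :: q₁, y, q₂, by simp [h1], h2, by simpa [hx] using h3⟩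

omit [DecidableEq V] in
theorem exists_last {p : List V} {Y : V → Prop} (h : ∃ y ∈ p, Y y) :
    ∃ q₁ y q₂, p = q₁ ++ y :: q₂ ∧ Y y ∧ ∀ z ∈ q₂, ¬ Y z := by
  obtain ⟨q₁, y, q₂, h1, h2, h3⟩ := exists_first (p := p.reverse) (Y := Y) (by simpa using h)
  refine ⟨q₂.reverse, y, q₁.reverse, ?_, h2, by simpa using h3⟩
  rw [← List.reverse_reverse p, h1]
  simp

/-- Along a path, the two colour classes alternate. -/
theorem tc_add_one {S : Finset V} (hb : ∀ a b, G.Adj a b → (a ∈ S ↔ b ∉ S))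
    {U : Finset V} {v : V} : ∀ {u : V} {p : List V}, IsP G U u v p →
    tc S p + 1 = (p.toFinset ∩ S).card + (if u ∈ S then 0 else 1) + (if v ∈ S then 0 else 1) := by
  intro u p
  induction p generalizing u with
  | nil => intro h; have := h.head; simp at this
  | cons x p ih =>
    intro h
    have hx : x = u := by simpa using h.head
    subst hx
    cases p with
    | nil =>
      have hv : x = v := by simpa using h.last
      subst hv
      by_cases hS : x ∈ S
      · simp [tc, hS]
      · have : ({x} : Finset V) \ S = {x} := by ext z; simp; rintro rfl; exact hS
        simp [tc, hS, this]
    | cons y p =>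
      have hadj : G.Adj x y := by have := h.chain; simp at this; exact this.1
      have h' : IsP G U y v (y :: p) := by
        have := IsP.back (p₁ := [x]) (a := y) (p₂ := p) h
        exact this
      have hi := ih h'
      have hxn : x ∉ (y :: p).toFinset := by have := h.nodup; simp_all
      have hS := hb x y hadj
      unfold tc at hi ⊢
      rw [List.toFinset_cons]
      by_cases hxS : x ∈ S
      · rw [Finset.insert_sdiff_of_mem _ hxS, Finset.insert_inter_of_mem hxS,
          Finset.card_insert_of_notMem (by grind)]
        have : y ∉ S := hS.1 hxS
        simp only [hxS, this, if_true, if_false] at hi ⊢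
        omega
      · rw [Finset.insert_sdiff_of_notMem _ hxS, Finset.insert_inter_of_notMem hxS,
          Finset.card_insert_of_notMem (by grind)]
        have : y ∈ S := by by_contra hy; exact hxS (hS.2 hy)
        simp only [hxS, this, if_true, if_false] at hi ⊢
        omega

theorem reroute_aux {U : Finset V} {u v w : V} {l₁ l₂ : List V} (h : IsP G U u v (l₁ ++ w :: l₂))
    {Y : Finset V} (hY : ∃ y ∈ l₂, y ∈ Y) {Q : List V}
    (hQ : Q.Nodup) (hQU : ∀ z ∈ Q, z ∈ U) (hQP : ∀ z ∈ Q, z ∉ l₁ ++ w :: l₂)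
    (hc : ∀ y ∈ Y, (w :: (Q ++ [y])).IsChain G.Adj) :
    ∃ I : Finset V, I ⊆ (l₁ ++ w :: l₂).toFinset ∧ Disjoint I Y ∧ w ∉ I ∧ ∃ p, IsP G U u v p ∧
      p.toFinset = ((l₁ ++ w :: l₂).toFinset \ I) ∪ Q.toFinset := by
  obtain ⟨m, y, l₃, rfl, hy, hm⟩ := exists_first hY
  refine ⟨m.toFinset, ?_, ?_, ?_, l₁ ++ w :: (Q ++ y :: l₃), ?_, ?_⟩
  · intro z; simp; tauto
  · rw [Finset.disjoint_left]; simpa using hm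
  · have := h.nodup
    simp only [List.nodup_append, List.nodup_cons, List.mem_append, List.mem_cons] at this
    simp; tauto
  · refine IsP.glue h.front ?_ ?_
    · have h1 : IsP G U y v (y :: l₃) := by
        apply IsP.back (p₁ := w :: m)
        simpa using h.back
      have h2 : IsP G U w y (w :: Q ++ [y]) := by
        refine ⟨by simpa using hc y hy, ?_, by simp, by simp [List.getLast?_cons], ?_⟩
        · have := h.nodup; grind
        · have := h.sub; grind
      exact IsP.glue h2 h1 (by have := h.nodup; grind)
    · have := h.nodup; grind
  · have := h.nodup
    ext z
    simp only [List.mem_toFinset, Finset.mem_union, Finset.mem_sdiff]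
    grind

theorem reroute {U : Finset V} {u v w : V} {P : List V} (h : IsP G U u v P) (hw : w ∈ P)
    {Y : Finset V} (hYP : Y ⊆ P.toFinset) (hY : (Y \ {w}).Nonempty) {Q : List V}
    (hQ : Q.Nodup) (hQU : ∀ z ∈ Q, z ∈ U) (hQP : ∀ z ∈ Q, z ∉ P)
    (hc : ∀ y ∈ Y, (w :: (Q ++ [y])).IsChain G.Adj) :
    ∃ I : Finset V, I ⊆ P.toFinset ∧ Disjoint I Y ∧ w ∉ I ∧ ∃ p, IsP G U u v p ∧
      p.toFinset = (P.toFinset \ I) ∪ Q.toFinset := by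
  obtain ⟨l₁, l₂, rfl⟩ := List.append_of_mem hw
  obtain ⟨y, hy⟩ := hY
  simp only [Finset.mem_sdiff, Finset.mem_singleton] at hy
  have hyP := hYP hy.1
  by_cases h2 : y ∈ l₂
  · exact reroute_aux h ⟨y, h2, hy.1⟩ hQ hQU hQP hc
  · have h1 : y ∈ l₁ := by simp at hyP; tauto
    have hr : IsP G U v u (l₂.reverse ++ w :: l₁.reverse) := by simpa using h.reverse
    obtain ⟨I, i1, i2, i3, p, hp, hp'⟩ :=
      reroute_aux hr ⟨y, by simpa using h1, hy.1⟩ hQ hQU (by grind) hc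
    have e : (l₂.reverse ++ w :: l₁.reverse).toFinset = (l₁ ++ w :: l₂).toFinset := by
      ext z; simp; tauto
    rw [e] at i1 hp'
    exact ⟨I, i1, i2, i3, p.reverse, hp.reverse, by simpa using hp'⟩

/-- No set of at most one vertex separates `U`. -/
def Conn2 (G : SimpleGraph V) (U : Finset V) : Prop :=
  ∀ W C : Finset V, W.card ≤ 1 → C ⊆ U \ W → C.Nonempty → ((U \ W) \ C).Nonempty →
    ∃ a ∈ C, ∃ b ∈ (U \ W) \ C, G.Adj a b

theorem Conn2.closure {U W : Finset V} (h : Conn2 G U) (hW : W.card ≤ 1) {φ : V → Prop} {a : V}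
    (ha : a ∈ U) (haW : a ∉ W) (hφ : φ a)
    (hstep : ∀ x y, x ∈ U → x ∉ W → y ∈ U → y ∉ W → G.Adj x y → φ x → φ y) :
    ∀ z ∈ U, z ∉ W → φ z := by
  classical
  intro z hz hzW
  by_contra hφz
  obtain ⟨x, hx, y, hy, hxy⟩ := h W ((U \ W).filter φ) hW (Finset.filter_subset _ _)
    ⟨a, by simp [ha, haW, hφ]⟩ ⟨z, by simp [hz, hzW, hφz]⟩
  simp only [Finset.mem_filter, Finset.mem_sdiff] at hx hy
  exact hy.2 ⟨hy.1, hstep x y hx.1.1 hx.1.2 hy.1.1 hy.1.2 hxy hx.2⟩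

omit [DecidableEq V] in
theorem IsP.extend {U : Finset V} {u v w : V} {p : List V} (h : IsP G U u v p) (hw : w ∈ U)
    (hvw : G.Adj v w) : ∃ q, IsP G U u w q := by
  by_cases hwp : w ∈ p
  · obtain ⟨p₁, p₂, rfl⟩ := List.append_of_mem hwp
    exact ⟨_, h.front⟩
  · exact ⟨p ++ [w], h.append (IsP.single hw) hvw (by simp; rintro z hz rfl; exact hwp hz)⟩

theorem Conn2.exists_path {U W : Finset V} (h : Conn2 G U) (hW : W.card ≤ 1) {a b : V}
    (ha : a ∈ U) (haW : a ∉ W) (hb : b ∈ U) (hbW : b ∉ W) : ∃ p, IsP G (U \ W) a b p :=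
  h.closure hW (φ := fun z => ∃ p, IsP G (U \ W) a z p) ha haW
    ⟨_, IsP.single (by simp [ha, haW])⟩
    (fun _ _ _ _ hy hyW hxy ⟨_, hp⟩ => hp.extend (by simp [hy, hyW]) hxy) b hb hbW

/-- `v, Q, w` is a path from `v ∈ H` to `w ∈ P` whose interior `Q` avoids `H` and `P`. -/
structure Exit (G : SimpleGraph V) (U H P : Finset V) (v : V) (Q : List V) (w : V) : Prop where
  memH : v ∈ H
  memP : w ∈ P
  chain : (v :: (Q ++ [w])).IsChain G.Adj
  nodup : Q.Nodup
  out : ∀ z ∈ Q, z ∈ U ∧ z ∉ H ∧ z ∉ P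

omit [DecidableEq V] in
theorem exists_exit_of_last {U H P : Finset V} {a d w : V} {l : List V} (h : IsP G U a d l)
    (ha : a ∈ H) (hl : ∀ z ∈ l, z ∉ P) (hw : w ∈ P) (hdw : G.Adj d w) :
    ∃ v Q, Exit G U H P v Q w ∧ (Q = [] → v = d) ∧ v ∈ l ∧ ∀ z ∈ Q, z ∈ l := by
  obtain ⟨q₁, v, Q, rfl, hv, hQ⟩ := exists_last (p := l) (Y := fun z => z ∈ H) ⟨a, h.head_mem, ha⟩
  have h' := h.back
  refine ⟨v, Q, ⟨hv, hw, ?_, ?_, ?_⟩, ?_, by simp, by simp +contextual⟩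
  · rw [← List.cons_append, List.isChain_append]
    refine ⟨h'.chain, by simp, ?_⟩
    rw [h'.last]
    simpa using hdw
  · have := h'.nodup; simp at this; exact this.2
  · intro z hz
    exact ⟨h.sub z (by simp [hz]), hQ z hz, hl z (by simp [hz])⟩
  · rintro rfl
    simpa using h'.last

omit [DecidableEq V] in
theorem exists_exit {U H P : Finset V} {a b : V} {l : List V} (h : IsP G U a b l)
    (ha : a ∈ H) (hb : b ∈ P) (hHP : ∀ z ∈ H, z ∉ P) :
    ∃ v Q w, Exit G U H P v Q w ∧ v ∈ l ∧ w ∈ l ∧ ∀ z ∈ Q, z ∈ l := by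
  obtain ⟨l₁, w, l₂, rfl, hw, hl⟩ := exists_first (p := l) (Y := fun z => z ∈ P) ⟨b, h.last_mem, hb⟩
  have hf := h.front
  rcases List.eq_nil_or_concat l₁ with rfl | ⟨r, d, rfl⟩
  · have := hf.head
    simp at this
    subst this
    exact absurd hw (hHP _ ha)
  · rw [List.concat_eq_append] at hl hf ⊢
    have h1 : IsP G U a d (r ++ [d]) := by
      apply IsP.front (p₂ := [w]) (v := w)
      simpa using hf
    have hc := hf.chain
    simp only [List.append_assoc, List.cons_append, List.nil_append] at hc
    have h2 := (List.isChain_split.1 hc).2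
    simp at h2
    obtain ⟨v, Q, e1, -, e2, e3⟩ := exists_exit_of_last h1 ha hl hw h2
    refine ⟨v, Q, w, e1, ?_, by simp, ?_⟩
    · exact List.mem_append_left _ e2
    · exact fun z hz => List.mem_append_left _ (e3 z hz)

omit [DecidableEq V] in
theorem exists_mem_ne {H : Finset V} (hH : 2 ≤ H.card) (a : V) : ∃ x ∈ H, x ≠ a :=
  Finset.exists_mem_ne (by omega) a

theorem two_linkage {U H P : Finset V} (hU : Conn2 G U) (hHU : H ⊆ U) (hPU : P ⊆ U)
    (hH : 2 ≤ H.card) (hP : 2 ≤ P.card) : ∀ z ∈ U,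
    ∃ A B a b c, a ∈ H ∧ b ∈ H ∧ c ∈ P ∧ IsP G U a z A ∧ IsP G U b c B ∧ ∀ x ∈ A, x ∉ B := by
  have avoid : ∀ z, ∃ C a b, a ∈ H ∧ b ∈ P ∧ IsP G U a b C ∧ z ∉ C := by
    intro z
    obtain ⟨a, ha, haz⟩ := exists_mem_ne hH z
    obtain ⟨b, hb, hbz⟩ := exists_mem_ne hP z
    obtain ⟨C, hC⟩ := hU.exists_path (W := {z}) (by simp) (hHU ha) (by simpa) (hPU hb) (by simpa)
    refine ⟨C, a, b, ha, hb, hC.mono fun x hx => (Finset.mem_sdiff.1 (hC.sub x hx)).1, fun hz => ?_⟩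
    have := hC.sub z hz
    simp at this
  obtain ⟨h₀, hh₀⟩ : H.Nonempty := Finset.card_pos.1 (by omega)
  intro z hz
  refine hU.closure (W := ∅) (by simp) (φ := fun z => ∃ A B a b c, a ∈ H ∧ b ∈ H ∧ c ∈ P ∧
    IsP G U a z A ∧ IsP G U b c B ∧ ∀ x ∈ A, x ∉ B) (hHU hh₀) (by simp) ?_ ?_ z hz (by simp)
  · obtain ⟨C, a, b, ha, hb, hC, hzC⟩ := avoid h₀
    exact ⟨[h₀], C, h₀, a, b, hh₀, ha, hb, IsP.single (hHU hh₀), hC, by simpa using hzC⟩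
  · rintro x y - - hy - hxy ⟨A, B, a, b, c, ha, hb, hc, hA, hB, hd⟩
    by_cases hyA : y ∈ A
    · obtain ⟨a₁, a₂, rfl⟩ := List.append_of_mem hyA
      exact ⟨_, B, a, b, c, ha, hb, hc, hA.front, hB, by grind⟩
    by_cases hyB : y ∈ B
    · obtain ⟨b₁, b₂, rfl⟩ := List.append_of_mem hyB
      obtain ⟨C, a', c', ha', hc', hC, hyC⟩ := avoid y
      by_cases hex : ∃ w ∈ C, w ∈ A ∨ w ∈ b₁
      · obtain ⟨c₁, w, c₂, rfl, hw, hlast⟩ := exists_last (Y := fun w => w ∈ A ∨ w ∈ b₁) hex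
        rcases hw with hw | hw
        · obtain ⟨a₁, a₂, rfl⟩ := List.append_of_mem hw
          refine ⟨_, _, b, a, c', hb, ha, hc', hB.front, hA.front.glue hC.back ?_, ?_⟩ <;> grind
        · obtain ⟨d₁, d₂, rfl⟩ := List.append_of_mem hw
          have hB' : IsP G U b w (d₁ ++ [w]) := by
            apply IsP.front (p₂ := d₂ ++ y :: b₂)
            simpa using hB
          refine ⟨_, _, a, b, c', ha, hb, hc', hA.append (IsP.single hy) hxy ?_,
            hB'.glue hC.back ?_, ?_⟩
          · grind
          · grind
          · have := hB.nodup
            simp only [List.nodup_append, List.nodup_cons, List.mem_append, List.mem_cons] at this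
            grind
      · refine ⟨_, _, b, a', c', hb, ha', hc', hB.front, hC, ?_⟩
        grind
    · exact ⟨_, _, a, b, c, ha, hb, hc, hA.append (IsP.single hy) hxy (by grind), hB, by grind⟩

/-- Two disjoint exits exist in a 2-connected set. -/
theorem two_exits {U H P : Finset V} (hU : Conn2 G U) (hHU : H ⊆ U) (hPU : P ⊆ U)
    (hH : 2 ≤ H.card) (hP : 2 ≤ P.card) (hHP : ∀ z ∈ H, z ∉ P) :
    ∃ v₁ Q₁ w₁ v₂ Q₂ w₂, Exit G U H P v₁ Q₁ w₁ ∧ Exit G U H P v₂ Q₂ w₂ ∧ v₁ ≠ v₂ ∧ w₁ ≠ w₂ ∧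
      ∀ z ∈ Q₁, z ∉ Q₂ := by
  obtain ⟨z, hz⟩ : P.Nonempty := Finset.card_pos.1 (by omega)
  obtain ⟨A, B, a, b, c, ha, hb, hc, hA, hB, hd⟩ := two_linkage hU hHU hPU hH hP z (hPU hz)
  obtain ⟨v₁, Q₁, w₁, e₁, h₁, h₂, h₃⟩ := exists_exit hA ha hz hHP
  obtain ⟨v₂, Q₂, w₂, e₂, k₁, k₂, k₃⟩ := exists_exit hB hb hc hHP
  refine ⟨v₁, Q₁, w₁, v₂, Q₂, w₂, e₁, e₂, ?_, ?_, ?_⟩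
  · rintro rfl; exact hd _ h₁ k₁
  · rintro rfl; exact hd _ h₂ k₂
  · exact fun z h1 h2 => hd z (h₃ z h1) (k₃ z h2)

open Classical in
/-- The vertices of `T` with a neighbour in `A`. -/
noncomputable def nbs (G : SimpleGraph V) (T A : Finset V) : Finset V :=
  T.filter (fun t => ∃ a ∈ A, G.Adj a t)

omit [DecidableEq V] in
theorem mem_nbs {T A : Finset V} {t : V} : t ∈ nbs G T A ↔ t ∈ T ∧ ∃ a ∈ A, G.Adj a t := by
  simp [nbs]

theorem critical_side {A T W C D : Finset V}
    (hmin : ∀ A' ⊆ A, A'.Nonempty → A' ≠ A → A'.card + 1 ≤ (nbs G T A').card)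
    (hCD : C ∪ D = (A ∪ nbs G T A) \ W) (hC : C.Nonempty) (hD : D.Nonempty)
    (hno : ∀ a ∈ C, ∀ b ∈ D, ¬ G.Adj a b) (hdis : ∀ a ∈ C, a ∉ D) :
    (C ∩ A).card + 1 ≤ (C ∩ nbs G T A).card + (W ∩ nbs G T A).card := by
  have key : ∀ x, x ∈ C ∨ x ∈ D ↔ (x ∈ A ∨ x ∈ nbs G T A) ∧ x ∉ W := by
    intro x
    rw [← Finset.mem_union, hCD, Finset.mem_sdiff, Finset.mem_union]
  by_cases h0 : (C ∩ A).Nonempty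
  · by_cases h1 : C ∩ A = A
    · exfalso
      obtain ⟨d, hd⟩ := hD
      have hAC : A ⊆ C := by rw [← h1]; exact Finset.inter_subset_left
      have hdA : d ∉ A := fun h => hdis d (hAC h) hd
      have := ((key d).1 (Or.inr hd)).1
      obtain ⟨-, a, ha, had⟩ := mem_nbs.1 (this.resolve_left hdA)
      exact hno a (hAC ha) d hd had
    · refine (hmin _ Finset.inter_subset_right h0 h1).trans ?_
      refine (Finset.card_le_card (t := (C ∩ nbs G T A) ∪ (W ∩ nbs G T A)) ?_).trans
        (Finset.card_union_le _ _)
      intro t ht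
      obtain ⟨htT, a, ha, hat⟩ := mem_nbs.1 ht
      simp only [Finset.mem_inter] at ha
      have htN : t ∈ nbs G T A := mem_nbs.2 ⟨htT, a, ha.2, hat⟩
      simp only [Finset.mem_union, Finset.mem_inter, htN, and_true]
      by_contra hcon
      push Not at hcon
      have := ((key t).2 ⟨Or.inr htN, hcon.2⟩).resolve_left hcon.1
      exact hno a ha.1 t this hat
  · rw [Finset.not_nonempty_iff_eq_empty] at h0
    obtain ⟨c, hc⟩ := hC
    have hcA : c ∉ A := fun h => by
      have : c ∈ C ∩ A := Finset.mem_inter.2 ⟨hc, h⟩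
      rw [h0] at this; simp at this
    have hcN := ((key c).1 (Or.inl hc)).1.resolve_left hcA
    have : 1 ≤ (C ∩ nbs G T A).card := Finset.card_pos.2 ⟨c, by simp [hc, hcN]⟩
    simp [h0]
    omega

theorem critical_conn2 {S A T : Finset V}
    (hA : A ⊆ S) (hT : ∀ z ∈ T, z ∉ S)
    (hmin : ∀ A' ⊆ A, A'.Nonempty → A' ≠ A → A'.card + 1 ≤ (nbs G T A').card)
    (hcard : A.card = (nbs G T A).card) : Conn2 G (A ∪ nbs G T A) := by
  intro W C hW hC hCne hDne
  by_contra hcon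
  push Not at hcon
  set D := ((A ∪ nbs G T A) \ W) \ C with hDdef
  have hCD : C ∪ D = (A ∪ nbs G T A) \ W := Finset.union_sdiff_of_subset hC
  have hdis : ∀ a ∈ C, a ∉ D := by simp +contextual [hDdef]
  have h1 := critical_side hmin hCD hCne hDne hcon hdis
  have h2 := critical_side hmin (by rw [Finset.union_comm]; exact hCD) hDne hCne
    (fun a ha b hb h => hcon b hb a ha h.symm) (fun a ha hc => hdis a hc ha)
  have hAN : Disjoint A (nbs G T A) := by
    rw [Finset.disjoint_left]
    exact fun x hx hx' => hT x (mem_nbs.1 hx').1 (hA hx)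
  have split : ∀ B ⊆ A ∪ nbs G T A, B.card = (C ∩ B).card + (D ∩ B).card + (W ∩ B).card := by
    intro B hB
    rw [← Finset.card_union_of_disjoint, ← Finset.card_union_of_disjoint]
    · congr 1
      ext x
      have := @hB x
      have hx : x ∈ C ∪ D ↔ x ∈ (A ∪ nbs G T A) \ W := by rw [hCD]
      grind
    · rw [Finset.disjoint_left]
      intro x hx hx'
      have hx2 : x ∈ C ∪ D := by grind
      rw [hCD] at hx2
      grind
    · rw [Finset.disjoint_left]
      intro x hx hx'
      exact hdis x (by grind) (by grind)
  have s1 := split A Finset.subset_union_left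
  have s2 := split (nbs G T A) Finset.subset_union_right
  have hW2 : (W ∩ A).card + (W ∩ nbs G T A).card ≤ W.card := by
    rw [← Finset.card_union_of_disjoint]
    · exact Finset.card_le_card (by intro x; simp; tauto)
    · exact hAN.mono Finset.inter_subset_right Finset.inter_subset_right
  omega

/-- A critical Hall violator spans a 2-connected balanced set. -/
theorem exists_critical {S S₁ T : Finset V} (hS₁ : S₁ ⊆ S) (hne : S₁.Nonempty) (hT : ∀ z ∈ T, z ∉ S) (hcard : T.card ≤ S₁.card) :
    (∃ a ∈ S₁, nb G T a = ∅) ∨ ∃ A ⊆ S₁, ∃ N ⊆ T, A.Nonempty ∧ A.card = N.card ∧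
      (∀ a ∈ A, nb G T a ⊆ N) ∧ Conn2 G (A ∪ N) := by
  classical
  have hex : ∃ n, ∃ A ⊆ S₁, A.Nonempty ∧ (nbs G T A).card ≤ A.card ∧ A.card = n :=
    ⟨_, S₁, Finset.Subset.refl _, hne, (Finset.card_le_card (Finset.filter_subset _ _)).trans hcard, rfl⟩
  obtain ⟨A, hAS, hA, hAN, hAn⟩ := Nat.find_spec hex
  have hmin0 : ∀ A' ⊆ A, A'.Nonempty → A' ≠ A → A'.card + 1 ≤ (nbs G T A').card := by
    intro A' hA' hne' hneq
    by_contra hlt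
    have h1 : A'.card < A.card := Finset.card_lt_card (hA'.ssubset_of_ne hneq)
    rw [hAn] at h1
    exact Nat.find_min hex h1 ⟨A', hA'.trans hAS, hne', by omega, rfl⟩
  have hmono : ∀ A' ⊆ A, (nbs G T A').card ≤ (nbs G T A).card := by
    intro A' hA'
    apply Finset.card_le_card
    intro t ht
    obtain ⟨h1, a, h2, h3⟩ := mem_nbs.1 ht
    exact mem_nbs.2 ⟨h1, a, hA' h2, h3⟩
  rcases hAN.lt_or_eq with hlt | heq
  · left
    obtain ⟨a, ha⟩ := hA
    refine ⟨a, hAS ha, ?_⟩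
    by_cases h1 : (A.erase a).Nonempty
    · exfalso
      have := hmin0 (A.erase a) (Finset.erase_subset _ _) h1
        (fun h => by rw [← h] at ha; simp at ha)
      have h2 := hmono (A.erase a) (Finset.erase_subset _ _)
      rw [Finset.card_erase_of_mem ha] at this
      omega
    · rw [Finset.not_nonempty_iff_eq_empty] at h1
      have : A.card = 1 := by
        have := Finset.card_erase_of_mem ha
        rw [h1] at this
        have := Finset.card_pos.2 ⟨a, ha⟩
        simp at *; omega
      have h0 : nbs G T A = ∅ := Finset.card_eq_zero.1 (by omega)
      rw [Finset.eq_empty_iff_forall_notMem] at h0 ⊢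
      intro t ht
      rw [mem_nb] at ht
      exact h0 t (mem_nbs.2 ⟨ht.1, a, ha, ht.2⟩)
  · right
    refine ⟨A, hAS, nbs G T A, Finset.filter_subset _ _, hA, heq.symm, ?_, ?_⟩
    · intro a ha t ht
      rw [mem_nb] at ht
      exact mem_nbs.2 ⟨ht.1, a, ha, ht.2⟩
    · exact critical_conn2 (hAS.trans hS₁) hT hmin0 heq.symm

theorem tc_append {S : Finset V} {p q : List V} (h : ∀ z ∈ p, z ∉ q) :
    tc S (p ++ q) = tc S p + tc S q := by
  unfold tc
  rw [← Finset.card_union_of_disjoint]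
  · congr 1
    ext z
    simp only [Finset.mem_union, Finset.mem_sdiff, List.mem_toFinset, List.mem_append]
    tauto
  · rw [Finset.disjoint_left]
    intro z hz hz'
    simp only [Finset.mem_sdiff, List.mem_toFinset] at hz hz'
    exact h z hz.1 hz'.1

theorem tc_reverse {S : Finset V} {p : List V} : tc S p.reverse = tc S p := by
  simp [tc]

theorem reroute_count {S U : Finset V} {u v w : V} {P : List V} (h : IsP G U u v P) (hw : w ∈ P)
    {Y : Finset V} (hYP : Y ⊆ P.toFinset) (hY : (Y \ {w}).Nonempty) {Q : List V}
    (hQ : Q.Nodup) (hQU : ∀ z ∈ Q, z ∈ U) (hQP : ∀ z ∈ Q, z ∉ P)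
    (hc : ∀ y ∈ Y, (w :: (Q ++ [y])).IsChain G.Adj) :
    ∃ p, IsP G U u v p ∧ tc S Q + (insert w Y \ S).card ≤ tc S p ∧
      ∀ y ∈ P, y ∉ S → y ∈ p → tc S Q + (insert y (insert w Y \ S)).card ≤ tc S p := by
  obtain ⟨I, hIP, hIY, hwI, p, hp, hpe⟩ := reroute h hw hYP hY hQ hQU hQP hc
  have main : ∀ F : Finset V, (∀ x ∈ F, x ∈ P ∧ x ∉ S ∧ x ∉ I) → tc S Q + F.card ≤ tc S p := by
    intro F hF
    unfold tc
    rw [← Finset.card_union_of_disjoint, hpe]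
    · apply Finset.card_le_card
      intro x
      have := hF x
      simp only [Finset.mem_union, Finset.mem_sdiff, List.mem_toFinset]
      tauto
    · rw [Finset.disjoint_left]
      intro x hx hx'
      simp only [Finset.mem_sdiff, List.mem_toFinset] at hx
      exact hQP x hx.1 (hF x hx').1
  have hF : ∀ x ∈ insert w Y \ S, x ∈ P ∧ x ∉ S ∧ x ∉ I := by
    intro x hx
    simp only [Finset.mem_sdiff, Finset.mem_insert] at hx
    rcases hx.1 with rfl | hxY
    · exact ⟨hw, hx.2, hwI⟩
    · exact ⟨List.mem_toFinset.1 (hYP hxY), hx.2, fun hI => Finset.disjoint_left.1 hIY hI hxY⟩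
  refine ⟨p, hp, main _ hF, fun y hy hyS hyp => main _ fun x hx => ?_⟩
  rcases Finset.mem_insert.1 hx with rfl | hx
  · refine ⟨hy, hyS, fun hI => ?_⟩
    have : x ∈ (P.toFinset \ I) ∪ Q.toFinset := by rw [← hpe]; simpa using hyp
    simp only [Finset.mem_union, Finset.mem_sdiff, List.mem_toFinset] at this
    rcases this with h | h
    · exact h.2 hI
    · exact hQP x h hy
  · exact hF x hx

omit [DecidableEq V] in
theorem bridge_chain {H : Finset V} {b v w y : V} {l Q Q₂ : List V} (hl : IsP G H b v l)
    (hQ : (v :: (Q ++ [w])).IsChain G.Adj) (hQ₂ : (b :: (Q₂ ++ [y])).IsChain G.Adj) :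
    (w :: ((Q.reverse ++ l.reverse ++ Q₂) ++ [y])).IsChain G.Adj := by
  have hr : (l.reverse).IsChain G.Adj := hl.reverse.chain
  have hlast : l.reverse.getLast? = some b := hl.reverse.last
  have hhead : l.reverse.head? = some v := hl.reverse.head
  have hQr : (w :: Q.reverse ++ [v]).IsChain G.Adj := by
    have : (w :: Q.reverse ++ [v]) = (v :: (Q ++ [w])).reverse := by simp
    rw [this, List.isChain_reverse]
    exact hQ.imp fun _ _ h => h.symm
  have e : w :: ((Q.reverse ++ l.reverse ++ Q₂) ++ [y]) =
      (w :: Q.reverse) ++ (l.reverse ++ (Q₂ ++ [y])) := by simp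
  rw [e, List.isChain_append]
  rw [List.isChain_append] at hQr
  refine ⟨hQr.1, ?_, ?_⟩
  · rw [List.isChain_append]
    refine ⟨hr, (List.isChain_cons.1 hQ₂).2, ?_⟩
    intro x hx z hz
    rw [hlast] at hx
    obtain rfl : b = x := by simpa using hx
    exact (List.isChain_cons.1 hQ₂).1 z hz
  · intro x hx z hz
    rw [List.head?_append, hhead] at hz
    exact hQr.2.2 x hx z (by simpa using hz)

theorem bridge {S U H : Finset V} {u v₀ v w b : V} {P Q Q₂ l : List V} (h : IsP G U u v₀ P)
    (hHU : H ⊆ U) (hHP : ∀ z ∈ H, z ∉ P) (e : Exit G U H P.toFinset v Q w) (hl : IsP G H b v l)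
    {Y : Finset V} (hYP : Y ⊆ P.toFinset) (hY : (Y \ {w}).Nonempty)
    (hQ₂ : Q₂.Nodup) (hQ₂' : ∀ z ∈ Q₂, z ∈ U ∧ z ∉ H ∧ z ∉ P.toFinset) (hd : ∀ z ∈ Q, z ∉ Q₂)
    (hc : ∀ y ∈ Y, (b :: (Q₂ ++ [y])).IsChain G.Adj) :
    ∃ p, IsP G U u v₀ p ∧ tc S Q + tc S l + tc S Q₂ + (insert w Y \ S).card ≤ tc S p ∧
      ∀ y ∈ P, y ∉ S → y ∈ p →
        tc S Q + tc S l + tc S Q₂ + (insert y (insert w Y \ S)).card ≤ tc S p := by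
  have hlH := hl.sub
  have hout := e.out
  have ht : tc S (Q.reverse ++ l.reverse ++ Q₂) = tc S Q + tc S l + tc S Q₂ := by
    rw [tc_append, tc_append, tc_reverse, tc_reverse] <;>
    · intro z
      have := hlH z
      have := hout z
      have := hQ₂' z
      have := hd z
      simp only [List.mem_append, List.mem_reverse]
      tauto
  rw [← ht]
  refine reroute_count h (by simpa using e.memP) hYP hY ?_ ?_ ?_
    fun y hy => bridge_chain hl e.chain (hc y hy)
  · rw [List.nodup_append', List.nodup_append']
    refine ⟨⟨List.nodup_reverse.2 e.nodup, List.nodup_reverse.2 hl.nodup, ?_⟩, hQ₂, ?_⟩ <;>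
    · intro z
      have := hlH z
      have := hout z
      have := hQ₂' z
      have := hd z
      simp only [List.mem_append, List.mem_reverse]
      tauto
  · intro z
    have := hlH z
    have := hout z
    have := hQ₂' z
    have := @hHU z
    simp only [List.mem_append, List.mem_reverse]
    tauto
  · intro z
    have := hlH z
    have := hout z
    have := hQ₂' z
    have := hHP z
    simp only [List.mem_append, List.mem_reverse, List.mem_toFinset] at *
    tauto

/-- The conclusion of the main induction for the vertex set `U`. -/
def Good (G : SimpleGraph V) (S U : Finset V) : Prop :=
  ∀ (u v : V) (Z : Finset V) (k : ℕ), u ∈ U → v ∈ U → u ≠ v → Z ⊆ U → (∀ z ∈ Z, z ∉ S) →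
    Z.card ≤ 1 → (Z.Nonempty → u ∈ S ∧ v ∈ S) →
    (∀ x ∈ U, x ∈ S → x ≠ u → k ≤ (nb G (U \ Z) x).card) → k ≤ ((U \ S) \ Z).card →
    ((U \ S) \ Z).card + 1 ≤ (U ∩ S).card + (if u ∈ S then 0 else 1) + (if v ∈ S then 0 else 1) →
    ∃ p, IsP G U u v p ∧ k ≤ tc S p

theorem exists_path_balanced {S A N : Finset V} (hA : A ⊆ S) (hN : ∀ z ∈ N, z ∉ S)
    (hcard : A.card = N.card)
    (hgood : Good G S (A ∪ N)) {p q : V} (hp : p ∈ A ∪ N) (hq : q ∈ A ∪ N) (hpq : p ≠ q) {K : ℕ}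
    (hK : ∀ x ∈ A, x ≠ p → K ≤ (nb G N x).card) (hKN : K ≤ N.card) :
    ∃ l, IsP G (A ∪ N) p q l ∧ K ≤ tc S l + (if p ∈ S ∧ q ∈ S then 1 else 0) := by
  have e1 : (A ∪ N) \ S = N := by
    ext z; have := @hA z; have := hN z; simp only [Finset.mem_sdiff, Finset.mem_union]; tauto
  have e2 : (A ∪ N) ∩ S = A := by
    ext z; have := @hA z; have := hN z; simp only [Finset.mem_inter, Finset.mem_union]; tauto
  have hxA : ∀ x ∈ A ∪ N, x ∈ S → x ∈ A := fun x hx hxS => by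
    rw [← e2]; exact Finset.mem_inter.2 ⟨hx, hxS⟩
  by_cases hS : p ∈ S ∧ q ∈ S
  · obtain ⟨t, ht⟩ : N.Nonempty := by
      rw [← Finset.card_pos, ← hcard]
      exact Finset.card_pos.2 ⟨p, hxA p hp hS.1⟩
    suffices h : ∃ l, IsP G (A ∪ N) p q l ∧ K - 1 ≤ tc S l by
      obtain ⟨l, hl, hl'⟩ := h
      exact ⟨l, hl, by simp only [hS, and_self, if_true]; omega⟩
    refine hgood p q {t} (K - 1) hp hq hpq (by simp [ht]) (by simpa using hN t ht)
      (by simp) (fun _ => hS) ?_ ?_ ?_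
    · intro x hx hxS hxp
      have h1 := hK x (hxA x hx hxS) hxp
      have h2 : (nb G N x).card ≤ (insert t (nb G ((A ∪ N) \ {t}) x)).card := by
        apply Finset.card_le_card
        intro y
        simp only [mem_nb, Finset.mem_insert, Finset.mem_sdiff, Finset.mem_union,
          Finset.mem_singleton]
        tauto
      have h3 := Finset.card_insert_le t (nb G ((A ∪ N) \ {t}) x)
      omega
    · rw [e1, Finset.sdiff_singleton_eq_erase, Finset.card_erase_of_mem ht]; omega
    · rw [e1, e2, Finset.sdiff_singleton_eq_erase, Finset.card_erase_of_mem ht]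
      have := Finset.card_pos.2 ⟨t, ht⟩
      simp only [hS, if_true]; omega
  · suffices h : ∃ l, IsP G (A ∪ N) p q l ∧ K ≤ tc S l by
      obtain ⟨l, hl, hl'⟩ := h
      exact ⟨l, hl, by omega⟩
    refine hgood p q ∅ K hp hq hpq (by simp) (by simp) (by simp) (by simp) ?_ ?_ ?_
    · intro x hx hxS hxp
      refine (hK x (hxA x hx hxS) hxp).trans (Finset.card_le_card ?_)
      intro y
      simp only [mem_nb, Finset.mem_sdiff, Finset.mem_union]
      simp; tauto
    · simpa [e1] using hKN
    · simp only [e1, e2, Finset.sdiff_empty]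
      by_cases h1 : p ∈ S <;> by_cases h2 : q ∈ S <;> simp [h1, h2] <;> first | omega | tauto

/-- `P` is a `u`-`v` path maximizing `tc` among the paths in `U`, with `tc P < k`; the set `A ∪ N` is
balanced, disjoint from `P`, and every vertex of `A` has `k` neighbours in `N ∪ M`, `M ⊆ P`. -/
structure Block (G : SimpleGraph V) (S U : Finset V) (u v : V) (P : List V) (A N M : Finset V)
    (k : ℕ) : Prop where
  bip : ∀ a b, G.Adj a b → (a ∈ S ↔ b ∉ S)
  conn : Conn2 G U
  path : IsP G U u v P
  ne : u ≠ v
  max : ∀ p, IsP G U u v p → tc S p ≤ tc S P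
  lt : tc S P < k
  subA : A ⊆ S
  subN : ∀ z ∈ N, z ∉ S
  card : A.card = N.card
  nonempty : A.Nonempty
  sub : A ∪ N ⊆ U
  dis : ∀ z ∈ A ∪ N, z ∉ P
  good : Good G S (A ∪ N)
  subM : M ⊆ P.toFinset
  deg : ∀ x ∈ A, k ≤ (nb G N x).card + (nb G M x).card

theorem nb_sdiff {S M : Finset V} (hb : ∀ a b, G.Adj a b → (a ∈ S ↔ b ∉ S)) {b w : V} (hbS : b ∈ S) :
    nb G M b ⊆ insert w (nb G M b) \ S := by
  intro y hy
  have := (hb b y (mem_nb.1 hy).2).1 hbS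
  simp [this, hy]

theorem Exit.first {S U H P : Finset V} (hb : ∀ a b, G.Adj a b → (a ∈ S ↔ b ∉ S)) {v w : V}
    {Q : List V} (e : Exit G U H P v Q w) (hv : v ∈ S) :
    (Q = [] ∧ w ∉ S ∧ G.Adj v w) ∨ (Q ≠ [] ∧ 1 ≤ tc S Q) := by
  have hc := e.chain
  cases Q with
  | nil =>
    simp at hc
    exact Or.inl ⟨rfl, (hb _ _ hc).1 hv, hc⟩
  | cons z Q =>
    simp at hc
    refine Or.inr ⟨by simp, Finset.card_pos.2 ⟨z, ?_⟩⟩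
    simp [(hb _ _ hc.1).1 hv]

namespace Block

variable {S U A N M : Finset V} {u v₀ : V} {P : List V} {k : ℕ}

theorem mem_A (c : Block G S U u v₀ P A N M k) {x : V} (hx : x ∈ A ∪ N) (hxS : x ∈ S) : x ∈ A := by
  rcases Finset.mem_union.1 hx with h | h
  · exact h
  · exact absurd hxS (c.subN x h)

theorem not_P (c : Block G S U u v₀ P A N M k) : ∀ z ∈ A ∪ N, z ∉ P.toFinset := by
  intro z hz
  simpa using c.dis z hz

theorem std_le (c : Block G S U u v₀ P A N M k) {b v w : V} {Q : List V} {K : ℕ} (hbA : b ∈ A)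
    (e : Exit G U (A ∪ N) P.toFinset v Q w) (hv : v ≠ b)
    (hK : ∀ x ∈ A, x ≠ b → K ≤ (nb G N x).card) (hKN : K ≤ N.card)
    (hY : (nb G M b \ {w}).Nonempty) :
    ∃ p, IsP G U u v₀ p ∧
      tc S Q + K + (insert w (nb G M b) \ S).card ≤ tc S p + (if v ∈ S then 1 else 0) ∧
      ∀ y ∈ P, y ∉ S → y ∈ p → tc S Q + K + (insert y (insert w (nb G M b) \ S)).card ≤
        tc S p + (if v ∈ S then 1 else 0) := by
  obtain ⟨l, hl, hlK⟩ := exists_path_balanced c.subA c.subN c.card c.good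
    (Finset.mem_union_left _ hbA) e.memH hv.symm hK hKN
  simp only [c.subA hbA, true_and] at hlK
  obtain ⟨p, hp, hp1, hp2⟩ := bridge (S := S) c.path c.sub c.dis e hl (Y := nb G M b) (Q₂ := [])
    (fun y hy => c.subM (mem_nb.1 hy).1) hY (by simp) (by simp) (by simp)
    (by intro y hy; simpa using (mem_nb.1 hy).2)
  have h0 : tc S ([] : List V) = 0 := by simp [tc]
  rw [h0] at hp1 hp2
  refine ⟨p, hp, by omega, fun y h1 h2 h3 => ?_⟩
  have := hp2 y h1 h2 h3
  omega

theorem std_lt (c : Block G S U u v₀ P A N M k) {b v w : V} {Q : List V} {K : ℕ} (hbA : b ∈ A)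
    (e : Exit G U (A ∪ N) P.toFinset v Q w) (hv : v ≠ b)
    (hK : ∀ x ∈ A, x ≠ b → K ≤ (nb G N x).card) (hKN : K ≤ N.card)
    (hY : (nb G M b \ {w}).Nonempty) : (nb G M b).card + K ≤ k := by
  obtain ⟨p, hp, hp1, -⟩ := c.std_le hbA e hv hK hKN hY
  have := c.max p hp
  have := c.lt
  have := Finset.card_le_card (nb_sdiff c.bip (M := M) (w := w) (c.subA hbA))
  split_ifs at hp1 <;> omega

theorem std_stuck (c : Block G S U u v₀ P A N M k) {b v w : V} {Q : List V} {K : ℕ} (hbA : b ∈ A)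
    (e : Exit G U (A ∪ N) P.toFinset v Q w) (hv : v ≠ b)
    (hK : ∀ x ∈ A, x ≠ b → K ≤ (nb G N x).card) (hKN : K ≤ N.card)
    (hY : (nb G M b \ {w}).Nonempty) (hk : k ≤ (nb G M b).card + K) :
    v ∈ S ∧ Q = [] ∧ w ∈ nb G M b := by
  obtain ⟨p, hp, hp1, -⟩ := c.std_le hbA e hv hK hKN hY
  have h1 := c.max p hp
  have h2 := c.lt
  have h3 := Finset.card_le_card (nb_sdiff c.bip (M := M) (w := w) (c.subA hbA))
  by_cases hvS : v ∈ S
  · simp only [hvS, if_true] at hp1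
    refine ⟨hvS, ?_⟩
    rcases e.first c.bip hvS with ⟨hQ, hw, -⟩ | ⟨-, hQ⟩
    · refine ⟨hQ, ?_⟩
      by_contra hwY
      have : insert w (nb G M b) ⊆ insert w (nb G M b) \ S := by
        intro x hx
        rcases Finset.mem_insert.1 hx with rfl | hx
        · simp [hw]
        · exact nb_sdiff c.bip (c.subA hbA) hx
      have := Finset.card_le_card this
      rw [Finset.card_insert_of_notMem hwY] at this
      omega
    · omega
  · simp only [hvS, if_false] at hp1
    omega

theorem pair_le (c : Block G S U u v₀ P A N M k) {v₁ v₂ w₁ w₂ : V} {Q₁ Q₂ : List V} {K : ℕ}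
    (e₁ : Exit G U (A ∪ N) P.toFinset v₁ Q₁ w₁) (e₂ : Exit G U (A ∪ N) P.toFinset v₂ Q₂ w₂)
    (hv : v₁ ≠ v₂) (hw : w₁ ≠ w₂) (hQ : ∀ z ∈ Q₁, z ∉ Q₂)
    (hK : ∀ x ∈ A, K ≤ (nb G N x).card) (hKN : K ≤ N.card) :
    K + (if v₁ ∈ S ∨ v₂ ∈ S then 1 else 0) ≤ tc S P := by
  obtain ⟨l, hl, hlK⟩ := exists_path_balanced c.subA c.subN c.card c.good
    e₂.memH e₁.memH hv.symm (fun x hx _ => hK x hx) hKN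
  obtain ⟨p, hp, hp1, -⟩ := bridge (S := S) c.path c.sub c.dis e₁ hl (Y := {w₂}) (Q₂ := Q₂)
    (by simpa using e₂.memP) ⟨w₂, by simp [hw.symm]⟩ e₂.nodup e₂.out hQ
    (by intro y hy; obtain rfl := Finset.mem_singleton.1 hy; exact e₂.chain)
  have h1 := c.max p hp
  have f₁ : v₁ ∈ S → 1 ≤ tc S Q₁ ∨ w₁ ∉ S := fun h => by
    rcases e₁.first c.bip h with h | h <;> tauto
  have f₂ : v₂ ∈ S → 1 ≤ tc S Q₂ ∨ w₂ ∉ S := fun h => by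
    rcases e₂.first c.bip h with h | h <;> tauto
  have hcard : (insert w₁ ({w₂} : Finset V) \ S).card =
      (if w₁ ∈ S then 0 else 1) + (if w₂ ∈ S then 0 else 1) := by
    by_cases g1 : w₁ ∈ S <;> by_cases g2 : w₂ ∈ S
    · have : insert w₁ ({w₂} : Finset V) \ S = ∅ := by ext; simp; grind
      simp [this, g1, g2]
    · have : insert w₁ ({w₂} : Finset V) \ S = {w₂} := by ext; simp; grind
      simp [this, g1, g2]
    · have : insert w₁ ({w₂} : Finset V) \ S = {w₁} := by ext; simp; grind
      simp [this, g1, g2]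
    · have : insert w₁ ({w₂} : Finset V) \ S = {w₁, w₂} := by ext; simp; grind
      simp [this, g1, g2, hw]
  rw [hcard] at hp1
  by_cases a1 : v₁ ∈ S <;> by_cases a2 : v₂ ∈ S <;> by_cases a3 : w₁ ∈ S <;>
    by_cases a4 : w₂ ∈ S <;> simp [a1, a2, a3, a4] at * <;> omega

theorem two_le_P (c : Block G S U u v₀ P A N M k) : 2 ≤ P.toFinset.card := by
  have : ({u, v₀} : Finset V) ⊆ P.toFinset := by
    intro x hx
    have h1 := c.path.head_mem
    have h2 := c.path.last_mem
    simp at hx ⊢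
    rcases hx with rfl | rfl <;> assumption
  have := Finset.card_le_card this
  rwa [Finset.card_pair c.ne] at this

theorem two_le_H (c : Block G S U u v₀ P A N M k) : 2 ≤ (A ∪ N).card := by
  rw [Finset.card_union_of_disjoint]
  · have := c.card
    have := Finset.card_pos.2 c.nonempty
    omega
  · rw [Finset.disjoint_left]
    exact fun x hx hx' => c.subN x hx' (c.subA hx)

theorem P_sub (c : Block G S U u v₀ P A N M k) : P.toFinset ⊆ U := by
  intro x hx
  exact c.path.sub x (by simpa using hx)

theorem stuck_aux (c : Block G S U u v₀ P A N M k) {b v₁ v₂ w₁ w₂ : V} {Q₁ Q₂ : List V}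
    (hbA : b ∈ A) (hbmax : ∀ x ∈ A, (nb G M x).card ≤ (nb G M b).card)
    (e₁ : Exit G U (A ∪ N) P.toFinset v₁ Q₁ w₁) (e₂ : Exit G U (A ∪ N) P.toFinset v₂ Q₂ w₂)
    (hv : v₁ ≠ v₂) (hw : w₁ ≠ w₂) (hQ : ∀ z ∈ Q₁, z ∉ Q₂) (h1 : v₁ ≠ b) :
    ∃ v ∈ A, v ≠ b ∧ ∃ w ∈ nb G M b, G.Adj v w ∧ (nb G M b \ {w}).Nonempty ∧
      ∀ v Q w, Exit G U (A ∪ N) P.toFinset v Q w → v ∈ S ∧ Q = [] := by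
  set σ := (nb G M b).card with hσ
  have hlt := c.lt
  have hK : ∀ x ∈ A, k - σ ≤ (nb G N x).card := fun x hx => by
    have := c.deg x hx
    have := hbmax x hx
    omega
  have hle : ∀ x, (nb G N x).card ≤ N.card := fun x => Finset.card_le_card fun y hy => (mem_nb.1 hy).1
  have hKN : k - σ ≤ N.card := (hK b hbA).trans (hle b)
  have hpair := c.pair_le e₁ e₂ hv hw hQ hK hKN
  by_cases hσ2 : 2 ≤ σ
  · have hYne : ∀ b' w, 2 ≤ (nb G M b').card → (nb G M b' \ {w}).Nonempty := fun b' w h => by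
      obtain ⟨y, hy, hyw⟩ := exists_mem_ne h w
      exact ⟨y, by simp [hyw, (mem_nb.1 hy).1, (mem_nb.1 hy).2]⟩
    obtain ⟨s1, s2, s3⟩ := c.std_stuck hbA e₁ h1 (fun x hx _ => hK x hx) hKN (hYne b w₁ hσ2)
      (by omega)
    have hv₁A := c.mem_A e₁.memH s1
    have hadj : G.Adj v₁ w₁ := by have := e₁.chain; rw [s2] at this; simpa using this
    refine ⟨v₁, hv₁A, h1, w₁, s3, hadj, hYne b w₁ hσ2, ?_⟩
    intro v Q w e
    by_cases hvb : v = b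
    · subst hvb
      refine ⟨c.subA hbA, ?_⟩
      by_cases hb2 : ∃ b₂ ∈ A, b₂ ≠ v ∧ (nb G M b₂).card = σ
      · obtain ⟨b₂, hb₂A, hb₂, hb₂σ⟩ := hb2
        exact (c.std_stuck hb₂A e hb₂.symm (fun x hx _ => hK x hx) hKN (hYne b₂ w (by omega))
          (by omega)).2.1
      · exfalso
        push Not at hb2
        have hK' : ∀ x ∈ A, x ≠ v → k - σ + 1 ≤ (nb G N x).card := fun x hx hxv => by
          have := c.deg x hx
          have := hbmax x hx
          have := hb2 x hx hxv
          have := c.std_lt hbA e₁ h1 (fun x hx _ => hK x hx) hKN (hYne v w₁ hσ2)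
          omega
        have := c.std_lt hbA e₁ h1 hK' ((hK' v₁ hv₁A h1).trans (hle _)) (hYne v w₁ hσ2)
        omega
    · have := c.std_stuck hbA e hvb (fun x hx _ => hK x hx) hKN (hYne b w hσ2) (by omega)
      exact ⟨this.1, this.2.1⟩
  · exfalso
    by_cases hσ0 : σ = 0
    · rw [hσ0] at hpair
      omega
    · have hσ1 : (nb G M b).card = 1 := by omega
      obtain ⟨y, hy⟩ := Finset.card_eq_one.1 hσ1
      have hno : ∀ v Q w, Exit G U (A ∪ N) P.toFinset v Q w → v ≠ b → w = y := by
        intro v Q w e hvb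
        by_contra hwy
        have := c.std_stuck hbA e hvb (fun x hx _ => hK x hx) hKN
          (by rw [hy]; exact ⟨y, by simp; exact Ne.symm hwy⟩) (by omega)
        rw [hy] at this
        exact hwy (by simpa using this.2.2)
      have hv₂ : v₂ = b := by
        by_contra hv₂
        exact hw ((hno _ _ _ e₁ h1).trans (hno _ _ _ e₂ hv₂).symm)
      have : v₂ ∈ S := hv₂ ▸ c.subA hbA
      simp only [this, or_true, if_true] at hpair
      omega

/-- In a block there is a vertex of `A` with many neighbours on `P`, and every exit is an edge
from `A`. -/
theorem stuck (c : Block G S U u v₀ P A N M k) :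
    ∃ b ∈ A, (∀ x ∈ A, (nb G M x).card ≤ (nb G M b).card) ∧
    ∃ v ∈ A, v ≠ b ∧ ∃ w ∈ nb G M b, G.Adj v w ∧ (nb G M b \ {w}).Nonempty ∧
      ∀ v Q w, Exit G U (A ∪ N) P.toFinset v Q w → v ∈ S ∧ Q = [] := by
  obtain ⟨b, hbA, hbmax⟩ := Finset.exists_max_image A (fun x => (nb G M x).card) c.nonempty
  refine ⟨b, hbA, hbmax, ?_⟩
  obtain ⟨v₁, Q₁, w₁, v₂, Q₂, w₂, e₁, e₂, hv, hw, hQ⟩ :=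
    two_exits c.conn c.sub c.P_sub c.two_le_H c.two_le_P c.not_P
  by_cases h1 : v₁ = b
  · exact c.stuck_aux hbA hbmax e₂ e₁ hv.symm hw.symm (fun z h h' => hQ z h' h)
      (by rw [← h1]; exact hv.symm)
  · exact c.stuck_aux hbA hbmax e₁ e₂ hv hw hQ h1

end Block

/-- A minimal counterexample `U` to `Good`, with a path `P` maximizing `tc` and, among those,
avoiding the exceptional set `Z` if possible. -/
structure Counter (G : SimpleGraph V) (S U Z : Finset V) (u v : V) (P : List V) (k : ℕ) :
    Prop where
  bip : ∀ a b, G.Adj a b → (a ∈ S ↔ b ∉ S)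
  conn : Conn2 G U
  ih : ∀ U' : Finset V, U' ⊂ U → Conn2 G U' → Good G S U'
  ne : u ≠ v
  subZ : Z ⊆ U
  disZ : ∀ z ∈ Z, z ∉ S
  cardZ : Z.card ≤ 1
  endsZ : Z.Nonempty → u ∈ S ∧ v ∈ S
  deg : ∀ x ∈ U, x ∈ S → x ≠ u → k ≤ (nb G (U \ Z) x).card
  le_card : k ≤ ((U \ S) \ Z).card
  balance : ((U \ S) \ Z).card + 1 ≤
    (U ∩ S).card + (if u ∈ S then 0 else 1) + (if v ∈ S then 0 else 1)
  path : IsP G U u v P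
  lt : tc S P < k
  max : ∀ p, IsP G U u v p → tc S p ≤ tc S P
  max' : ∀ p, IsP G U u v p → tc S p = tc S P → (∀ z ∈ Z, z ∉ p) → ∀ z ∈ Z, z ∉ P

namespace Counter

variable {S U Z : Finset V} {u v : V} {P : List V} {k : ℕ}

theorem P_sub (c : Counter G S U Z u v P k) : P.toFinset ⊆ U := by
  intro x hx
  exact c.path.sub x (by simpa using hx)

theorem card_inter (c : Counter G S U Z u v P k) :
    (U ∩ S).card = (P.toFinset ∩ S).card + ((U \ P.toFinset) ∩ S).card := by
  rw [← Finset.card_union_of_disjoint]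
  · congr 1
    ext x
    have hs := c.P_sub
    have := @hs x
    simp only [Finset.mem_inter, Finset.mem_union, Finset.mem_sdiff]
    tauto
  · rw [Finset.disjoint_left]
    intro x
    simp only [Finset.mem_inter, Finset.mem_sdiff]
    tauto

theorem card_sdiff (c : Counter G S U Z u v P k) :
    (U \ S).card = tc S P + ((U \ P.toFinset) \ S).card := by
  unfold tc
  rw [← Finset.card_union_of_disjoint]
  · congr 1
    ext x
    have hs := c.P_sub
    have := @hs x
    simp only [Finset.mem_union, Finset.mem_sdiff]
    tauto
  · rw [Finset.disjoint_left]
    intro x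
    simp only [Finset.mem_sdiff]
    tauto

theorem not_mem_S (c : Counter G S U Z u v P k) {a b : V} (h : G.Adj a b) (ha : a ∈ S) : b ∉ S :=
  (c.bip a b h).1 ha

theorem good_of (c : Counter G S U Z u v P k) {H : Finset V} (hH : H ⊆ U) (hu : u ∉ H)
    (hc : Conn2 G H) : Good G S H :=
  c.ih H (hH.ssubset_of_ne (by rintro rfl; exact hu (c.path.sub u c.path.head_mem))) hc

/-- The degree of `x` splits over `P` and a set `T` containing the other neighbours. -/
theorem deg_split (c : Counter G S U Z u v P k) {x : V} (hxU : x ∈ U) (hxS : x ∈ S) (hxu : x ≠ u)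
    {T : Finset V} (hT : ∀ y ∈ U, y ∉ P → y ∉ S → y ∉ Z → G.Adj x y → y ∈ T) :
    k ≤ (nb G T x).card + (nb G (P.toFinset \ Z) x).card := by
  refine (c.deg x hxU hxS hxu).trans ?_
  refine (Finset.card_le_card (t := nb G T x ∪ nb G (P.toFinset \ Z) x) ?_).trans
    (Finset.card_union_le _ _)
  intro y hy
  simp only [mem_nb, Finset.mem_union, Finset.mem_sdiff, List.mem_toFinset] at hy ⊢
  have := hT y hy.1.1
  have := c.not_mem_S hy.2 hxS
  tauto

theorem nb_P_le (c : Counter G S U Z u v P k) {x : V} (hxS : x ∈ S) :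
    (nb G (P.toFinset \ Z) x).card ≤ ((P.toFinset \ S) \ Z).card := by
  apply Finset.card_le_card
  intro y hy
  simp only [mem_nb, Finset.mem_sdiff] at hy ⊢
  exact ⟨⟨hy.1.1, c.not_mem_S hy.2 hxS⟩, hy.1.2⟩

theorem nb_P_le' (c : Counter G S U Z u v P k) {x : V} (hxS : x ∈ S) :
    (nb G (P.toFinset \ Z) x).card ≤ tc S P :=
  (c.nb_P_le hxS).trans (Finset.card_le_card Finset.sdiff_subset)

theorem balance_compl (c : Counter G S U Z u v P k) (hZP : ∀ z ∈ Z, z ∉ P) :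
    (((U \ P.toFinset) \ S) \ Z).card ≤ ((U \ P.toFinset) ∩ S).card ∧
      ((U \ S) \ Z).card = tc S P + (((U \ P.toFinset) \ S) \ Z).card := by
  have h1 := tc_add_one c.bip c.path
  have h2 := c.balance
  have h3 := c.card_inter
  have h4 : ((U \ S) \ Z).card = tc S P + (((U \ P.toFinset) \ S) \ Z).card := by
    unfold tc
    rw [← Finset.card_union_of_disjoint]
    · congr 1
      ext x
      have hs := c.P_sub
      have := @hs x
      have := hZP x
      simp only [Finset.mem_union, Finset.mem_sdiff, List.mem_toFinset] at *
      tauto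
    · rw [Finset.disjoint_left]
      intro x
      simp only [Finset.mem_sdiff]
      tauto
  omega

/-- The critical block found inside a closed part `K` of the complement of `P`. -/
theorem exists_block (c : Counter G S U Z u v P k) {K : Finset V}
    (hK : K ⊆ U \ P.toFinset)
    (hclosed : ∀ a ∈ K, ∀ b ∈ U \ P.toFinset, G.Adj a b → b ∈ K) (hne : (K ∩ S).Nonempty)
    (hcard : ((K \ S) \ Z).card ≤ (K ∩ S).card) :
    ∃ A ⊆ K ∩ S, ∃ N ⊆ (K \ S) \ Z, Conn2 G (A ∪ N) ∧
      Block G S U u v P A N (P.toFinset \ Z) k := by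
  have hKU : ∀ x ∈ K, x ∈ U ∧ x ∉ P := by
    intro x hx; simpa using hK hx
  have huP := c.path.head_mem
  have hdeg : ∀ x ∈ K ∩ S, ∀ T : Finset V, nb G ((K \ S) \ Z) x ⊆ T →
      k ≤ (nb G T x).card + (nb G (P.toFinset \ Z) x).card := by
    intro x hx T hT
    obtain ⟨hxK, hxS⟩ := Finset.mem_inter.1 hx
    refine c.deg_split (hKU x hxK).1 hxS (by rintro rfl; exact (hKU _ hxK).2 huP) ?_
    intro y hyU hyP hyS hyZ hxy
    apply hT
    have := hclosed x hxK y (by simp [hyU, hyP]) hxy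
    simp [this, hyS, hyZ, hxy]
  rcases exists_critical (G := G) Finset.inter_subset_right hne
    (fun z hz => (Finset.mem_sdiff.1 (Finset.mem_sdiff.1 hz).1).2) hcard with
    ⟨a, ha, ha0⟩ | ⟨A, hA, N, hN, hAne, hAN, hnb, hconn⟩
  · exfalso
    have h1 := hdeg a ha ∅ (by rw [ha0])
    have h2 := c.nb_P_le' (Finset.mem_inter.1 ha).2
    have h3 : (nb G ∅ a).card = 0 := by
      rw [Finset.card_eq_zero, Finset.eq_empty_iff_forall_notMem]; simp
    have := c.lt
    omega
  · have hHK : A ∪ N ⊆ K := by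
      intro x hx
      rcases Finset.mem_union.1 hx with h | h
      · exact (Finset.mem_inter.1 (hA h)).1
      · exact (Finset.mem_sdiff.1 (Finset.mem_sdiff.1 (hN h)).1).1
    have hHU : A ∪ N ⊆ U := fun x hx => (hKU x (hHK hx)).1
    refine ⟨A, hA, N, hN, hconn, ⟨c.bip, c.conn, c.path, c.ne, c.max, c.lt,
      hA.trans Finset.inter_subset_right, ?_, hAN, hAne, hHU, ?_, ?_, Finset.sdiff_subset, ?_⟩⟩
    · intro z hz
      exact (Finset.mem_sdiff.1 (Finset.mem_sdiff.1 (hN hz)).1).2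
    · exact fun z hz => (hKU z (hHK hz)).2
    · exact c.good_of hHU (fun h => (hKU u (hHK h)).2 huP) hconn
    · exact fun x hx => hdeg x (hA hx) N (hnb x hx)

theorem exists_edge (c : Counter G S U Z u v P k)
    (hne : (U \ P.toFinset).Nonempty) :
    ∃ g ∈ P, g ∈ S ∧ ∃ t ∈ U \ P.toFinset, t ∉ S ∧ t ∉ Z ∧ G.Adj t g := by
  have hlt := c.lt
  have huP := c.path.head_mem
  have hvP := c.path.last_mem
  by_cases hg : ∃ g ∈ P, g ∈ S ∧ g ≠ u
  · obtain ⟨g, hgP, hgS, hgu⟩ := hg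
    refine ⟨g, hgP, hgS, ?_⟩
    by_contra hcon
    push Not at hcon
    have h1 := c.deg_split (c.path.sub g hgP) hgS hgu (T := ∅) (by
      intro y hyU hyP hyS hyZ hgy
      exact absurd hgy.symm (hcon y (by simp [hyU, hyP]) hyS hyZ))
    have h2 := c.nb_P_le' hgS
    have h3 : (nb G ∅ g).card = 0 := by
      rw [Finset.card_eq_zero, Finset.eq_empty_iff_forall_notMem]; simp
    omega
  · push Not at hg
    have halt := tc_add_one c.bip c.path
    have hvS : v ∉ S := fun h => c.ne (hg v hvP h).symm
    have huS : u ∈ S := by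
      by_contra huS
      have h0 : P.toFinset ∩ S = ∅ := by
        rw [Finset.eq_empty_iff_forall_notMem]
        intro x hx
        simp only [Finset.mem_inter, List.mem_toFinset] at hx
        exact huS (hg x hx.1 hx.2 ▸ hx.2)
      have h2 : ({u, v} : Finset V) ⊆ P.toFinset \ S := by
        intro x hx
        simp only [Finset.mem_insert, Finset.mem_singleton] at hx
        rcases hx with rfl | rfl <;> simp [*]
      have h3 := Finset.card_le_card h2
      rw [Finset.card_pair c.ne] at h3
      simp only [h0, huS, hvS, Finset.card_empty, if_false] at halt
      unfold tc at halt
      omega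
    have hPS : P.toFinset ∩ S = {u} := by
      ext x
      simp only [Finset.mem_inter, List.mem_toFinset, Finset.mem_singleton]
      exact ⟨fun h => hg x h.1 h.2, by rintro rfl; exact ⟨huP, huS⟩⟩
    simp only [hPS, huS, hvS, Finset.card_singleton, if_true, if_false] at halt
    have htc : (P.toFinset \ S).card = 1 := by unfold tc at halt; omega
    have hPT : ∀ x ∈ P, x ∉ S → x = v := by
      intro x hx hxS
      exact Finset.card_le_one.1 htc.le x (by simp [hx, hxS]) v (by simp [hvP, hvS])
    obtain ⟨a, ha, b, hb, hab⟩ := c.conn {v} (U \ P.toFinset) (by simp)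
      (by intro x hx; simp only [Finset.mem_sdiff, List.mem_toFinset, Finset.mem_singleton] at hx ⊢
          exact ⟨hx.1, by rintro rfl; exact hx.2 hvP⟩) hne
      ⟨u, by simp [huP, c.path.sub u huP, c.ne]⟩
    simp only [Finset.mem_sdiff, List.mem_toFinset, Finset.mem_singleton, not_and, not_not] at hb
    have hbP := hb.2 hb.1.1
    have hbS : b ∈ S := by
      by_contra hbS
      exact hb.1.2 (hPT b hbP hbS)
    refine ⟨b, hbP, hbS, a, ha, c.not_mem_S hab.symm hbS, ?_, hab⟩
    intro haZ
    exact hvS (c.endsZ ⟨a, haZ⟩).2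

open Classical in
/-- The component of `t` in `R`. -/
noncomputable def comp (G : SimpleGraph V) (R : Finset V) (t : V) : Finset V :=
  R.filter (fun z => ∃ p, IsP G R t z p)

omit [DecidableEq V] in
theorem mem_comp {R : Finset V} {t z : V} : z ∈ comp G R t ↔ z ∈ R ∧ ∃ p, IsP G R t z p := by
  simp [comp]

omit [DecidableEq V] in
theorem comp_closed {R : Finset V} {t : V} : ∀ a ∈ comp G R t, ∀ b ∈ R, G.Adj a b → b ∈ comp G R t := by
  intro a ha b hb hab
  obtain ⟨-, p, hp⟩ := mem_comp.1 ha
  exact mem_comp.2 ⟨hb, hp.extend hb hab⟩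

omit [DecidableEq V] in
theorem comp_sub {R : Finset V} {t : V} : comp G R t ⊆ R := fun _ h => (mem_comp.1 h).1

theorem card_compl_inter {R K S : Finset V} (h : K ⊆ R) :
    (R ∩ S).card = (K ∩ S).card + ((R \ K) ∩ S).card := by
  rw [← Finset.card_union_of_disjoint]
  · congr 1
    ext x
    have := @h x
    simp only [Finset.mem_inter, Finset.mem_union, Finset.mem_sdiff]
    tauto
  · rw [Finset.disjoint_left]
    intro x
    simp only [Finset.mem_inter, Finset.mem_sdiff]
    tauto

theorem card_compl_sdiff {R K S Z : Finset V} (h : K ⊆ R) :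
    ((R \ S) \ Z).card = ((K \ S) \ Z).card + (((R \ K) \ S) \ Z).card := by
  rw [← Finset.card_union_of_disjoint]
  · congr 1
    ext x
    have := @h x
    simp only [Finset.mem_union, Finset.mem_sdiff]
    tauto
  · rw [Finset.disjoint_left]
    intro x
    simp only [Finset.mem_sdiff]
    tauto

theorem false_of_no_excess (c : Counter G S U Z u v P k) (hZP : ∀ z ∈ Z, z ∉ P)
    (hno : ∀ K ⊆ U \ P.toFinset, (∀ a ∈ K, ∀ b ∈ U \ P.toFinset, G.Adj a b → b ∈ K) →
      (K ∩ S).card ≤ ((K \ S) \ Z).card) : False := by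
  obtain ⟨hbal, htot⟩ := c.balance_compl hZP
  have hne : (U \ P.toFinset).Nonempty := by
    by_contra h
    rw [Finset.not_nonempty_iff_eq_empty] at h
    have := c.le_card
    have := c.lt
    simp [h] at htot
    omega
  obtain ⟨g, hgP, hgS, t, htR, htS, htZ, htg⟩ := c.exists_edge hne
  obtain ⟨R, hR⟩ : ∃ R, R = U \ P.toFinset := ⟨_, rfl⟩
  rw [← hR] at hno hbal htot hne htR
  have htK : t ∈ comp G R t := mem_comp.2 ⟨htR, _, IsP.single htR⟩
  have h1 := hno (R \ comp G R t) Finset.sdiff_subset (by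
    intro a ha b hb hab
    simp only [Finset.mem_sdiff] at ha ⊢
    exact ⟨hb, fun h => ha.2 (comp_closed b h a ha.1 hab.symm)⟩)
  have h2 := card_compl_inter (S := S) (comp_sub (G := G) (R := R) (t := t))
  have h3 := card_compl_sdiff (S := S) (Z := Z) (comp_sub (G := G) (R := R) (t := t))
  have h4 : 1 ≤ ((comp G R t \ S) \ Z).card := Finset.card_pos.2 ⟨t, by simp [htK, htS, htZ]⟩
  obtain ⟨A, hA, N, hN, -, blk⟩ := c.exists_block (K := comp G R t)
    (hR ▸ comp_sub) (by rw [← hR]; exact comp_closed) (Finset.card_pos.1 (by omega)) (by omega)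
  obtain ⟨b, hbA, -, -, -, -, -, -, -, -, hstuck⟩ := blk.stuck
  obtain ⟨-, p, hp⟩ := mem_comp.1 (Finset.mem_inter.1 (hA hbA)).1
  have hp' : IsP G U b t p.reverse := hp.reverse.mono (by
    intro z hz
    have := hp.sub z (by simpa using hz)
    rw [hR] at this
    exact (Finset.mem_sdiff.1 this).1)
  obtain ⟨x, Q, e, hxt, -⟩ := exists_exit_of_last (P := P.toFinset) (w := g) hp'
    (Finset.mem_union_left N hbA) (by
      intro z hz
      have := hp.sub z (by simpa using hz)
      rw [hR] at this
      exact (Finset.mem_sdiff.1 this).2) (by simpa using hgP) htg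
  obtain ⟨hxS, hQ⟩ := hstuck _ _ _ e
  exact htS (hxt hQ ▸ hxS)

theorem false_of_excess (c : Counter G S U Z u v P k)
    {K : Finset V} (hKR : K ⊆ U \ P.toFinset)
    (hclosed : ∀ a ∈ K, ∀ b ∈ U \ P.toFinset, G.Adj a b → b ∈ K)
    (hK : ((K \ S) \ Z).card + 1 ≤ (K ∩ S).card)
    (hpath : ∀ a ∈ K, ∀ b ∈ K, ∃ p, IsP G K a b p) : False := by
  obtain ⟨A, hA, N, hN, hconn, blk⟩ := c.exists_block hKR hclosed
    (Finset.card_pos.1 (by omega)) (by omega)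
  obtain ⟨b, hbA, hbmax, v', hv'A, hv'b, w, hw, hv'w, hY, hstuck⟩ := blk.stuck
  have hKU : ∀ x ∈ K, x ∈ U ∧ x ∉ P := by
    intro x hx; simpa using hKR hx
  have hAK : ∀ x ∈ A, x ∈ K ∧ x ∈ S := fun x hx => by simpa using hA hx
  have hHK : A ∪ N ⊆ K := by
    intro x hx
    rcases Finset.mem_union.1 hx with h | h
    · exact (hAK x h).1
    · exact (Finset.mem_sdiff.1 (Finset.mem_sdiff.1 (hN h)).1).1
  have hKP : ∀ d ∈ K, ∀ w' ∈ P, G.Adj d w' → d ∈ A := by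
    intro d hd w' hw' hdw
    obtain ⟨l, hl⟩ := hpath b (hAK b hbA).1 d hd
    obtain ⟨x, Q, e, hxd, -⟩ := exists_exit_of_last (P := P.toFinset) (w := w')
      (hl.mono fun z hz => (hKU z (hl.sub z hz)).1)
      (Finset.mem_union_left N hbA) (fun z hz => by simpa using (hKU z (hl.sub z hz)).2)
      (by simpa using hw') hdw
    obtain ⟨hxS, hQ⟩ := hstuck _ _ _ e
    have := blk.mem_A e.memH hxS
    rwa [hxd hQ] at this
  have huP := c.path.head_mem
  have hvP := c.path.last_mem
  have hside : ∀ W C : Finset V, W.card ≤ 1 → C ⊆ K \ W → C.Nonempty → (∀ x ∈ C, x ∉ A) →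
      ∃ a ∈ C, ∃ b ∈ (K \ W) \ C, G.Adj a b := by
    intro W C hW hC hCne hCA
    obtain ⟨a, ha, b, hb, hab⟩ := c.conn W C hW
      (fun x hx => by
        have := hC hx
        simp only [Finset.mem_sdiff] at this ⊢
        exact ⟨(hKU x this.1).1, this.2⟩) hCne (by
        have hCP : ∀ x ∈ P, x ∉ C := fun x hx hxC =>
          (hKU x (Finset.mem_sdiff.1 (hC hxC)).1).2 hx
        by_cases huW : u ∈ W
        · have hvW : v ∉ W := fun hvW => c.ne (Finset.card_le_one.1 hW u huW v hvW)
          exact ⟨v, by simp [hvW, hCP v hvP, c.path.sub v hvP]⟩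
        · exact ⟨u, by simp [huW, hCP u huP, c.path.sub u huP]⟩)
    simp only [Finset.mem_sdiff] at hb
    have haK := (Finset.mem_sdiff.1 (hC ha)).1
    have hbP : b ∉ P := fun hbP => hCA a ha (hKP a haK b hbP hab)
    exact ⟨a, ha, b, by simp [hb.1.2, hb.2, hclosed a haK b (by simp [hb.1.1, hbP]) hab], hab⟩
  have hconnK : Conn2 G K := by
    intro W C hW hC hCne hDne
    by_cases h1 : ∀ x ∈ C, x ∉ A ∪ N
    · exact hside W C hW hC hCne fun x hx hxA => h1 x hx (Finset.mem_union_left _ hxA)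
    by_cases h2 : ∀ x ∈ (K \ W) \ C, x ∉ A ∪ N
    · obtain ⟨a, ha, b, hb, hab⟩ := hside W ((K \ W) \ C) hW Finset.sdiff_subset hDne
        fun x hx hxA => h2 x hx (Finset.mem_union_left _ hxA)
      rw [Finset.sdiff_sdiff_eq_self hC] at hb
      exact ⟨b, hb, a, ha, hab.symm⟩
    push Not at h1 h2
    obtain ⟨x, hxC, hxH⟩ := h1
    obtain ⟨y, hyD, hyH⟩ := h2
    have hxW := (Finset.mem_sdiff.1 (hC hxC)).2
    simp only [Finset.mem_sdiff] at hyD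
    obtain ⟨a, ha, b, hb, hab⟩ := hconn W (C ∩ (A ∪ N)) hW (fun z hz => by
        simp only [Finset.mem_inter] at hz
        exact Finset.mem_sdiff.2 ⟨hz.2, (Finset.mem_sdiff.1 (hC hz.1)).2⟩)
      ⟨x, Finset.mem_inter.2 ⟨hxC, hxH⟩⟩
      ⟨y, Finset.mem_sdiff.2 ⟨Finset.mem_sdiff.2 ⟨hyH, hyD.1.2⟩,
        fun h => hyD.2 (Finset.mem_inter.1 h).1⟩⟩
    refine ⟨a, (Finset.mem_inter.1 ha).1, b, ?_, hab⟩
    simp only [Finset.mem_sdiff, Finset.mem_inter] at hb ⊢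
    exact ⟨⟨hHK hb.1.1, hb.1.2⟩, fun h => hb.2 ⟨h, hb.1.1⟩⟩
  have hdeg : ∀ x ∈ K, x ∈ S →
      k - (nb G (P.toFinset \ Z) b).card ≤ (nb G ((K \ S) \ Z) x).card := by
    intro x hxK hxS
    have h1 := c.deg_split (hKU x hxK).1 hxS (by rintro rfl; exact (hKU _ hxK).2 huP)
      (T := (K \ S) \ Z) (by
        intro y hyU hyP hyS hyZ hxy
        simp [hyS, hyZ, hclosed x hxK y (by simp [hyU, hyP]) hxy])
    have h2 : (nb G (P.toFinset \ Z) x).card ≤ (nb G (P.toFinset \ Z) b).card := by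
      by_cases hxA : x ∈ A
      · exact hbmax x hxA
      · have : nb G (P.toFinset \ Z) x = ∅ := by
          rw [Finset.eq_empty_iff_forall_notMem]
          intro y hy
          simp only [mem_nb, Finset.mem_sdiff, List.mem_toFinset] at hy
          exact hxA (hKP x hxK y hy.1.1 hy.2)
        simp [this]
    omega
  have hgoodK := c.good_of (fun x hx => (hKU x hx).1) (fun h => (hKU u h).2 huP) hconnK
  have eZ : (K \ S) \ (Z ∩ K) = (K \ S) \ Z := by
    ext x; simp only [Finset.mem_sdiff, Finset.mem_inter]; tauto
  obtain ⟨l, hl, hlk⟩ : ∃ l, IsP G K b v' l ∧ k - (nb G (P.toFinset \ Z) b).card ≤ tc S l := by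
    have hbK := hAK b hbA
    have hvK := hAK v' hv'A
    refine hgoodK b v' (Z ∩ K) _ hbK.1 hvK.1 hv'b.symm Finset.inter_subset_right
      (fun z hz => c.disZ z (Finset.mem_inter.1 hz).1)
      ((Finset.card_le_card Finset.inter_subset_left).trans c.cardZ) (fun _ => ⟨hbK.2, hvK.2⟩)
      ?_ ?_ ?_
    · intro x hxK hxS _
      refine (hdeg x hxK hxS).trans (Finset.card_le_card ?_)
      intro y
      simp only [mem_nb, Finset.mem_sdiff, Finset.mem_inter]
      tauto
    · rw [eZ]
      exact (hdeg b hbK.1 hbK.2).trans (Finset.card_le_card fun y hy => (mem_nb.1 hy).1)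
    · rw [eZ]
      simp only [hbK.2, hvK.2, if_true]
      omega
  have hwP : w ∈ P := by
    have := (mem_nb.1 hw).1
    simp at this
    exact this.1
  obtain ⟨p, hp, hp1, -⟩ := bridge (S := S) (H := K) c.path (fun x hx => (hKU x hx).1)
    (fun x hx => (hKU x hx).2) (v := v') (Q := []) (w := w)
    ⟨(hAK v' hv'A).1, by simpa using hwP, by simpa using hv'w, by simp, by simp⟩ hl
    (Y := nb G (P.toFinset \ Z) b) (Q₂ := [])
    (fun y hy => (Finset.mem_sdiff.1 (mem_nb.1 hy).1).1) hY (by simp) (by simp) (by simp)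
    (by intro y hy; simpa using (mem_nb.1 hy).2)
  have h1 := Finset.card_le_card (nb_sdiff c.bip (M := P.toFinset \ Z) (w := w) (hAK b hbA).2)
  have h2 := c.max p hp
  have h3 := c.lt
  omega

theorem false_of_avoids (c : Counter G S U Z u v P k) (hZP : ∀ z ∈ Z, z ∉ P) : False := by
  classical
  by_cases hno : ∀ K ⊆ U \ P.toFinset, (∀ a ∈ K, ∀ b ∈ U \ P.toFinset, G.Adj a b → b ∈ K) →
      (K ∩ S).card ≤ ((K \ S) \ Z).card
  · exact c.false_of_no_excess hZP hno
  push Not at hno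
  have hex : ∃ n, ∃ K ⊆ U \ P.toFinset, (∀ a ∈ K, ∀ b ∈ U \ P.toFinset, G.Adj a b → b ∈ K) ∧
      ((K \ S) \ Z).card < (K ∩ S).card ∧ K.card = n := by
    obtain ⟨K, h1, h2, h3⟩ := hno
    exact ⟨_, K, h1, h2, h3, rfl⟩
  obtain ⟨K, hKR, hclosed, hK, hKn⟩ := Nat.find_spec hex
  refine c.false_of_excess hKR hclosed hK ?_
  intro a ha
  by_contra hcon
  push Not at hcon
  obtain ⟨b, hb, hab⟩ := hcon
  have hCK := comp_sub (G := G) (R := K) (t := a)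
  have haC : a ∈ comp G K a := mem_comp.2 ⟨ha, _, IsP.single ha⟩
  have hbC : b ∉ comp G K a := fun h => by
    obtain ⟨-, p, hp⟩ := mem_comp.1 h
    exact hab p hp
  have small : ∀ C ⊆ K, (∀ x ∈ C, ∀ y ∈ K, G.Adj x y → y ∈ C) → C ≠ K →
      (C ∩ S).card ≤ ((C \ S) \ Z).card := by
    intro C hC hcl hne
    by_contra hlt
    have h1 : C.card < K.card := Finset.card_lt_card (hC.ssubset_of_ne hne)
    rw [hKn] at h1
    exact Nat.find_min hex h1 ⟨C, hC.trans hKR,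
      fun x hx y hy hxy => hcl x hx y (hclosed x (hC hx) y hy hxy) hxy, by omega, rfl⟩
  have s1 := small (comp G K a) hCK comp_closed (fun h => hbC (by rw [h]; exact hb))
  have s2 := small (K \ comp G K a) Finset.sdiff_subset (by
    intro x hx y hy hxy
    simp only [Finset.mem_sdiff] at hx ⊢
    exact ⟨hy, fun h => hx.2 (comp_closed y h x hx.1 hxy.symm)⟩) (fun h => by
      rw [← h] at ha
      exact (Finset.mem_sdiff.1 ha).2 haC)
  have s3 := card_compl_inter (S := S) hCK
  have s4 := card_compl_sdiff (S := S) (Z := Z) hCK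
  omega

end Counter

/-- Replace the tail of a path after `w` by a path `D` that meets it only in the last vertex. -/
theorem retail {S U : Finset V} {u v w : V} {l₁ l₂ D : List V}
    (h : IsP G U u v (l₁ ++ w :: l₂)) (hwv : w ≠ v) (hD : IsP G U w v (w :: D))
    (hd : ∀ z ∈ D, z ∈ l₁ ++ w :: l₂ → z = v) :
    IsP G U u v ((l₁ ++ [w]) ++ D) ∧ tc S ((l₁ ++ [w]) ++ D) = tc S (l₁ ++ [w]) + tc S D := by
  have hv : v ∉ l₁ ++ [w] := by
    have hl := h.back.last_mem
    have hn := h.nodup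
    simp only [List.mem_cons, hwv.symm, false_or] at hl
    grind
  have hdis : ∀ z ∈ l₁ ++ [w], z ∉ D := by
    intro z hz hzD
    have hzv := hd z hzD (by grind)
    exact hv (hzv ▸ hz)
  refine ⟨?_, tc_append hdis⟩
  rw [List.append_assoc]
  exact h.front.glue hD fun z hz => hdis z (by simp [hz])

namespace Counter

variable {S U Z : Finset V} {u v : V} {P : List V} {k : ℕ}

theorem not_mem_of_max (c : Counter G S U Z u v P k) {y : V} (hy : y ∈ Z) (hyP : y ∈ P)
    {p : List V} (hp : IsP G U u v p) (h : k ≤ tc S p + 1) (hk : y ∈ p → k ≤ tc S p) : False := by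
  have h1 := c.max p hp
  have h2 := c.lt
  by_cases hyp : y ∈ p
  · have := hk hyp; omega
  · refine c.max' p hp (by omega) (fun z hz => ?_) y hy hyP
    rwa [Finset.card_le_one.1 c.cardZ z hz y hy]

/-- The exceptional vertex lies on `P`: the block avoids the end-vertex `v`. -/
theorem false_of_block (c : Counter G S U Z u v P k) {y : V} (hy : y ∈ Z) (hyP : y ∈ P)
    {A N : Finset V} (blk : Block G S U u v P A N (P.toFinset \ Z) k) : False := by
  obtain ⟨b, hbA, hbmax, v', hv'A, hv'b, w, hw, hv'w, hY, -⟩ := blk.stuck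
  have hbS := blk.subA hbA
  have hwP : w ∈ P.toFinset := (Finset.mem_sdiff.1 (mem_nb.1 hw).1).1
  have hKN := blk.deg b hbA
  have hNb : (nb G N b).card ≤ N.card := Finset.card_le_card fun x hx => (mem_nb.1 hx).1
  obtain ⟨p, hp, hp1, hp2⟩ := blk.std_le (v := v') (Q := []) (w := w)
    (K := k - (nb G (P.toFinset \ Z) b).card) hbA
    ⟨Finset.mem_union_left _ hv'A, hwP, by simpa using hv'w, by simp, by simp⟩ hv'b
    (fun x hx _ => by have := blk.deg x hx; have := hbmax x hx; omega) (by omega) hY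
  have h1 := Finset.card_le_card (nb_sdiff c.bip (M := P.toFinset \ Z) (w := w) hbS)
  simp only [blk.subA hv'A, if_true] at hp1 hp2
  refine c.not_mem_of_max hy hyP hp (by omega) fun hyp => ?_
  have h2 := hp2 y hyP (c.disZ y hy) hyp
  rw [Finset.card_insert_of_notMem] at h2
  · omega
  · intro h
    simp only [Finset.mem_sdiff, Finset.mem_insert, mem_nb] at h hw
    rcases h.1 with rfl | h
    · exact hw.1.2 hy
    · exact h.1.2 hy

theorem false_of_end (c : Counter G S U Z u v P k) {y : V} (hy : y ∈ Z) (hyP : y ∈ P)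
    {A N : Finset V} (hA : A ⊆ insert v ((U \ P.toFinset) ∩ S)) (hN : N ⊆ (U \ P.toFinset) \ S)
    (hcard : A.card = N.card) (hvA : v ∈ A) (hconn : Conn2 G (A ∪ N))
    (hdeg : ∀ x ∈ A, k ≤ (nb G N x).card + (nb G (P.toFinset \ Z) x).card) : False := by
  have hvS : v ∈ S := (c.endsZ ⟨y, hy⟩).2
  have huS : u ∈ S := (c.endsZ ⟨y, hy⟩).1
  have hvP := c.path.last_mem
  have huP := c.path.head_mem
  have hlt := c.lt
  have hyS := c.disZ y hy
  have hAS : A ⊆ S := by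
    intro x hx
    rcases Finset.mem_insert.1 (hA hx) with rfl | h
    · exact hvS
    · exact (Finset.mem_inter.1 h).2
  have hNS : ∀ z ∈ N, z ∉ S := fun z hz => (Finset.mem_sdiff.1 (hN hz)).2
  have hHP : ∀ z ∈ A ∪ N, z ∈ P → z = v := by
    intro z hz hzP
    rcases Finset.mem_union.1 hz with h | h
    · rcases Finset.mem_insert.1 (hA h) with rfl | h
      · rfl
      · simp [hzP] at h
    · have := hN h
      simp [hzP] at this
  have hHU : A ∪ N ⊆ U := by
    intro z hz
    rcases Finset.mem_union.1 hz with h | h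
    · rcases Finset.mem_insert.1 (hA h) with rfl | h
      · exact c.path.sub _ hvP
      · simp at h; exact h.1.1
    · have := hN h
      simp at this; exact this.1.1
  have hyH : y ∉ A ∪ N := fun h => hyS (hHP y h hyP ▸ hvS)
  have hgood := c.good_of hHU (fun h => c.ne (hHP u h huP)) hconn
  have hNx : ∀ x, (nb G N x).card ≤ N.card :=
    fun x => Finset.card_le_card fun z hz => (mem_nb.1 hz).1
  by_cases hA2 : ∀ x ∈ A, x = v
  · have h1 : A.card ≤ 1 := Finset.card_le_one.2 fun a ha b hb => (hA2 a ha).trans (hA2 b hb).symm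
    have h2 := hdeg v hvA
    have h3 := c.nb_P_le hvS
    have h4 : ((P.toFinset \ S) \ Z).card < tc S P :=
      Finset.card_lt_card ⟨Finset.sdiff_subset, fun h => by
        have := h (Finset.mem_sdiff.2 ⟨List.mem_toFinset.2 hyP, hyS⟩)
        exact (Finset.mem_sdiff.1 this).2 hy⟩
    have := hNx v
    omega
  push Not at hA2
  obtain ⟨x', hx'A, hx'v⟩ := hA2
  obtain ⟨x, hx, hxmax⟩ := Finset.exists_max_image (A.erase v)
    (fun x => (nb G (P.toFinset \ Z) x).card) ⟨x', by simp [hx'A, hx'v]⟩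
  obtain ⟨hxv, hxA⟩ := Finset.mem_erase.1 hx
  have hxS := hAS hxA
  have hK : ∀ z ∈ A, z ≠ v → k - (nb G (P.toFinset \ Z) x).card ≤ (nb G N z).card := by
    intro z hz hzv
    have := hdeg z hz
    have := hxmax z (Finset.mem_erase.2 ⟨hzv, hz⟩)
    omega
  have hKN := (hK x hxA hxv).trans (hNx x)
  by_cases hσ : (nb G (P.toFinset \ Z) x).Nonempty
  · obtain ⟨l, hl, hlK⟩ := exists_path_balanced hAS hNS hcard hgood
      (Finset.mem_union_left N hvA) (Finset.mem_union_left N hxA) hxv.symm hK hKN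
    simp only [hvS, hxS, and_self, if_true] at hlK
    obtain ⟨l₁, w, l₂, hP, hw, hl₂⟩ := exists_last (p := P)
      (Y := fun z => z ∈ nb G (P.toFinset \ Z) x) (by
        obtain ⟨z, hz⟩ := hσ
        refine ⟨z, ?_, hz⟩
        simp at hz
        exact hz.1.1)
    have hxw := (mem_nb.1 hw).2
    have hwS : w ∉ S := c.not_mem_S hxw hxS
    have hwP : w ∈ P := by simp [hP]
    obtain ⟨hp, htc⟩ := retail (S := S) (D := l.reverse) (hP ▸ c.path)
      (by rintro rfl; exact hwS hvS)
      ((IsP.single (c.path.sub w hwP)).append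
        (hl.reverse.mono fun z hz => hHU (hl.sub z (by simpa using hz))) hxw.symm
        (by
          intro z hz h
          have hwl : w ∈ l.reverse := by
            rw [← List.mem_singleton.1 hz]
            exact h
          exact hwS (hHP w (hl.sub w (List.mem_reverse.1 hwl)) hwP ▸ hvS)))
      (fun z hz hzP => hHP z (hl.sub z (by simpa using hz)) (hP ▸ hzP))
    rw [tc_reverse] at htc
    have hsub : nb G (P.toFinset \ Z) x ⊆ (l₁ ++ [w]).toFinset \ S := by
      intro z hz
      have h1 := mem_nb.1 hz
      have h2 := c.not_mem_S h1.2 hxS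
      have h3 : z ∈ P := by simpa using (Finset.mem_sdiff.1 h1.1).1
      rw [hP] at h3
      have h4 := fun h => hl₂ z h hz
      simp only [Finset.mem_sdiff, List.mem_toFinset]
      refine ⟨?_, h2⟩
      grind
    have h1 := Finset.card_le_card hsub
    change _ ≤ tc S (l₁ ++ [w]) at h1
    refine c.not_mem_of_max hy hyP hp (by omega) fun hyp => ?_
    have hyl : y ∉ l := fun h => hyH (hl.sub y h)
    have h2 : insert y (nb G (P.toFinset \ Z) x) ⊆ (l₁ ++ [w]).toFinset \ S := by
      refine Finset.insert_subset ?_ hsub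
      simp only [Finset.mem_sdiff, List.mem_toFinset]
      refine ⟨?_, hyS⟩
      simpa [hyl] using hyp
    have h3 := Finset.card_le_card h2
    rw [Finset.card_insert_of_notMem (by simp [hy])] at h3
    change _ ≤ tc S (l₁ ++ [w]) at h3
    omega
  · rw [Finset.not_nonempty_iff_eq_empty] at hσ
    simp only [hσ, Finset.card_empty, Nat.sub_zero] at hK hKN
    obtain ⟨q, hq⟩ := c.conn.exists_path (W := {v}) (by simp)
      (hHU (Finset.mem_union_left N hxA)) (by simpa using hxv)
      (c.path.sub u huP) (by simpa using c.ne)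
    obtain ⟨v₂, Q, w, e, -⟩ := exists_exit (H := (A ∪ N).erase v) (P := P.toFinset.erase v) hq
      (by simp [hxA, hxv]) (by simp [huP, c.ne])
      (by
        intro z hz hz'
        simp only [Finset.mem_erase, List.mem_toFinset] at hz hz'
        exact hz.1 (hHP z hz.2 hz'.2))
    obtain ⟨hv₂v, hv₂⟩ := Finset.mem_erase.1 e.memH
    have hwP := e.memP
    simp only [Finset.mem_erase, List.mem_toFinset] at hwP
    have hQ : ∀ z ∈ Q, z ∈ U ∧ z ∉ A ∪ N ∧ z ∉ P := by
      intro z hz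
      have := e.out z hz
      simp only [Finset.mem_sdiff, Finset.mem_singleton, Finset.mem_erase, List.mem_toFinset] at this
      tauto
    obtain ⟨l, hl, hlK⟩ := exists_path_balanced hAS hNS hcard hgood
      (Finset.mem_union_left N hvA) hv₂ hv₂v.symm hK hKN
    simp only [hvS, true_and] at hlK
    have hlw : IsP G U v w (l ++ (Q ++ [w])) := by
      obtain ⟨l', rfl⟩ := List.getLast?_eq_some_iff.1 hl.last
      refine ⟨?_, ?_, ?_, by rw [← List.append_assoc]; exact List.getLast?_concat, ?_⟩
      · rw [List.append_assoc]
        exact List.isChain_split.2 ⟨hl.chain, e.chain⟩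
      · have h1 := hl.nodup
        have h2 := e.nodup
        have h3 : ∀ z ∈ l' ++ [v₂], z ∉ Q ++ [w] := by
          intro z hz hz'
          rcases List.mem_append.1 hz' with h | h
          · exact (hQ z h).2.1 (hl.sub z hz)
          · rw [List.mem_singleton.1 h] at hz
            exact hwP.1 (hHP w (hl.sub w hz) hwP.2)
        refine List.nodup_append'.2 ⟨h1, List.nodup_append'.2 ⟨h2, by simp, ?_⟩, h3⟩
        intro z hz hz'
        rw [List.mem_singleton.1 hz'] at hz
        exact (hQ w hz).2.2 hwP.2
      · have := hl.head
        cases l' <;> simp_all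
      · intro z hz
        rcases List.mem_append.1 hz with h | h
        · exact hHU (hl.sub z h)
        · rcases List.mem_append.1 h with h | h
          · exact (hQ z h).1
          · rw [List.mem_singleton.1 h]; exact c.path.sub w hwP.2
    have hD : IsP G U w v (w :: (Q.reverse ++ l.reverse)) := by
      simpa using hlw.reverse
    obtain ⟨l₁, l₂, hP⟩ := List.append_of_mem hwP.2
    obtain ⟨hp, htc⟩ := retail (S := S) (hP ▸ c.path) hwP.1 hD (by
      intro z hz hzP
      rw [← hP] at hzP
      rcases List.mem_append.1 hz with h | h
      · exact absurd hzP (hQ z (by simpa using h)).2.2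
      · exact hHP z (hl.sub z (by simpa using h)) hzP)
    rw [tc_append (p := Q.reverse) (by
      intro z hz hz'
      exact (hQ z (by simpa using hz)).2.1 (hl.sub z (by simpa using hz'))), tc_reverse,
      tc_reverse] at htc
    have h1 := c.max _ hp
    by_cases hv₂S : v₂ ∈ S
    · rw [if_pos hv₂S] at hlK
      rcases e.first c.bip hv₂S with ⟨-, hwS, -⟩ | ⟨-, h⟩
      · have h2 : 1 ≤ tc S (l₁ ++ [w]) := Finset.card_pos.2 ⟨w, by simp [hwS]⟩
        omega
      · omega
    · rw [if_neg hv₂S] at hlK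
      omega

theorem false_of_meets (c : Counter G S U Z u v P k) {y : V} (hy : y ∈ Z) (hyP : y ∈ P) :
    False := by
  have hvS : v ∈ S := (c.endsZ ⟨y, hy⟩).2
  have huS : u ∈ S := (c.endsZ ⟨y, hy⟩).1
  have hvP := c.path.last_mem
  have huP := c.path.head_mem
  have hlt := c.lt
  have hyS := c.disZ y hy
  have hdeg : ∀ x ∈ insert v ((U \ P.toFinset) ∩ S), ∀ T : Finset V,
      nb G ((U \ P.toFinset) \ S) x ⊆ T →
      k ≤ (nb G T x).card + (nb G (P.toFinset \ Z) x).card := by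
    intro x hx T hT
    have hx' : x ∈ U ∧ x ∈ S ∧ x ≠ u := by
      simp only [Finset.mem_insert, Finset.mem_inter, Finset.mem_sdiff, List.mem_toFinset] at hx
      rcases hx with rfl | h
      · exact ⟨c.path.sub _ hvP, hvS, c.ne.symm⟩
      · exact ⟨h.1.1, h.2, fun e => h.1.2 (e ▸ huP)⟩
    refine c.deg_split hx'.1 hx'.2.1 hx'.2.2 fun z hzU hzP hzS _ hxz => hT ?_
    simp [hzU, hzP, hzS, hxz]
  have hcard : ((U \ P.toFinset) \ S).card ≤ (insert v ((U \ P.toFinset) ∩ S)).card := by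
    rw [Finset.card_insert_of_notMem (by simp [hvP])]
    have h1 := c.card_inter
    have h2 := c.card_sdiff
    have h3 := c.balance
    have h4 := tc_add_one c.bip c.path
    have h5 := Finset.card_le_card_sdiff_add_card (s := U \ S) (t := Z)
    have h6 := c.cardZ
    simp only [hvS, huS, if_true] at h3 h4
    omega
  rcases exists_critical (G := G) (S := S)
    (Finset.insert_subset hvS Finset.inter_subset_right) ⟨v, by simp⟩
    (fun z hz => (Finset.mem_sdiff.1 hz).2) hcard with
    ⟨a, ha, ha0⟩ | ⟨A, hA, N, hN, hAne, hAN, hnb, hconn⟩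
  · have haS : a ∈ S := by
      rcases Finset.mem_insert.1 ha with rfl | h
      · exact hvS
      · exact (Finset.mem_inter.1 h).2
    have h1 := hdeg a ha ∅ (by rw [ha0])
    have h2 := c.nb_P_le' haS
    have h3 : (nb G ∅ a).card = 0 := by
      rw [Finset.card_eq_zero, Finset.eq_empty_iff_forall_notMem]; simp
    omega
  · by_cases hvA : v ∈ A
    · exact c.false_of_end hy hyP hA hN hAN hvA hconn fun x hx => hdeg x (hA hx) N (hnb x hx)
    · have hAR : A ⊆ (U \ P.toFinset) ∩ S := fun x hx =>
        (Finset.mem_insert.1 (hA hx)).resolve_left fun h => hvA (h ▸ hx)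
      have hHR : ∀ x ∈ A ∪ N, x ∈ U ∧ x ∉ P := by
        intro x hx
        rcases Finset.mem_union.1 hx with h | h
        · simpa using (Finset.mem_inter.1 (hAR h)).1
        · simpa using (Finset.mem_sdiff.1 (hN h)).1
      have hHU : A ∪ N ⊆ U := fun x hx => (hHR x hx).1
      exact c.false_of_block hy hyP ⟨c.bip, c.conn, c.path, c.ne, c.max, c.lt,
        fun x hx => (Finset.mem_inter.1 (hAR hx)).2, fun z hz => (Finset.mem_sdiff.1 (hN hz)).2,
        hAN, hAne, hHU, fun z hz => (hHR z hz).2,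
        c.good_of hHU (fun h => (hHR u h).2 huP) hconn, Finset.sdiff_subset,
        fun x hx => hdeg x (hA hx) N (hnb x hx)⟩

end Counter

theorem good_of_conn2 {S : Finset V} (hb : ∀ a b, G.Adj a b → (a ∈ S ↔ b ∉ S)) :
    ∀ U : Finset V, Conn2 G U → Good G S U := by
  classical
  intro U
  induction U using Finset.strongInduction with
  | H U ih =>
    intro hU u v Z k hu hv huv hZU hZS hZ hZe hdeg hk hbal
    by_contra hcon
    push Not at hcon
    let f : List V → ℕ := fun p => 2 * tc S p + if ∀ z ∈ Z, z ∉ p then 1 else 0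
    obtain ⟨p₀, hp₀⟩ := hU.exists_path (W := ∅) (by simp) hu (by simp) hv (by simp)
    rw [Finset.sdiff_empty] at hp₀
    have hbd : ∀ n, (∃ p, IsP G U u v p ∧ f p = n) → n ≤ 2 * k := by
      rintro n ⟨p, hp, rfl⟩
      have := hcon p hp
      simp only [f]
      split_ifs <;> omega
    obtain ⟨P, hP, hPf⟩ := Nat.findGreatest_spec (P := fun n => ∃ p, IsP G U u v p ∧ f p = n)
      (hbd _ ⟨p₀, hp₀, rfl⟩) ⟨p₀, hp₀, rfl⟩
    have hmax : ∀ p, IsP G U u v p → f p ≤ f P := fun p hp => by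
      rw [hPf]
      exact Nat.le_findGreatest (hbd _ ⟨p, hp, rfl⟩) ⟨p, hp, rfl⟩
    have c : Counter G S U Z u v P k := by
      refine ⟨hb, hU, fun U' h h' => ih U' h h', huv, hZU, hZS, hZ, hZe, hdeg, hk, hbal, hP,
        hcon P hP, fun p hp => ?_, fun p hp h hpZ => ?_⟩
      · have := hmax p hp
        simp only [f] at this
        split_ifs at this <;> omega
      · by_contra hPZ
        have := hmax p hp
        simp only [f] at this
        rw [if_pos hpZ, if_neg hPZ] at this
        omega
    by_cases hZP : ∀ z ∈ Z, z ∉ P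
    · exact c.false_of_avoids hZP
    · push Not at hZP
      obtain ⟨z, hz, hzP⟩ := hZP
      exact c.false_of_meets hz hzP

theorem exists_boundary {W : Type*} {H : SimpleGraph W} (h : H.Connected) {C : Set W} {a b : W}
    (ha : a ∈ C) (hb : b ∉ C) : ∃ x ∈ C, ∃ y, y ∉ C ∧ H.Adj x y := by
  obtain ⟨p⟩ := h.preconnected a b
  obtain ⟨d, -, h1, h2⟩ := p.exists_boundary_dart C ha hb
  exact ⟨_, h1, _, h2, d.adj⟩

theorem conn2_univ [Fintype V] (h : G.Connected)
    (h' : ∀ v : V, (G.induce {u : V | u ≠ v}).Connected) : Conn2 G Finset.univ := by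
  rintro W C hW hC ⟨a, ha⟩ ⟨b, hb⟩
  simp only [Finset.mem_sdiff, Finset.mem_univ, true_and] at hb ⊢
  have haW := (Finset.mem_sdiff.1 (hC ha)).2
  rcases W.eq_empty_or_nonempty with rfl | ⟨w, hw⟩
  · obtain ⟨x, hx, y, hy, hxy⟩ := exists_boundary h (C := (C : Set V)) (a := a) (b := b)
      (by simpa using ha) (by simpa using hb.2)
    exact ⟨x, by simpa using hx, y, by simpa using hy, hxy⟩
  · have hWw : ∀ x, x ∈ W ↔ x = w := fun x =>
      ⟨fun hx => Finset.card_le_one.1 hW x hx w hw, fun hx => hx ▸ hw⟩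
    obtain ⟨x, hx, y, hy, hxy⟩ := exists_boundary (h' w) (C := {x | x.1 ∈ C})
      (a := ⟨a, fun e => haW ((hWw a).2 e)⟩) (b := ⟨b, fun e => hb.1 ((hWw b).2 e)⟩) ha hb.2
    exact ⟨x, hx, y, ⟨fun e => y.2 ((hWw y).1 e), hy⟩, hxy⟩

omit [DecidableEq V] in
theorem IsP.exists_walk {U : Finset V} {u v : V} {p : List V} (h : IsP G U u v p) :
    ∃ q : G.Walk u v, q.IsPath ∧ q.support = p := by
  have hne : p ≠ [] := List.ne_nil_of_mem h.head_mem
  refine ⟨(SimpleGraph.Walk.ofSupport p hne h.chain).copy ?_ ?_, ?_, ?_⟩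
  · have := h.head
    rw [List.head?_eq_some_head hne] at this
    exact Option.some_injective _ this
  · have := h.last
    rw [List.getLast?_eq_some_getLast hne] at this
    exact Option.some_injective _ this
  · rw [SimpleGraph.Walk.isPath_def]
    simpa using h.nodup
  · simp

theorem IsP.length_eq {S U : Finset V} {u v : V} {p : List V} (h : IsP G U u v p) :
    p.length = tc S p + (p.toFinset ∩ S).card := by
  rw [← List.toFinset_card_of_nodup h.nodup]
  exact (Finset.card_sdiff_add_card_inter _ _).symm

theorem rhoEdges_pair_le {V : Type} [Fintype V] [DecidableEq V] (G : SimpleGraph V) (x y : V) :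
    rhoEdges G {x, y} ≤ (nb G (Finset.univ \ {y}) x).card + (nb G Finset.univ y).card := by
  unfold rhoEdges
  refine le_trans ?_ (add_le_add (Finset.card_image_le (f := fun z => s(x, z)))
    (Finset.card_image_le (f := fun z => s(y, z))))
  refine le_trans ?_ (Finset.card_union_le _ _)
  rw [← Set.ncard_coe_finset]
  refine Set.ncard_le_ncard ?_ (Finset.finite_toSet _)
  rintro e ⟨he, z, hz, hze⟩
  obtain ⟨t, rfl⟩ := Sym2.mem_iff_exists.1 hze
  rw [SimpleGraph.mem_edgeSet] at he
  simp only [Finset.coe_union, Finset.coe_image, Set.mem_union, Set.mem_image, Finset.mem_coe,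
    mem_nb, Finset.mem_univ, true_and, Finset.mem_sdiff, Finset.mem_singleton]
  rcases hz with rfl | rfl
  · by_cases hty : t = y
    · subst hty
      exact Or.inr ⟨z, he.symm, Sym2.eq_swap⟩
    · exact Or.inl ⟨t, ⟨hty, he⟩, rfl⟩
  · exact Or.inr ⟨t, he, rfl⟩

end BipPath

open BipPath in
/-- **Lemma (Li–Ning).** Let `G = (X,Y;E)` be a 2-connected balanced bipartite graph with
`ρ({x,y}) ≥ ρ` for every `(x,y) ∈ (X,Y)`. Then for any two (distinct) vertices
`x₁, x₂ ∈ X`, `G` has an `(x₁,x₂)`-path of order at least `ρ`. -/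
theorem stmt_12 {V : Type} [Fintype V] [DecidableEq V]
    (G : SimpleGraph V) (X Y : Finset V) (ρ : ℕ)
    (hpart : ∀ v : V, v ∈ X ∨ v ∈ Y) (hdisj : Disjoint X Y)
    (hbip : ∀ u v : V, G.Adj u v → (u ∈ X ∧ v ∈ Y) ∨ (u ∈ Y ∧ v ∈ X))
    (hbal : X.card = Y.card)
    (h2conn : 3 ≤ Fintype.card V ∧ G.Connected ∧
      ∀ v : V, (G.induce {u : V | u ≠ v}).Connected)
    (hrho : ∀ x ∈ X, ∀ y ∈ Y, ρ ≤ rhoEdges G {x, y})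
    (x₁ x₂ : V) (hx₁ : x₁ ∈ X) (hx₂ : x₂ ∈ X) (hne : x₁ ≠ x₂) :
    ∃ p : G.Walk x₁ x₂, p.IsPath ∧ ρ ≤ p.support.length := by
  have hconn := conn2_univ h2conn.2.1 h2conn.2.2
  have hXY : ∀ v, v ∈ X → v ∉ Y := fun v hv => Finset.disjoint_left.1 hdisj hv
  have hY1 := hXY x₁ hx₁
  have hY2 := hXY x₂ hx₂
  have eX : Finset.univ \ Y = X := by
    ext z; have := hpart z; have := hXY z; simp; tauto
  have eY : Finset.univ \ X = Y := by
    ext z; have := hpart z; have := hXY z; simp; tauto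
  have hbY : ∀ a b, G.Adj a b → (a ∈ Y ↔ b ∉ Y) := by
    intro a b hab
    have := hbip a b hab; have := hXY a; have := hXY b; tauto
  have hbX : ∀ a b, G.Adj a b → (a ∈ X ↔ b ∉ X) := by
    intro a b hab
    have := hbip a b hab; have := hXY a; have := hXY b; tauto
  have hnbX : ∀ y ∈ Y, nb G Finset.univ y ⊆ X := by
    intro y hy z hz
    rw [← eX]
    simpa using (hbY _ _ (mem_nb.1 hz).2).1 hy
  suffices h : ∃ p, IsP G Finset.univ x₁ x₂ p ∧ ρ ≤ p.length by
    obtain ⟨p, hp, hl⟩ := h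
    obtain ⟨q, hq, rfl⟩ := hp.exists_walk
    exact ⟨q, hq, hl⟩
  by_cases hdeg : ∀ y ∈ Y, ρ / 2 + 1 ≤ (nb G Finset.univ y).card
  · obtain ⟨y, hy⟩ : Y.Nonempty := Finset.card_pos.1 (hbal ▸ Finset.card_pos.2 ⟨x₁, hx₁⟩)
    obtain ⟨p, hp, hpk⟩ := good_of_conn2 hbY Finset.univ hconn x₁ x₂ ∅ (ρ / 2 + 1)
      (by simp) (by simp) hne (by simp) (by simp) (by simp) (by simp)
      (fun x _ hx _ => by simpa using hdeg x hx)
      (by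
        rw [Finset.sdiff_empty, eX]
        exact (hdeg y hy).trans (Finset.card_le_card (hnbX y hy)))
      (by simp [eX, hY1, hY2, hbal])
    have h1 := tc_add_one hbY hp
    have h2 := hp.length_eq (S := Y)
    simp only [hY1, hY2, if_false] at h1
    exact ⟨p, hp, by omega⟩
  · push Not at hdeg
    obtain ⟨y, hy, hyd⟩ := hdeg
    have hyX : y ∉ X := fun h => hXY y h hy
    have hXd : ∀ x ∈ X, ρ - ρ / 2 ≤ (nb G (Finset.univ \ {y}) x).card := by
      intro x hx
      have h1 := hrho x hx y hy
      have h2 := rhoEdges_pair_le G x y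
      omega
    have hYy : 1 ≤ Y.card := Finset.card_pos.2 ⟨y, hy⟩
    have hcY : (Y \ {y}).card = Y.card - 1 := by
      rw [Finset.sdiff_singleton_eq_erase, Finset.card_erase_of_mem hy]
    obtain ⟨p, hp, hpk⟩ := good_of_conn2 hbX Finset.univ hconn x₁ x₂ {y} (ρ - ρ / 2)
      (by simp) (by simp) hne (by simp) (by simpa using hyX) (by simp) (fun _ => ⟨hx₁, hx₂⟩)
      (fun x _ hx _ => hXd x hx)
      (by
        rw [eY]
        refine (hXd x₁ hx₁).trans (Finset.card_le_card fun z hz => ?_)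
        simp only [mem_nb, Finset.mem_sdiff] at hz ⊢
        refine ⟨?_, hz.1.2⟩
        rw [← eY]
        simpa using (hbX _ _ hz.2).1 hx₁)
      (by
        rw [eY, hcY, Finset.univ_inter]
        omega)
    have h1 := tc_add_one hbX hp
    have h2 := hp.length_eq (S := X)
    simp only [hx₁, hx₂, if_true] at h1
    exact ⟨p, hp, by omega⟩
end
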